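/- Outer-planarity is minor-monotone among planar graphs: if a planar graph H is a minor of a planar graph G, then op(H) ≤ op(G). -/

import Mathlib

open SimpleGraph

/-- `H` is a minor of `G`: `H` can be obtained from a subgraph of `G` by contracting
edges; equivalently there is a family of disjoint nonempty connected branch sets in `G`,
one for each vertex of `H`, such that every edge of `H` is witnessed by an edge of `G`
between the corresponding branch sets. -/
def IsMinor {α β : Type*} (H : SimpleGraph α) (G : SimpleGraph β) : Prop :=
  ∃ B : α → Set β,
    (∀ a, (B a).Nonempty) ∧
    (∀ a, (G.induce (B a)).Connected) ∧
    (Pairwise fun a b => Disjoint (B a) (B b)) ∧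
    (∀ a b, H.Adj a b → ∃ x ∈ B a, ∃ y ∈ B b, G.Adj x y)

/-- A planar straight-line drawing of `G` in the plane: vertices at distinct points,
edges drawn as straight-line segments, no edge passing through a non-incident vertex,
distinct edges meeting only in common endpoints.  (By Fáry's theorem every planar
embedding is realized by such a drawing.) -/
def IsPlanarDrawing {V : Type*} (G : SimpleGraph V) (pos : V → ℝ × ℝ) : Prop :=
  Function.Injective pos ∧
  (∀ u v w : V, G.Adj u v → w ≠ u → w ≠ v → pos w ∉ segment ℝ (pos u) (pos v)) ∧
  (∀ u v x y : V, G.Adj u v → G.Adj x y → s(u, v) ≠ s(x, y) →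
    ∀ p : ℝ × ℝ, p ∈ segment ℝ (pos u) (pos v) → p ∈ segment ℝ (pos x) (pos y) →
      (p = pos u ∨ p = pos v) ∧ (p = pos x ∨ p = pos y))

/-- The part of the drawing (points and edge segments) spanned by a vertex set `S`. -/
def drawnSet {V : Type*} (G : SimpleGraph V) (pos : V → ℝ × ℝ) (S : Set V) :
    Set (ℝ × ℝ) :=
  (pos '' S) ∪
    ⋃ (u : V) (v : V) (_ : u ∈ S ∧ v ∈ S ∧ G.Adj u v), segment ℝ (pos u) (pos v)

/-- The outer (unbounded) face of a closed set `X` in the plane: the union of the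
unbounded connected components of the complement of `X`. -/
def unboundedFace (X : Set (ℝ × ℝ)) : Set (ℝ × ℝ) :=
  {p | p ∉ X ∧ ¬Bornology.IsBounded (connectedComponentIn Xᶜ p)}

/-- The vertices of `S` incident to the outer face of the sub-drawing induced by `S`. -/
def outerVertices {V : Type*} (G : SimpleGraph V) (pos : V → ℝ × ℝ) (S : Set V) :
    Set V :=
  {v | v ∈ S ∧ pos v ∈ closure (unboundedFace (drawnSet G pos S))}

/-- Iteratively delete all vertices on the outer face of the remaining drawing;
`drawingPeel G pos k` is what remains after `k` rounds. -/
def drawingPeel {V : Type*} (G : SimpleGraph V) (pos : V → ℝ × ℝ) : ℕ → Set V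
  | 0 => Set.univ
  | k + 1 => drawingPeel G pos k \ outerVertices G pos (drawingPeel G pos k)

/-- The outer-planarity of a planar graph: the least number of rounds of outer-face
vertex deletion, over all planar (straight-line) drawings of `G`. -/
noncomputable def outerplanarity {V : Type*} (G : SimpleGraph V) : ℕ :=
  sInf {k | ∃ pos : V → ℝ × ℝ, IsPlanarDrawing G pos ∧ drawingPeel G pos k = ∅}


namespace OPM

/-- A combinatorial simple triangulation of the sphere on the vertex set `P`;
`F` is the set of its oriented faces (closed under rotation). -/
structure Tri {X : Type*} (P : Finset X) (F : Finset (X × X × X)) : Prop where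
  mem : ∀ {u v w}, (u, v, w) ∈ F → u ∈ P
  ne : ∀ {u v w}, (u, v, w) ∈ F → u ≠ v
  cyc : ∀ {u v w}, (u, v, w) ∈ F → (v, w, u) ∈ F
  uniq : ∀ {u v w w'}, (u, v, w) ∈ F → (u, v, w') ∈ F → w = w'
  rev : ∀ {u v w}, (u, v, w) ∈ F → ∃ w', (v, u, w') ∈ F
  link : ∀ (v : X) (S : Set X), (∀ n n', (v, n, n') ∈ F → n ∈ S → n' ∈ S) →
    ∀ n n1 m m1, (v, n, n1) ∈ F → (v, m, m1) ∈ F → n ∈ S → m ∈ S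
  conn : ∀ (S : Set X), (∀ u v w, (u, v, w) ∈ F → u ∈ S → v ∈ S) →
    ∀ u v, u ∈ P → v ∈ P → u ∈ S → v ∈ S
  euler : F.card + 12 ≤ 6 * P.card

/-- Adjacency in the 1-skeleton. -/
def Adj {X : Type*} (F : Finset (X × X × X)) (u v : X) : Prop := ∃ w, (u, v, w) ∈ F

section basics
variable {X : Type*} {P : Finset X} {F : Finset (X × X × X)}

lemma Tri.adj_symm (T : Tri P F) {u v : X} (h : Adj F u v) : Adj F v u := by
  obtain ⟨w, hw⟩ := h
  exact T.rev hw

lemma Tri.adj_ne (T : Tri P F) {u v : X} (h : Adj F u v) : u ≠ v := by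
  obtain ⟨w, hw⟩ := h
  exact T.ne hw

lemma Tri.adj_mem (T : Tri P F) {u v : X} (h : Adj F u v) : u ∈ P := by
  obtain ⟨w, hw⟩ := h
  exact T.mem hw

lemma Tri.cyc2 (T : Tri P F) {u v w : X} (h : (u, v, w) ∈ F) : (w, u, v) ∈ F :=
  T.cyc (T.cyc h)

lemma Tri.ne2 (T : Tri P F) {u v w : X} (h : (u, v, w) ∈ F) : v ≠ w := T.ne (T.cyc h)
lemma Tri.ne3 (T : Tri P F) {u v w : X} (h : (u, v, w) ∈ F) : w ≠ u := T.ne (T.cyc2 h)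

lemma Tri.prev_uniq (T : Tri P F) {v n n' m : X} (h : (v, n, m) ∈ F) (h' : (v, n', m) ∈ F) :
    n = n' := T.uniq (T.cyc2 h) (T.cyc2 h')

lemma Tri.prev (T : Tri P F) {v n : X} (h : Adj F v n) : ∃ n0, (v, n0, n) ∈ F := by
  obtain ⟨w, hw⟩ := T.adj_symm h
  exact ⟨w, T.cyc hw⟩

lemma Tri.next_adj (T : Tri P F) {v n n' : X} (h : (v, n, n') ∈ F) : Adj F v n' :=
  T.adj_symm ⟨n, T.cyc2 h⟩

lemma Tri.exists_adj (T : Tri P F) {u : X} (hu : u ∈ P) : ∃ v, Adj F u v := by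
  by_contra hcon
  push Not at hcon
  have h2 : 2 ≤ P.card := by have := T.euler; omega
  obtain ⟨v, hv, hvu⟩ := Finset.exists_mem_ne (s := P) (by omega) u
  have := T.conn {u} (by
    intro a b w h ha
    rcases ha with rfl
    exact absurd ⟨w, h⟩ (hcon b)) u v hu hv rfl
  exact hvu this

/-- if both sides of an edge see the same vertex there are only three vertices -/
lemma Tri.opp_ne (T : Tri P F) (h4 : 4 ≤ P.card) {u v w w' : X} (h : (u, v, w) ∈ F)
    (h' : (v, u, w') ∈ F) : w ≠ w' := by
  rintro rfl
  have key : ∀ a b c : X, (a, b, c) ∈ F → (b, a, c) ∈ F → ∀ z, Adj F a z → z = b ∨ z = c := by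
    intro a b c h1 h2 z ⟨z1, hz⟩
    have := T.link a {b, c} (by
      intro n n' hn hnS
      rcases hnS with rfl | rfl
      · right; exact T.uniq hn h1
      · left; exact T.uniq hn (T.cyc h2)) b c z z1 h1 hz (Or.inl rfl)
    simpa using this
  have hsub : P ⊆ ({u, v, w} : Set X).toFinite.toFinset := by
    intro z hz
    have := T.conn ({u, v, w} : Set X) (by
      intro a b c hab ha
      rcases ha with rfl | rfl | rfl
      · rcases key _ _ _ h h' b ⟨c, hab⟩ with rfl | rfl <;> simp
      · rcases key _ _ _ h' h b ⟨c, hab⟩ with rfl | rfl <;> simp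
      · rcases key _ _ _ (T.cyc2 h) (T.cyc h') b ⟨c, hab⟩ with rfl | rfl <;> simp) u z (T.mem h) hz (Or.inl rfl)
    simpa using this
  have hc := Finset.card_le_card hsub
  have : (({u, v, w} : Set X).toFinite.toFinset).card ≤ 3 := by
    classical
    have e : ({u, v, w} : Set X).toFinite.toFinset = ({u, v, w} : Finset X) := by ext; simp
    rw [e]; exact Finset.card_le_three
  omega

end basics
end OPM


namespace OPM
section split
variable {X : Type*} [DecidableEq X] {P : Finset X} {F : Finset (X × X × X)}

/-- the directed edges of the boundary of the quadrilateral -/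
def Q4 (u v w w' b c : X) : Prop :=
  (b = w ∧ c = u) ∨ (b = v ∧ c = w) ∨ (b = w' ∧ c = v) ∨ (b = u ∧ c = w')

/-- `(a,b)` is not the edge `uv` -/
def NE (u v a b : X) : Prop := ¬ (a = u ∧ b = v) ∧ ¬ (a = v ∧ b = u)

/-- faces after splitting the edge `uv` (between `uvw` and `vuw'`) by a new vertex `m` -/
noncomputable def splitF (F : Finset (X × X × X)) (u v w w' m : X) : Finset (X × X × X) :=
  open Classical in
  F.filter (fun t => NE u v t.1 t.2.1 ∧ NE u v t.2.1 t.2.2 ∧ NE u v t.2.2 t.1) ∪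
  {(m, w, u), (m, v, w), (m, w', v), (m, u, w'),
   (w, u, m), (v, w, m), (w', v, m), (u, w', m),
   (u, m, w), (w, m, v), (v, m, w'), (w', m, u)}

lemma mem_splitF {u v w w' m a b c : X} : (a, b, c) ∈ splitF F u v w w' m ↔
    ((a, b, c) ∈ F ∧ NE u v a b ∧ NE u v b c ∧ NE u v c a) ∨
    (a = m ∧ Q4 u v w w' b c) ∨ (c = m ∧ Q4 u v w w' a b) ∨ (b = m ∧ Q4 u v w w' c a) := by
  simp only [splitF, Finset.mem_union, Finset.mem_filter, Finset.mem_insert,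
    Finset.mem_singleton, Prod.mk.injEq]
  refine or_congr Iff.rfl ?_
  unfold Q4
  constructor
  · rintro (h | h | h | h | h | h | h | h | h | h | h | h) <;> simp [h]
  · rintro (⟨rfl, h | h | h | h⟩ | ⟨rfl, h | h | h | h⟩ | ⟨rfl, h | h | h | h⟩) <;> simp [h]

variable {u v w w' m : X}

lemma card_splitF (T : Tri P F) (h : (u, v, w) ∈ F)
    (h' : (v, u, w') ∈ F) (hw : w ≠ w') : (splitF F u v w w' m).card ≤ F.card + 6 := by
  classical
  have d1 := T.ne h; have d2 := T.ne2 h; have d3 := T.ne3 h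
  have d4 := T.ne2 h'; have d5 := T.ne3 h'
  let R : Finset (X × X × X) := {(u,v,w),(v,w,u),(w,u,v),(v,u,w'),(u,w',v),(w',v,u)}
  have hR : R.card = 6 := by
    simp only [R]
    repeat rw [Finset.card_insert_of_notMem (by simp [Prod.mk.injEq]; grind)]
    simp
  have hRF : R ⊆ F := by
    intro t ht
    simp only [R, Finset.mem_insert, Finset.mem_singleton] at ht
    rcases ht with rfl | rfl | rfl | rfl | rfl | rfl
    · exact h
    · exact T.cyc h
    · exact T.cyc2 h
    · exact h'
    · exact T.cyc h'
    · exact T.cyc2 h'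
  have h1 : (F.filter (fun t => NE u v t.1 t.2.1 ∧ NE u v t.2.1 t.2.2 ∧ NE u v t.2.2 t.1))
      ⊆ F \ R := by
    rintro ⟨a, b, c⟩ ht
    rw [Finset.mem_filter] at ht
    simp only [NE] at ht
    simp only [R, Finset.mem_sdiff, Finset.mem_insert, Finset.mem_singleton, Prod.mk.injEq]
    refine ⟨ht.1, ?_⟩
    grind
  have h2 := Finset.card_le_card h1
  rw [Finset.card_sdiff_of_subset hRF] at h2
  have h3 := Finset.card_le_card hRF
  unfold splitF
  refine (Finset.card_union_le _ _).trans ?_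
  have h4 : ({(m, w, u), (m, v, w), (m, w', v), (m, u, w'),
   (w, u, m), (v, w, m), (w', v, m), (u, w', m),
   (u, m, w), (w, m, v), (v, m, w'), (w', m, u)} : Finset (X × X × X)).card ≤ 12 := by
    repeat refine (Finset.card_insert_le _ _).trans (Nat.succ_le_succ ?_)
    simp
  omega

set_option maxHeartbeats 1000000 in
theorem Tri.split (T : Tri P F) (h : (u, v, w) ∈ F)
    (h' : (v, u, w') ∈ F) (hw : w ≠ w') (hm : m ∉ P) :
    Tri (insert m P) (splitF F u v w w' m) := by
  have d1 := T.ne h; have d2 := T.ne2 h; have d3 := T.ne3 h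
  have d4 := T.ne2 h'; have d5 := T.ne3 h'
  have mu := T.mem h; have mv := T.mem h'; have mw := T.mem (T.cyc2 h)
  have mw' := T.mem (T.cyc2 h')
  have c1 := T.cyc h; have c2 := T.cyc2 h; have c3 := T.cyc h'; have c4 := T.cyc2 h'
  have em : ∀ {a b c}, (a, b, c) ∈ F → a ≠ m ∧ b ≠ m ∧ c ≠ m := by
    intro a b c habc
    have := T.mem habc; have := T.mem (T.cyc habc); have := T.mem (T.cyc2 habc)
    refine ⟨?_, ?_, ?_⟩ <;> rintro rfl <;> contradiction
  have mne : m ≠ u ∧ m ≠ v ∧ m ≠ w ∧ m ≠ w' := by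
    refine ⟨?_, ?_, ?_, ?_⟩ <;> rintro rfl <;> contradiction
  have U := @Tri.uniq _ _ _ T
  -- faces containing u v edge
  have rem : ∀ {a b c}, (a, b, c) ∈ F → ¬ (NE u v a b ∧ NE u v b c ∧ NE u v c a) →
      (¬ NE u v a b) ∨ Q4 u v w w' a b := by
    intro a b c habc hN
    have e1 := T.cyc habc; have e2 := T.cyc2 habc
    unfold NE at *
    unfold Q4
    grind
  have keep : ∀ {a b c}, (a, b, c) ∈ F → NE u v a b → ∃ c', (a, b, c') ∈ splitF F u v w w' m := by
    intro a b c habc hN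
    by_cases hq : Q4 u v w w' a b
    · exact ⟨m, by rw [mem_splitF]; right; right; left; exact ⟨rfl, hq⟩⟩
    · refine ⟨c, ?_⟩
      rw [mem_splitF]; left
      refine ⟨habc, ?_⟩
      by_contra hcon
      rcases rem habc hcon with h | h <;> contradiction
  have Qf : ∀ {b c c'}, Q4 u v w w' b c → Q4 u v w w' b c' → c = c' := by
    unfold Q4; grind
  have Qi : ∀ {b c c'}, Q4 u v w w' c b → Q4 u v w w' c' b → c = c' := by
    unfold Q4; grind
  have QF : ∀ {a b c}, Q4 u v w w' a b → (a, b, c) ∈ F → ¬ (NE u v b c ∧ NE u v c a) := by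
    intro a b c hq hF hN
    rcases hq with ⟨rfl, rfl⟩ | ⟨rfl, rfl⟩ | ⟨rfl, rfl⟩ | ⟨rfl, rfl⟩
    · exact hN.1.1 ⟨rfl, T.uniq hF c2⟩
    · exact hN.2.1 ⟨T.uniq hF c1, rfl⟩
    · exact hN.1.2 ⟨rfl, T.uniq hF c4⟩
    · exact hN.2.2 ⟨T.uniq hF c3, rfl⟩
  have Qm : ∀ {a b}, Q4 u v w w' a b → a ≠ m ∧ b ≠ m ∧ a ≠ b ∧ a ∈ P ∧ NE u v a b := by
    unfold Q4 NE; grind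
  have QE : ∀ {a b}, Q4 u v w w' a b → ∃ c, (a, b, c) ∈ F := by
    intro a b hq
    rcases hq with ⟨rfl, rfl⟩ | ⟨rfl, rfl⟩ | ⟨rfl, rfl⟩ | ⟨rfl, rfl⟩ <;> exact ⟨_, by assumption⟩
  have Qs : ∀ {a b}, Q4 u v w w' a b → (∃ c, Q4 u v w w' b c) ∧ (∃ c, Q4 u v w w' c a) := by
    unfold Q4; grind
  have NEs : ∀ {a b}, NE u v a b → NE u v b a := by unfold NE; tauto
  have cyc' : ∀ {a b c}, (a, b, c) ∈ splitF F u v w w' m → (b, c, a) ∈ splitF F u v w w' m := by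
    intro a b c habc
    rw [mem_splitF] at habc ⊢
    have := @Tri.cyc _ _ _ T a b c
    tauto
  refine ⟨?_, ?_, cyc', ?_, ?_, ?_, ?_, ?_⟩
  · intro a b c habc
    rw [mem_splitF] at habc
    rw [Finset.mem_insert]
    rcases habc with ⟨habc, -⟩ | ⟨rfl, h⟩ | ⟨rfl, h⟩ | ⟨rfl, h⟩
    · right; exact T.mem habc
    · left; rfl
    · right; exact (Qm h).2.2.2.1
    · right
      obtain ⟨⟨d, hd⟩, -⟩ := Qs h
      exact (Qm hd).2.2.2.1
  · intro a b c habc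
    rw [mem_splitF] at habc
    rcases habc with ⟨habc, -⟩ | ⟨rfl, h⟩ | ⟨rfl, h⟩ | ⟨rfl, h⟩
    · exact T.ne habc
    · exact (Qm h).1.symm
    · exact (Qm h).2.2.1
    · exact (Qm h).2.1
  · intro a b c c' h1 h2
    rw [mem_splitF] at h1 h2
    rcases h1 with ⟨h1, k1⟩ | ⟨k1, h1⟩ | ⟨k1, h1⟩ | ⟨k1, h1⟩ <;>
    rcases h2 with ⟨h2, k2⟩ | ⟨k2, h2⟩ | ⟨k2, h2⟩ | ⟨k2, h2⟩
    · exact T.uniq h1 h2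
    · exact absurd k2 (em h1).1
    · exact absurd k1.2 (QF h2 h1)
    · exact absurd k2 (em h1).2.1
    · exact absurd k1 (em h2).1
    · exact Qf h1 h2
    · exact absurd k1 (Qm h2).1
    · exact absurd k2 (Qm h1).1
    · exact absurd k2.2 (QF h1 h2)
    · exact absurd k2 (Qm h1).1
    · rw [k1, k2]
    · exact absurd k2 (Qm h1).2.1
    · exact absurd k1 (em h2).2.1
    · exact absurd k1 (Qm h2).1
    · exact absurd k1 (Qm h2).2.1
    · exact Qi h1 h2
  · intro a b c habc
    rw [mem_splitF] at habc
    rcases habc with ⟨habc, k⟩ | ⟨rfl, h⟩ | ⟨rfl, h⟩ | ⟨rfl, h⟩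
    · obtain ⟨d, hd⟩ := T.rev habc
      exact keep hd (NEs k.1)
    · obtain ⟨-, ⟨d, hd⟩⟩ := Qs h
      exact ⟨d, by rw [mem_splitF]; right; right; right; exact ⟨rfl, hd⟩⟩
    · obtain ⟨d, hd⟩ := QE h
      obtain ⟨e, he⟩ := T.rev hd
      exact keep he (NEs (Qm h).2.2.2.2)
    · obtain ⟨⟨d, hd⟩, -⟩ := Qs h
      exact ⟨d, by rw [mem_splitF]; right; left; exact ⟨rfl, hd⟩⟩
  · intro z S hS n n1 k k1 hn hk hnS
    by_cases hz : z = m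
    · subst hz
      have hS' : ∀ a b, Q4 u v w w' a b → a ∈ S → b ∈ S := by
        intro a b hab
        exact hS a b (by rw [mem_splitF]; right; left; exact ⟨rfl, hab⟩)
      have hq : ∀ {a b}, (z, a, b) ∈ splitF F u v w w' z → Q4 u v w w' a b := by
        intro a b hab
        rw [mem_splitF] at hab
        rcases hab with ⟨hab, -⟩ | ⟨-, h⟩ | ⟨rfl, h⟩ | ⟨rfl, h⟩
        · exact absurd rfl (em hab).1
        · exact h
        · exact absurd rfl (Qm h).1
        · exact absurd rfl (Qm h).2.1
      have q1 := hq hn; have q2 := hq hk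
      have s1 : w ∈ S → u ∈ S := hS' w u (Or.inl ⟨rfl, rfl⟩)
      have s2 : v ∈ S → w ∈ S := hS' v w (Or.inr (Or.inl ⟨rfl, rfl⟩))
      have s3 : w' ∈ S → v ∈ S := hS' _ _ (Or.inr (Or.inr (Or.inl ⟨rfl, rfl⟩)))
      have s4 : u ∈ S → w' ∈ S := hS' _ _ (Or.inr (Or.inr (Or.inr ⟨rfl, rfl⟩)))
      unfold Q4 at q1 q2
      have hu : u ∈ S := by
        rcases q1 with ⟨rfl, -⟩ | ⟨rfl, -⟩ | ⟨rfl, -⟩ | ⟨rfl, -⟩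
        · exact s1 hnS
        · exact s1 (s2 hnS)
        · exact s1 (s2 (s3 hnS))
        · exact hnS
      rcases q2 with ⟨rfl, -⟩ | ⟨rfl, -⟩ | ⟨rfl, -⟩ | ⟨rfl, -⟩
      · exact s2 (s3 (s4 hu))
      · exact s3 (s4 hu)
      · exact s4 hu
      · exact hu
    · have L := T.link z {n | (NE u v z n ∧ n ∈ S) ∨ (¬ NE u v z n ∧ m ∈ S)} (by
        intro a b hab haS
        simp only [Set.mem_setOf_eq] at haS ⊢
        by_cases hN : NE u v z a ∧ NE u v a b ∧ NE u v b z
        · rcases haS with ⟨-, haS⟩ | ⟨haS, -⟩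
          · left
            refine ⟨NEs hN.2.2, hS a b (by rw [mem_splitF]; left; exact ⟨hab, hN⟩) haS⟩
          · exact absurd hN.1 haS
        · have r1 := rem hab hN
          have r2 := rem (T.cyc2 hab) (fun hh => hN ⟨hh.2.1, hh.2.2, hh.1⟩)
          rcases haS with ⟨ha, haS⟩ | ⟨ha, haS⟩
          · have hq : Q4 u v w w' z a := r1.resolve_left (fun hh => hh ha)
            have hmS : m ∈ S := hS a m (by
              rw [mem_splitF]; right; right; left; exact ⟨rfl, hq⟩) haS
            by_cases hb : NE u v z b
            · left
              refine ⟨hb, hS m b ?_ hmS⟩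
              rw [mem_splitF]; right; right; right
              refine ⟨rfl, ?_⟩
              exact r2.resolve_left (fun hh => hh (NEs hb))
            · right; exact ⟨hb, hmS⟩
          · have hq : Q4 u v w w' b z := by
              rcases r2 with r2 | r2
              · exfalso; revert ha r2; have := T.ne2 hab; unfold NE; grind
              · exact r2
            left
            refine ⟨NEs (Qm hq).2.2.2.2, hS m b ?_ haS⟩
            rw [mem_splitF]; right; right; right; exact ⟨rfl, hq⟩)
      -- description of neighbours
      have nb : ∀ {a b}, (z, a, b) ∈ splitF F u v w w' m →
          (a ≠ m ∧ NE u v z a ∧ ∃ c, (z, a, c) ∈ F) ∨ (a = m ∧ Q4 u v w w' b z) := by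
        intro a b hab
        rw [mem_splitF] at hab
        rcases hab with ⟨hab, k⟩ | ⟨rfl, h⟩ | ⟨rfl, h⟩ | ⟨rfl, h⟩
        · left; exact ⟨(em hab).2.1, k.1, _, hab⟩
        · exact absurd rfl hz
        · left; exact ⟨(Qm h).2.1, (Qm h).2.2.2.2, QE h⟩
        · right; exact ⟨rfl, h⟩
      -- from n find a start
      have st : ∃ a c, (z, a, c) ∈ F ∧ ((NE u v z a ∧ a ∈ S) ∨ (¬ NE u v z a ∧ m ∈ S)) := by
        rcases nb hn with ⟨-, hN, c, hc⟩ | ⟨rfl, hq⟩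
        · exact ⟨n, c, hc, Or.inl ⟨hN, hnS⟩⟩
        · have hb : n1 ∈ S := hS n n1 hn hnS
          obtain ⟨c, hc⟩ := QE hq
          obtain ⟨d, hd⟩ := T.rev hc
          exact ⟨n1, d, hd, Or.inl ⟨NEs (Qm hq).2.2.2.2, hb⟩⟩
      obtain ⟨a, c, hac, haS⟩ := st
      rcases nb hk with ⟨-, hN, d, hd⟩ | ⟨rfl, hq⟩
      · have := L a c k d hac hd haS
        simp only [Set.mem_setOf_eq] at this
        exact this.elim (fun hh => hh.2) (fun hh => absurd hN hh.1)
      · obtain ⟨⟨d, hd⟩, -⟩ := Qs hq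
        obtain ⟨e, he⟩ := QE hd
        have := L a c d e hac he haS
        simp only [Set.mem_setOf_eq] at this
        have hN := (Qm hd).2.2.2.2
        have hdS : d ∈ S := this.elim (fun hh => hh.2) (fun hh => absurd hN hh.1)
        exact hS d k (by rw [mem_splitF]; right; right; left; exact ⟨rfl, hd⟩) hdS
  · intro S hS a b ha hb haS
    have s1 : m ∈ S → u ∈ S := hS m u w' (by
      rw [mem_splitF]; right; left; exact ⟨rfl, Or.inr (Or.inr (Or.inr ⟨rfl, rfl⟩))⟩)
    have s2 : u ∈ S → m ∈ S := hS u m w (by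
      rw [mem_splitF]; right; right; right; exact ⟨rfl, Or.inl ⟨rfl, rfl⟩⟩)
    have s3 : m ∈ S → v ∈ S := hS m v w (by
      rw [mem_splitF]; right; left; exact ⟨rfl, (Or.inr (Or.inl ⟨rfl, rfl⟩))⟩)
    have s4 : v ∈ S → m ∈ S := hS v m w' (by
      rw [mem_splitF]; right; right; right; exact ⟨rfl, (Or.inr (Or.inr (Or.inl ⟨rfl, rfl⟩)))⟩)
    have C := T.conn S (by
      intro a b c habc haS
      by_cases hN : NE u v a b
      · obtain ⟨c', hc'⟩ := keep habc hN
        exact hS a b c' hc' haS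
      · unfold NE at hN
        grind)
    rw [Finset.mem_insert] at ha hb
    rcases ha with rfl | ha <;> rcases hb with rfl | hb
    · exact haS
    · exact C u b mu hb (s1 haS)
    · exact s2 (C a u ha mu haS)
    · exact C a b ha hb haS
  · have := card_splitF (m := m) T h h' hw
    rw [Finset.card_insert_of_notMem hm]
    have := T.euler
    omega

set_option maxHeartbeats 1000000 in
/-- adjacency after a split -/
lemma adj_split (T : Tri P F) (h : (u, v, w) ∈ F)
    (h' : (v, u, w') ∈ F) (hw : w ≠ w') (hm : m ∉ P) {a b : X} :
    Adj (splitF F u v w w' m) a b ↔ (Adj F a b ∧ NE u v a b) ∨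
      (a = m ∧ (b = u ∨ b = v ∨ b = w ∨ b = w')) ∨
      (b = m ∧ (a = u ∨ a = v ∨ a = w ∨ a = w')) := by
  have d1 := T.ne h; have d2 := T.ne2 h; have d3 := T.ne3 h
  have d4 := T.ne2 h'; have d5 := T.ne3 h'
  have c1 := T.cyc h; have c2 := T.cyc2 h; have c3 := T.cyc h'; have c4 := T.cyc2 h'
  constructor
  · rintro ⟨c, hc⟩
    rw [mem_splitF] at hc
    rcases hc with ⟨hc, k⟩ | ⟨rfl, hc⟩ | ⟨rfl, hc⟩ | ⟨rfl, hc⟩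
    · left; exact ⟨⟨c, hc⟩, k.1⟩
    · right; left; unfold Q4 at hc; tauto
    · left
      rcases hc with ⟨rfl, rfl⟩ | ⟨rfl, rfl⟩ | ⟨rfl, rfl⟩ | ⟨rfl, rfl⟩ <;>
      refine ⟨⟨_, by assumption⟩, ?_⟩ <;> unfold NE <;> tauto
    · right; right; unfold Q4 at hc; tauto
  · rintro (⟨⟨c, hc⟩, hN⟩ | ⟨rfl, hb⟩ | ⟨rfl, hb⟩)
    · by_cases hq : Q4 u v w w' a b
      · exact ⟨m, by rw [mem_splitF]; right; right; left; exact ⟨rfl, hq⟩⟩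
      · refine ⟨c, ?_⟩
        rw [mem_splitF]; left
        refine ⟨hc, ?_⟩
        have e1 := T.cyc hc; have e2 := T.cyc2 hc
        have U := @Tri.uniq _ _ _ T
        by_contra hcon
        unfold NE at *
        unfold Q4 at hq
        grind
    · unfold Adj
      simp only [mem_splitF]
      unfold Q4
      rcases hb with rfl | rfl | rfl | rfl
      · exact ⟨w', by simp⟩
      · exact ⟨w, by simp⟩
      · exact ⟨u, by simp⟩
      · exact ⟨v, by simp⟩
    · unfold Adj
      simp only [mem_splitF]
      unfold Q4
      rcases hb with rfl | rfl | rfl | rfl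
      · exact ⟨w, by simp⟩
      · exact ⟨w', by simp⟩
      · exact ⟨v, by simp⟩
      · exact ⟨u, by simp⟩

end split
end OPM


namespace OPM
section contract
variable {X : Type*} [DecidableEq X] {P : Finset X} {F : Finset (X × X × X)}

/-- the contraction map -/
def phi (x y z : X) : X := if z = y then x else z

lemma phi_y (x y : X) : phi x y y = x := by simp [phi]
lemma phi_ne {x y z : X} (h : z ≠ y) : phi x y z = z := by simp [phi, h]
lemma phi_cases (x y z : X) : (z = y ∧ phi x y z = x) ∨ (z ≠ y ∧ phi x y z = z) := by
  by_cases h : z = y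
  · left; exact ⟨h, by rw [h, phi_y]⟩
  · right; exact ⟨h, phi_ne h⟩

/-- faces after contracting `y` into `x` -/
def contractF (F : Finset (X × X × X)) (x y : X) : Finset (X × X × X) :=
  (F.image (fun t => (phi x y t.1, phi x y t.2.1, phi x y t.2.2))).filter
    (fun t => t.1 ≠ t.2.1 ∧ t.2.1 ≠ t.2.2 ∧ t.2.2 ≠ t.1)

lemma mem_contractF {x y a b c : X} : (a, b, c) ∈ contractF F x y ↔
    (a ≠ b ∧ b ≠ c ∧ c ≠ a) ∧ ∃ a0 b0 c0, (a0, b0, c0) ∈ F ∧ phi x y a0 = a ∧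
      phi x y b0 = b ∧ phi x y c0 = c := by
  unfold contractF
  rw [Finset.mem_filter, Finset.mem_image, and_comm]
  simp only [Prod.exists, Prod.mk.injEq]

variable {x y p q : X}

lemma keep_contract (T : Tri P F) (hp : (x, y, p) ∈ F) (hq : (y, x, q) ∈ F) (hpq : p ≠ q)
    {a b c : X} (h : (a, b, c) ∈ F) (hab : phi x y a ≠ phi x y b) :
    ∃ c', (phi x y a, phi x y b, c') ∈ contractF F x y := by
  have hxy := T.ne hp
  by_cases hd : phi x y b ≠ phi x y c ∧ phi x y c ≠ phi x y a
  · exact ⟨phi x y c, mem_contractF.2 ⟨⟨hab, hd.1, hd.2⟩, a, b, c, h, rfl, rfl, rfl⟩⟩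
  have n1 := T.ne h; have n2 := T.ne2 h; have n3 := T.ne3 h
  have U := @Tri.uniq _ _ _ T
  have h1 := T.cyc h; have h2 := T.cyc2 h
  have cases4 : (a = y ∧ b = p ∧ c = x) ∨ (a = p ∧ b = x ∧ c = y) ∨ (a = x ∧ b = q ∧ c = y) ∨
      (a = q ∧ b = y ∧ c = x) := by
    unfold phi at *
    grind
  rcases cases4 with ⟨rfl, rfl, rfl⟩ | ⟨rfl, rfl, rfl⟩ | ⟨rfl, rfl, rfl⟩ | ⟨rfl, rfl, rfl⟩
  · clear hd
    obtain ⟨d, hd⟩ := T.rev h1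
    have d1 : d ≠ a := by
      rintro rfl
      exact hpq (T.uniq (T.cyc2 hd) hq)
    refine ⟨d, mem_contractF.2 ⟨?_, c, b, d, hd, ?_, ?_, ?_⟩⟩
    · rw [phi_y, phi_ne n1.symm]; exact ⟨T.ne hd, T.ne2 hd, T.ne3 hd⟩
    · rw [phi_y, phi_ne hxy]
    · rfl
    · rw [phi_ne d1]
  · clear hd
    obtain ⟨d, hd⟩ := T.rev h2
    have d1 : d ≠ b := by
      rintro rfl
      exact hpq (T.uniq (T.cyc hd) hq)
    have d2 := T.ne2 hd
    refine ⟨d, mem_contractF.2 ⟨?_, a, c, d, hd, rfl, ?_, ?_⟩⟩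
    · rw [phi_ne hxy, phi_ne n3.symm]; exact ⟨n1, d1.symm, T.ne3 hd⟩
    · rw [phi_y, phi_ne hxy]
    · rw [phi_ne d2.symm]
  · clear hd
    obtain ⟨d, hd⟩ := T.rev h1
    have d1 : d ≠ a := by
      rintro rfl
      exact hpq (T.uniq hp (T.cyc2 hd))
    have d2 := T.ne3 hd
    refine ⟨d, mem_contractF.2 ⟨?_, c, b, d, hd, ?_, rfl, ?_⟩⟩
    · rw [phi_ne hxy, phi_ne n2]; exact ⟨n1, T.ne2 hd, d1⟩
    · rw [phi_y, phi_ne hxy]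
    · rw [phi_ne d2]
  · clear hd
    obtain ⟨d, hd⟩ := T.rev h2
    have d1 : d ≠ b := by
      rintro rfl
      exact hpq (T.uniq hp (T.cyc hd))
    refine ⟨d, mem_contractF.2 ⟨?_, a, c, d, hd, rfl, ?_, ?_⟩⟩
    · rw [phi_y, phi_ne n1]; exact ⟨n3.symm, T.ne2 hd, T.ne3 hd⟩
    · rw [phi_y, phi_ne hxy]
    · rw [phi_ne d1]

lemma adj_contract (T : Tri P F) (hp : (x, y, p) ∈ F) (hq : (y, x, q) ∈ F) (hpq : p ≠ q)
    {a b : X} : Adj (contractF F x y) a b ↔ a ≠ b ∧ ∃ a0 b0, Adj F a0 b0 ∧ phi x y a0 = a ∧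
      phi x y b0 = b := by
  constructor
  · rintro ⟨c, hc⟩
    obtain ⟨hd, a0, b0, c0, h, h1, h2, -⟩ := mem_contractF.1 hc
    exact ⟨hd.1, a0, b0, ⟨c0, h⟩, h1, h2⟩
  · rintro ⟨hab, a0, b0, ⟨c0, h⟩, rfl, rfl⟩
    exact keep_contract T hp hq hpq h hab

lemma card_contractF (T : Tri P F) (hp : (x, y, p) ∈ F) (hq : (y, x, q) ∈ F) :
    (contractF F x y).card + 6 ≤ F.card := by
  have d1 := T.ne hp; have d2 := T.ne2 hp; have d3 := T.ne3 hp
  have d4 := T.ne2 hq; have d5 := T.ne3 hq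
  let R : Finset (X × X × X) := {(x,y,p),(y,p,x),(p,x,y),(y,x,q),(x,q,y),(q,y,x)}
  have hR : R.card = 6 := by
    simp only [R]
    repeat rw [Finset.card_insert_of_notMem (by simp [Prod.mk.injEq]; grind)]
    simp
  have hRF : R ⊆ F := by
    intro t ht
    simp only [R, Finset.mem_insert, Finset.mem_singleton] at ht
    rcases ht with rfl | rfl | rfl | rfl | rfl | rfl
    · exact hp
    · exact T.cyc hp
    · exact T.cyc2 hp
    · exact hq
    · exact T.cyc hq
    · exact T.cyc2 hq
  have h1 : contractF F x y ⊆ (F \ R).image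
      (fun t => (phi x y t.1, phi x y t.2.1, phi x y t.2.2)) := by
    rintro ⟨a, b, c⟩ ht
    obtain ⟨hd, a0, b0, c0, h, rfl, rfl, rfl⟩ := mem_contractF.1 ht
    rw [Finset.mem_image]
    refine ⟨(a0, b0, c0), ?_, rfl⟩
    rw [Finset.mem_sdiff]
    refine ⟨h, ?_⟩
    simp only [R, Finset.mem_insert, Finset.mem_singleton, Prod.mk.injEq]
    unfold phi at hd
    grind
  have h2 := (Finset.card_le_card h1).trans Finset.card_image_le
  rw [Finset.card_sdiff_of_subset hRF] at h2
  have h3 := Finset.card_le_card hRF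
  omega

set_option maxHeartbeats 1000000 in
theorem Tri.contract (T : Tri P F) (hp : (x, y, p) ∈ F) (hq : (y, x, q) ∈ F) (hpq : p ≠ q)
    (hc : ∀ z, Adj F x z → Adj F y z → z = p ∨ z = q) :
    Tri (P.erase y) (contractF F x y) := by
  have hxy := T.ne hp
  have hyp := T.cyc hp; have hpx := T.cyc2 hp; have hxq := T.cyc hq; have hqy := T.cyc2 hq
  have d1 := T.ne hp; have d2 := T.ne2 hp; have d3 := T.ne3 hp
  have d4 := T.ne2 hq; have d5 := T.ne3 hq
  refine ⟨?_, ?_, ?_, ?_, ?_, ?_, ?_, ?_⟩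
  · intro a b c hg
    obtain ⟨hd, a0, b0, c0, h, rfl, rfl, rfl⟩ := mem_contractF.1 hg
    rw [Finset.mem_erase]
    rcases phi_cases x y a0 with ⟨h1, h2⟩ | ⟨h1, h2⟩ <;> rw [h2]
    · exact ⟨hxy, T.mem hp⟩
    · exact ⟨h1, T.mem h⟩
  · intro a b c h
    exact (mem_contractF.1 h).1.1
  · intro a b c hg
    obtain ⟨hd, a0, b0, c0, h, h1, h2, h3⟩ := mem_contractF.1 hg
    exact mem_contractF.2 ⟨⟨hd.2.1, hd.2.2, hd.1⟩, b0, c0, a0, T.cyc h, h2, h3, h1⟩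
  · intro a b c c' hg hg'
    obtain ⟨hd, a0, b0, c0, h, h1, h2, h3⟩ := mem_contractF.1 hg
    obtain ⟨hd', a1, b1, c1, h', h1', h2', h3'⟩ := mem_contractF.1 hg'
    have main : ∀ {a b c c' b0 c0 b1 c1}, (x, b0, c0) ∈ F → (y, b1, c1) ∈ F → phi x y b0 = b →
        phi x y b1 = b → a = x → (a ≠ b ∧ b ≠ c ∧ c ≠ a) → (a ≠ b ∧ b ≠ c' ∧ c' ≠ a) →
        phi x y c0 = c → phi x y c1 = c' → False := by
      intro a b c c' b0 c0 b1 c1 e1 e2 e3 e4 e5 e6 e7 e8 e9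
      have b0y : b0 ≠ y := by
        rintro rfl; rw [phi_y] at e3; exact e6.1 (e5.trans e3)
      have b1y : b1 ≠ y := (T.ne e2).symm
      rw [phi_ne b0y] at e3; rw [phi_ne b1y] at e4
      subst e3; subst e4
      rcases hc b1 ⟨_, e1⟩ ⟨_, e2⟩ with rfl | rfl
      · have := T.uniq e2 hyp
        subst this
        rw [phi_ne hxy] at e9
        exact e7.2.2 (e9.symm.trans e5.symm)
      · have := T.uniq e1 hxq
        subst this
        rw [phi_y] at e8
        exact e6.2.2 (e8.symm.trans e5.symm)
    have main2 : ∀ {a b c c' a0 c0 a1 c1}, (a0, x, c0) ∈ F → (a1, y, c1) ∈ F → phi x y a0 = a →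
        phi x y a1 = a → b = x → (a ≠ b ∧ b ≠ c ∧ c ≠ a) → (a ≠ b ∧ b ≠ c' ∧ c' ≠ a) →
        phi x y c0 = c → phi x y c1 = c' → False := by
      intro a b c c' a0 c0 a1 c1 e1 e2 e3 e4 e5 e6 e7 e8 e9
      have b0y : a0 ≠ y := by
        rintro rfl; rw [phi_y] at e3; exact e6.1 (e3.symm.trans e5.symm)
      have b1y : a1 ≠ y := (T.ne e2)
      rw [phi_ne b0y] at e3; rw [phi_ne b1y] at e4
      subst e3; subst e4
      rcases hc a1 (T.rev e1) (T.rev e2) with rfl | rfl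
      · have := T.uniq e1 hpx
        subst this
        rw [phi_y] at e8
        exact e6.2.1 (e5.trans e8)
      · have := T.uniq e2 hqy
        subst this
        rw [phi_ne hxy] at e9
        exact e7.2.1 (e5.trans e9)
    have inj : ∀ {s t z}, phi x y s = z → phi x y t = z → s = t ∨ (z = x ∧ s = x ∧ t = y) ∨
        (z = x ∧ s = y ∧ t = x) := by
      unfold phi; grind
    rcases inj h1 h1' with rfl | ⟨hx, rfl, rfl⟩ | ⟨hx, rfl, rfl⟩
    · rcases inj h2 h2' with rfl | ⟨hx, rfl, rfl⟩ | ⟨hx, rfl, rfl⟩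
      · rw [T.uniq h h'] at h3
        exact h3.symm.trans h3'
      · exact (main2 h h' h1 h1' hx hd hd' h3 h3').elim
      · exact (main2 h' h h1' h1 hx hd' hd h3' h3).elim
    · exact (main h h' h2 h2' hx hd hd' h3 h3').elim
    · exact (main h' h h2' h2 hx hd' hd h3' h3).elim
  · intro a b c hg
    obtain ⟨hd, a0, b0, c0, h, rfl, rfl, rfl⟩ := mem_contractF.1 hg
    obtain ⟨d, hd'⟩ := T.rev h
    exact keep_contract T hp hq hpq hd' hd.1.symm
  · intro z S hS n n1 k k1 hn hk hnS
    by_cases hz : z = x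
    · subst hz
      have hSx : ∀ n n', (z, n, n') ∈ F → n ≠ y → n' ≠ y → n ∈ S → n' ∈ S := by
        intro n n' h h1 h2
        apply hS
        refine mem_contractF.2 ⟨⟨T.ne h, T.ne2 h, T.ne3 h⟩, z, n, n', h, ?_, ?_, ?_⟩
        · exact phi_ne hxy
        · exact phi_ne h1
        · exact phi_ne h2
      have hSy : ∀ n n', (y, n, n') ∈ F → n ≠ z → n' ≠ z → n ∈ S → n' ∈ S := by
        intro n n' h h1 h2
        apply hS
        refine mem_contractF.2 ⟨⟨h1.symm, T.ne2 h, h2⟩, y, n, n', h, ?_, ?_, ?_⟩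
        · exact phi_y _ _
        · exact phi_ne (T.ne h).symm
        · exact phi_ne (T.ne3 h)
      have A1 : ∀ s s1, (z, s, s1) ∈ F → s ≠ y → s ∈ S → q ∈ S := by
        intro s s1 h hs hsS
        by_contra hqS
        have := T.link z {n | n ∈ S ∧ n ≠ y} (by
          rintro n n' h ⟨h1, h2⟩
          have h3 : n' ≠ y := by
            rintro rfl
            exact hqS (T.prev_uniq hxq h ▸ h1)
          exact ⟨hSx n n' h h2 h3 h1, h3⟩) s s1 y p h hp ⟨hsS, hs⟩
        exact this.2 rfl
      have A2 : ∀ s s1, (y, s, s1) ∈ F → s ≠ z → s ∈ S → p ∈ S := by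
        intro s s1 h hs hsS
        by_contra hqS
        have := T.link y {n | n ∈ S ∧ n ≠ z} (by
          rintro n n' h ⟨h1, h2⟩
          have h3 : n' ≠ z := by
            rintro rfl
            exact hqS (T.prev_uniq hyp h ▸ h1)
          exact ⟨hSy n n' h h2 h3 h1, h3⟩) s s1 z q h hq ⟨hsS, hs⟩
        exact this.2 rfl
      obtain ⟨px, hpx'⟩ : Adj F z p := T.rev hpx
      obtain ⟨qy, hqy'⟩ : Adj F y q := T.rev hqy
      have nb : ∀ {a b}, (z, a, b) ∈ contractF F z y →
          a ≠ y ∧ a ≠ z ∧ ((∃ c, (z, a, c) ∈ F) ∨ (∃ c, (y, a, c) ∈ F)) := by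
        intro a b hab
        obtain ⟨hd, a0, b0, c0, h, e1, e2, -⟩ := mem_contractF.1 hab
        have a1 : b0 ≠ y := by
          rintro rfl; rw [phi_y] at e2; exact hd.1 e2
        rw [phi_ne a1] at e2
        subst e2
        refine ⟨a1, hd.1.symm, ?_⟩
        rcases phi_cases z y a0 with ⟨g1, g2⟩ | ⟨g1, g2⟩
        · right; exact ⟨c0, g1 ▸ h⟩
        · left; rw [g2] at e1; exact ⟨c0, e1 ▸ h⟩
      have both : p ∈ S ∧ q ∈ S := by
        obtain ⟨a1, a2, ⟨c, h⟩ | ⟨c, h⟩⟩ := nb hn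
        · have hqS := A1 _ _ h a1 hnS
          exact ⟨A2 _ _ hqy' d4.symm hqS, hqS⟩
        · have hpS := A2 _ _ h a2 hnS
          exact ⟨hpS, A1 _ _ hpx' d2.symm hpS⟩
      obtain ⟨a1, a2, ⟨c, h⟩ | ⟨c, h⟩⟩ := nb hk
      · have := T.link z {n | n ∈ S ∨ n = y} (by
          intro n n' h hn
          rcases hn with hn | rfl
          · by_cases h2 : n' = y
            · right; exact h2
            · by_cases h1 : n = y
              · subst h1; left; exact T.uniq hp h ▸ both.1
              · left; exact hSx n n' h h1 h2 hn
          · left; exact T.uniq hp h ▸ both.1) p px k c hpx' h (Or.inl both.1)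
        exact this.resolve_right a1
      · have := T.link y {n | n ∈ S ∨ n = z} (by
          intro n n' h hn
          rcases hn with hn | rfl
          · by_cases h2 : n' = z
            · right; exact h2
            · by_cases h1 : n = z
              · subst h1; left; exact T.uniq hq h ▸ both.2
              · left; exact hSy n n' h h1 h2 hn
          · left; exact T.uniq hq h ▸ both.2) q qy k c hqy' h (Or.inl both.2)
        exact this.resolve_right a2
    · have zF : ∀ {a b}, (z, a, b) ∈ contractF F x y → z ≠ y ∧ ∃ a0 b0, (z, a0, b0) ∈ F ∧
          phi x y a0 = a := by
        intro a b hab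
        obtain ⟨hd, a0, b0, c0, h, e1, e2, -⟩ := mem_contractF.1 hab
        rcases phi_cases x y a0 with ⟨g1, g2⟩ | ⟨g1, g2⟩
        · exact absurd (e1.symm.trans g2) hz
        · rw [g2] at e1; subst e1
          exact ⟨g1, b0, c0, h, e2⟩
      obtain ⟨hzy, a0, b0, h0, rfl⟩ := zF hn
      obtain ⟨-, a1, b1, h1, rfl⟩ := zF hk
      have pz : ∀ s, s ≠ z → phi x y s ≠ z := by
        intro s hs
        rcases phi_cases x y s with ⟨g1, g2⟩ | ⟨g1, g2⟩ <;> rw [g2]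
        · exact fun h => hz h.symm
        · exact hs
      exact T.link z {n | phi x y n ∈ S} (by
        intro n n' h hnS
        simp only [Set.mem_setOf_eq] at hnS ⊢
        by_cases hnn : phi x y n = phi x y n'
        · rw [← hnn]; exact hnS
        · refine hS _ _ (mem_contractF.2 ⟨⟨?_, hnn, ?_⟩, z, n, n', h, phi_ne hzy, rfl, rfl⟩) hnS
          · exact (pz n (T.ne h).symm).symm
          · exact pz n' (T.ne3 h)) a0 b0 a1 b1 h0 h1 hnS
  · intro S hS a b ha hb haS
    rw [Finset.mem_erase] at ha hb
    have := T.conn {n | phi x y n ∈ S} (by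
      intro u v w h hu
      simp only [Set.mem_setOf_eq] at hu ⊢
      by_cases hnn : phi x y u = phi x y v
      · rw [← hnn]; exact hu
      · obtain ⟨c, hc⟩ := keep_contract T hp hq hpq h hnn
        exact hS _ _ _ hc hu) a b ha.2 hb.2 (by simpa [phi_ne ha.1] using haS)
    simpa [phi_ne hb.1] using this
  · have := card_contractF T hp hq
    have h1 := T.euler
    rw [Finset.card_erase_of_mem (T.mem hq)]
    have : 0 < P.card := Finset.card_pos.2 ⟨_, T.mem hq⟩
    omega

end contract
end OPM


namespace OPM
section morse
variable {X : Type*} [DecidableEq X] {P : Finset X} {F : Finset (X × X × X)}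

/-- a sign change of `f - f v` in the link of `v` -/
def Trans (F : Finset (X × X × X)) (f : X → ℝ) (v n n' : X) : Prop :=
  (v, n, n') ∈ F ∧ ((f n < f v ∧ f v < f n') ∨ (f n' < f v ∧ f v < f n))

lemma card_trans (T : Tri P F) (f : X → ℝ) :
    open Classical in
    3 * (F.filter (fun t => Trans F f t.1 t.2.1 t.2.2)).card ≤ F.card := by
  classical
  set A := F.filter (fun t => Trans F f t.1 t.2.1 t.2.2) with hA
  let r : X × X × X → X × X × X := fun t => (t.2.1, t.2.2, t.1)
  have rinj : Function.Injective r := by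
    rintro ⟨a, b, c⟩ ⟨a', b', c'⟩ h
    simp only [r, Prod.mk.injEq] at h ⊢
    tauto
  have hmem : ∀ a b c, (a, b, c) ∈ A → (a, b, c) ∈ F ∧
      ((f b < f a ∧ f a < f c) ∨ (f c < f a ∧ f a < f b)) := by
    intro a b c h
    rw [hA, Finset.mem_filter] at h
    exact h.2
  have d1 : Disjoint A (A.image r) := by
    rw [Finset.disjoint_left]
    rintro ⟨a, b, c⟩ h h'
    rw [Finset.mem_image] at h'
    obtain ⟨⟨a', b', c'⟩, h', e⟩ := h'
    simp only [r, Prod.mk.injEq] at e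
    obtain ⟨rfl, rfl, rfl⟩ := e
    have := (hmem _ _ _ h).2; have := (hmem _ _ _ h').2
    rcases (hmem _ _ _ h).2 with h1 | h1 <;> rcases (hmem _ _ _ h').2 with h2 | h2 <;> linarith
  have d2 : Disjoint (A ∪ A.image r) ((A.image r).image r) := by
    rw [Finset.disjoint_left]
    rintro ⟨a, b, c⟩ h h'
    rw [Finset.mem_image] at h'
    obtain ⟨⟨a', b', c'⟩, h', e⟩ := h'
    rw [Finset.mem_image] at h'
    obtain ⟨⟨a2, b2, c2⟩, h', e2⟩ := h'
    simp only [r, Prod.mk.injEq] at e e2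
    obtain ⟨rfl, rfl, rfl⟩ := e
    obtain ⟨rfl, rfl, rfl⟩ := e2
    rw [Finset.mem_union, Finset.mem_image] at h
    rcases h with h | ⟨⟨a3, b3, c3⟩, h, e3⟩
    · rcases (hmem _ _ _ h).2 with h1 | h1 <;> rcases (hmem _ _ _ h').2 with h2 | h2 <;> linarith
    · simp only [r, Prod.mk.injEq] at e3
      obtain ⟨rfl, rfl, rfl⟩ := e3
      rcases (hmem _ _ _ h).2 with h1 | h1 <;> rcases (hmem _ _ _ h').2 with h2 | h2 <;> linarith
  have hsub : (A ∪ A.image r) ∪ ((A.image r).image r) ⊆ F := by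
    have rF : ∀ t ∈ F, r t ∈ F := by
      rintro ⟨a, b, c⟩ h; exact T.cyc h
    have hAF : ∀ t ∈ A, t ∈ F := fun t ht => (Finset.mem_filter.1 ht).1
    intro t ht
    simp only [Finset.mem_union, Finset.mem_image] at ht
    rcases ht with (h | ⟨s, h, rfl⟩) | ⟨s, ⟨z, h, rfl⟩, rfl⟩
    · exact hAF t h
    · exact rF _ (hAF _ h)
    · exact rF _ (rF _ (hAF _ h))
  have := Finset.card_le_card hsub
  rw [Finset.card_union_of_disjoint d2, Finset.card_union_of_disjoint d1] at this
  have i1 := Finset.card_image_of_injective A rinj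
  have i2 := Finset.card_image_of_injective (A.image r) rinj
  omega

lemma exists_exit (T : Tri P F) (v : X) (S : Set X) {n n1 m m1 : X} (hn : (v, n, n1) ∈ F)
    (hm : (v, m, m1) ∈ F) (hnS : n ∈ S) (hmS : m ∉ S) : ∃ a b, (v, a, b) ∈ F ∧ a ∈ S ∧ b ∉ S := by
  by_contra hcon
  push Not at hcon
  exact hmS (T.link v S (fun a b h ha => hcon a b h ha) n n1 m m1 hn hm hnS)

/-- no interior saddle -/
theorem Tri.no_saddle (T : Tri P F) (f : X → ℝ) (hf : Set.InjOn f P) {m M : X}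
    (hm : m ∈ P) (hM : M ∈ P) (hmM : m ≠ M)
    (hlow : ∀ v ∈ P, v ≠ m → v ≠ M → ∃ n, Adj F v n ∧ f n < f v)
    (hhigh : ∀ v ∈ P, v ≠ m → v ≠ M → ∃ n, Adj F v n ∧ f v < f n)
    {v : X} (hv : v ∈ P) (hvm : v ≠ m) (hvM : v ≠ M) {n1 n1' n2 n2' n3 n3' : X}
    (h1 : Trans F f v n1 n1') (h2 : Trans F f v n2 n2') (h3 : Trans F f v n3 n3')
    (h12 : n1 ≠ n2) (h13 : n1 ≠ n3) (h23 : n2 ≠ n3) : False := by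
  classical
  have hc := card_trans T f
  set A := F.filter (fun t => Trans F f t.1 t.2.1 t.2.2) with hA
  have hAP : ∀ t ∈ A, t.1 ∈ P := by
    rintro ⟨a, b, c⟩ h
    exact T.mem (Finset.mem_filter.1 h).1
  have hsum := Finset.card_eq_sum_card_fiberwise (f := fun t : X × X × X => t.1) (s := A) (t := P)
    hAP
  have memA : ∀ a b c, Trans F f a b c → (a, b, c) ∈ A.filter (fun t => t.1 = a) := by
    intro a b c h
    rw [Finset.mem_filter, hA, Finset.mem_filter]
    exact ⟨⟨h.1, h⟩, rfl⟩
  have two : ∀ z ∈ (P.erase m).erase M, 2 ≤ (A.filter (fun t => t.1 = z)).card := by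
    intro z hz
    rw [Finset.mem_erase, Finset.mem_erase] at hz
    obtain ⟨l, ⟨l1, hl⟩, hl'⟩ := hlow z hz.2.2 hz.2.1 hz.1
    obtain ⟨g, ⟨g1, hg⟩, hg'⟩ := hhigh z hz.2.2 hz.2.1 hz.1
    have nz : ∀ a b, (z, a, b) ∈ F → f b ≠ f z := by
      intro a b h e
      exact T.ne3 h (hf (T.mem (T.cyc2 h)) hz.2.2 e)
    obtain ⟨a, b, hab, ha, hb⟩ := exists_exit T z {n | f n < f z} hl hg hl' (by simp; linarith)
    obtain ⟨c, d, hcd, hc, hd⟩ := exists_exit T z {n | f z < f n} hg hl hg' (by simp; linarith)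
    simp only [Set.mem_setOf_eq, not_lt] at ha hb hc hd
    have hb' := lt_of_le_of_ne hb (nz _ _ hab).symm
    have hd' := lt_of_le_of_ne hd (nz _ _ hcd)
    have m1 := memA z a b ⟨hab, Or.inl ⟨ha, hb'⟩⟩
    have m2 := memA z c d ⟨hcd, Or.inr ⟨hd', hc⟩⟩
    have hne : (z, a, b) ≠ (z, c, d) := by
      intro e
      simp only [Prod.mk.injEq] at e
      rw [e.2.1] at ha; linarith
    have := Finset.one_lt_card.2 ⟨_, m1, _, m2, hne⟩
    omega
  have hvP : v ∈ (P.erase m).erase M := by simp [hv, hvm, hvM]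
  have three : 3 ≤ (A.filter (fun t => t.1 = v)).card := by
    have : 2 < (A.filter (fun t => t.1 = v)).card := by
      rw [Finset.two_lt_card]
      exact ⟨_, memA _ _ _ h1, _, memA _ _ _ h2, _, memA _ _ _ h3, by simp [h12], by simp [h13],
        by simp [h23]⟩
    omega
  have hle : ∑ z ∈ (P.erase m).erase M, (A.filter (fun t => t.1 = z)).card ≤
      ∑ z ∈ P, (A.filter (fun t => t.1 = z)).card :=
    Finset.sum_le_sum_of_subset ((Finset.erase_subset _ _).trans (Finset.erase_subset _ _))
  have hlt : ∑ z ∈ (P.erase m).erase M, 2 <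
      ∑ z ∈ (P.erase m).erase M, (A.filter (fun t => t.1 = z)).card :=
    Finset.sum_lt_sum two ⟨v, hvP, by omega⟩
  rw [Finset.sum_const, smul_eq_mul, Finset.card_erase_of_mem (by simp [hM, hmM.symm]),
    Finset.card_erase_of_mem hm] at hlt
  have := T.euler
  omega

/-- extending a partial bipolar order -/
theorem Tri.st_order (T : Tri P F) {m M : X} : ∀ (k : ℕ) (P0 : Finset X) (f : X → ℝ),
    (P \ P0).card = k → P0 ⊆ P → Set.InjOn f P0 →
    (∀ v ∈ P0, ∃ n ∈ P0, Adj F v n) → P0.Nonempty →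
    (∀ v ∈ P0, v ≠ m → v ≠ M → (∃ n ∈ P0, Adj F v n ∧ f n < f v) ∧
      (∃ n ∈ P0, Adj F v n ∧ f v < f n)) →
    ∃ g : X → ℝ, Set.InjOn g P ∧ (∀ v ∈ P0, g v = f v) ∧
    (∀ v ∈ P, v ≠ m → v ≠ M → (∃ n, Adj F v n ∧ g n < g v) ∧
      (∃ n, Adj F v n ∧ g v < g n)) := by
  intro k
  induction k with
  | zero =>
    intro P0 f hk hP0 hf _ _ h
    have : P ⊆ P0 := by
      rw [Finset.card_eq_zero, Finset.sdiff_eq_empty_iff_subset] at hk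
      exact hk
    have e : P0 = P := Finset.Subset.antisymm hP0 this
    subst e
    refine ⟨f, hf, fun _ _ => rfl, ?_⟩
    intro v hv h1 h2
    obtain ⟨⟨n, -, hn⟩, ⟨n', -, hn'⟩⟩ := h v hv h1 h2
    exact ⟨⟨n, hn⟩, ⟨n', hn'⟩⟩
  | succ k ih =>
    intro P0 f hk hP0 hf hnb hne h
    obtain ⟨z, hz⟩ : ∃ z, z ∈ P \ P0 := by
      rw [← Finset.Nonempty, ← Finset.card_pos]; omega
    rw [Finset.mem_sdiff] at hz
    obtain ⟨t, ht⟩ := hne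
    obtain ⟨s, c, w, hscw, hs, hc⟩ : ∃ s c w, (s, c, w) ∈ F ∧ s ∈ P0 ∧ c ∉ P0 := by
      by_contra hcon
      push Not at hcon
      exact hz.2 (T.conn (P0 : Set X) (fun u v w h1 h2 => hcon u v w h1 h2) t z (hP0 ht) hz.1 ht)
    obtain ⟨n, hn, n1, hsn⟩ := hnb s hs
    obtain ⟨c', n', hcn, hc', hn'⟩ := exists_exit T s {a | a ∉ P0} hscw hsn hc (by simpa using hn)
    simp only [Set.mem_setOf_eq, not_not] at hc' hn'
    have hsn' : f s ≠ f n' := fun e => T.ne3 hcn (hf hn' hs e.symm)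
    obtain ⟨x, hx, hxP⟩ : ∃ x ∈ Set.Ioo (min (f s) (f n')) (max (f s) (f n')),
        x ∉ (P0.image f : Finset ℝ) := by
      have : (Set.Ioo (min (f s) (f n')) (max (f s) (f n'))).Infinite :=
        Set.Ioo_infinite (min_lt_max.2 hsn')
      obtain ⟨x, hx⟩ := (this.diff (P0.image f).finite_toSet).nonempty
      exact ⟨x, hx.1, by simpa using hx.2⟩
    have hc'P : c' ∈ P := T.mem (T.cyc hcn)
    have cs : Adj F c' s := T.rev hcn
    have cn : Adj F c' n' := ⟨_, T.cyc hcn⟩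
    let g := Function.update f c' x
    have gc : g c' = x := by simp [g]
    have go : ∀ v ∈ P0, g v = f v := by
      intro v hv
      have : v ≠ c' := by rintro rfl; exact hc' hv
      simp [g, this]
    obtain ⟨G, hG, hG0, hG1⟩ := ih (insert c' P0) g (by
        have : P \ insert c' P0 = (P \ P0).erase c' := by
          ext a; simp; tauto
        rw [this, Finset.card_erase_of_mem (by simp [hc'P, hc'])]; omega)
      (by intro a ha; rw [Finset.mem_insert] at ha; rcases ha with rfl | ha
          · exact hc'P
          · exact hP0 ha)
      (by
        have xne : ∀ v ∈ P0, x ≠ f v := by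
          rintro v hv rfl
          exact hxP (Finset.mem_image_of_mem f hv)
        intro a ha b hb hab
        simp only [Finset.coe_insert, Set.mem_insert_iff, Finset.mem_coe] at ha hb
        rcases ha with rfl | ha <;> rcases hb with rfl | hb
        · rfl
        · rw [gc, go b hb] at hab
          exact absurd hab (xne b hb)
        · rw [gc, go a ha] at hab
          exact absurd hab.symm (xne a ha)
        · rw [go a ha, go b hb] at hab; exact hf ha hb hab)
      (by intro v hv; rw [Finset.mem_insert] at hv; rcases hv with rfl | hv
          · exact ⟨s, Finset.mem_insert_of_mem hs, cs⟩
          · obtain ⟨n, hn, h⟩ := hnb v hv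
            exact ⟨n, Finset.mem_insert_of_mem hn, h⟩)
      ⟨t, Finset.mem_insert_of_mem ht⟩
      (by
        intro v hv h1 h2
        rw [Finset.mem_insert] at hv
        rcases hv with rfl | hv
        · rw [gc]
          obtain ⟨hx1, hx2⟩ := hx
          rcases lt_or_gt_of_ne hsn' with hlt | hlt
          · rw [min_eq_left hlt.le] at hx1
            rw [max_eq_right hlt.le] at hx2
            exact ⟨⟨s, Finset.mem_insert_of_mem hs, cs, by rw [go s hs]; exact hx1⟩,
              ⟨n', Finset.mem_insert_of_mem hn', cn, by rw [go n' hn']; exact hx2⟩⟩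
          · rw [min_eq_right hlt.le] at hx1
            rw [max_eq_left hlt.le] at hx2
            exact ⟨⟨n', Finset.mem_insert_of_mem hn', cn, by rw [go n' hn']; exact hx1⟩,
              ⟨s, Finset.mem_insert_of_mem hs, cs, by rw [go s hs]; exact hx2⟩⟩
        · obtain ⟨⟨a, ha, ha1, ha2⟩, ⟨b, hb, hb1, hb2⟩⟩ := h v hv h1 h2
          exact ⟨⟨a, Finset.mem_insert_of_mem ha, ha1, by rw [go a ha, go v hv]; exact ha2⟩,
              ⟨b, Finset.mem_insert_of_mem hb, hb1, by rw [go b hb, go v hv]; exact hb2⟩⟩)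
    refine ⟨G, hG, ?_, hG1⟩
    intro v hv
    rw [hG0 v (Finset.mem_insert_of_mem hv), go v hv]

/-- a path of five vertices extends to a bipolar order -/
theorem Tri.st5 (T : Tri P F) {x0 x1 x2 x3 x4 : X} (a0 : Adj F x0 x1) (a1 : Adj F x1 x2)
    (a2 : Adj F x2 x3) (a3 : Adj F x3 x4) (h02 : x0 ≠ x2) (h03 : x0 ≠ x3) (h04 : x0 ≠ x4)
    (h13 : x1 ≠ x3) (h14 : x1 ≠ x4) (h24 : x2 ≠ x4) :
    ∃ f : X → ℝ, Set.InjOn f P ∧ f x0 < f x1 ∧ f x1 < f x2 ∧ f x2 < f x3 ∧ f x3 < f x4 ∧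
      ∀ {n1 n1' n2 n2' n3 n3' : X},
      Trans F f x2 n1 n1' → Trans F f x2 n2 n2' → Trans F f x2 n3 n3' →
      n1 ≠ n2 → n1 ≠ n3 → n2 ≠ n3 → False := by
  have b0 := T.adj_symm a0; have b1 := T.adj_symm a1
  have b2 := T.adj_symm a2; have b3 := T.adj_symm a3
  have h01 := T.adj_ne a0; have h12 := T.adj_ne a1; have h23 := T.adj_ne a2
  have h34 := T.adj_ne a3
  let f0 : X → ℝ := fun z => if z = x0 then 0 else if z = x1 then 1 else if z = x2 then 2 else
    if z = x3 then 3 else 4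
  have f00 : f0 x0 = 0 := by simp [f0]
  have f01 : f0 x1 = 1 := by simp [f0, h01.symm]
  have f02 : f0 x2 = 2 := by simp [f0, h02.symm, h12.symm]
  have f03 : f0 x3 = 3 := by simp [f0, h03.symm, h13.symm, h23.symm]
  have f04 : f0 x4 = 4 := by simp [f0, h04.symm, h14.symm, h24.symm, h34.symm]
  let P0 : Finset X := {x0, x1, x2, x3, x4}
  have m0 : x0 ∈ P0 := by simp [P0]
  have m1 : x1 ∈ P0 := by simp [P0]
  have m2 : x2 ∈ P0 := by simp [P0]
  have m3 : x3 ∈ P0 := by simp [P0]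
  have m4 : x4 ∈ P0 := by simp [P0]
  have cs : ∀ {z}, z ∈ P0 → z = x0 ∨ z = x1 ∨ z = x2 ∨ z = x3 ∨ z = x4 := by
    intro z hz; simpa [P0] using hz
  obtain ⟨g, hg, hg0, hg1⟩ := T.st_order (m := x0) (M := x4) _ P0 f0 rfl
    (by
      intro z hz
      rcases cs hz with rfl | rfl | rfl | rfl | rfl
      · exact T.adj_mem a0
      · exact T.adj_mem a1
      · exact T.adj_mem a2
      · exact T.adj_mem a3
      · exact T.adj_mem b3)
    (by
      intro a ha b hb
      rcases cs ha with rfl | rfl | rfl | rfl | rfl <;>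
      rcases cs hb with rfl | rfl | rfl | rfl | rfl <;>
      simp only [f00, f01, f02, f03, f04] <;> norm_num)
    (by
      intro z hz
      rcases cs hz with rfl | rfl | rfl | rfl | rfl
      · exact ⟨_, m1, a0⟩
      · exact ⟨_, m0, b0⟩
      · exact ⟨_, m1, b1⟩
      · exact ⟨_, m2, b2⟩
      · exact ⟨_, m3, b3⟩)
    ⟨x0, m0⟩
    (by
      intro z hz z0 z4
      rcases cs hz with rfl | rfl | rfl | rfl | rfl
      · exact absurd rfl z0
      · exact ⟨⟨_, m0, b0, by rw [f00, f01]; norm_num⟩, ⟨_, m2, a1, by rw [f01, f02]; norm_num⟩⟩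
      · exact ⟨⟨_, m1, b1, by rw [f01, f02]; norm_num⟩, ⟨_, m3, a2, by rw [f02, f03]; norm_num⟩⟩
      · exact ⟨⟨_, m2, b2, by rw [f02, f03]; norm_num⟩, ⟨_, m4, a3, by rw [f03, f04]; norm_num⟩⟩
      · exact absurd rfl z4)
  refine ⟨g, hg, ?_, ?_, ?_, ?_, ?_⟩
  · rw [hg0 _ m0, hg0 _ m1, f00, f01]; norm_num
  · rw [hg0 _ m1, hg0 _ m2, f01, f02]; norm_num
  · rw [hg0 _ m2, hg0 _ m3, f02, f03]; norm_num
  · rw [hg0 _ m3, hg0 _ m4, f03, f04]; norm_num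
  · intro n1 n1' n2 n2' n3 n3'
    exact T.no_saddle g hg (T.adj_mem a0) (T.adj_mem b3) h04 (fun v h1 h2 h3 => (hg1 v h1 h2 h3).1)
      (fun v h1 h2 h3 => (hg1 v h1 h2 h3).2) (T.adj_mem a2) h02.symm h24

/-- the flip of `yw` does not create a double edge when `yw` is a chord -/
theorem Tri.flip_ok (T : Tri P F) {x y w p q : X} (hq : (y, q, w) ∈ F) (hp : (y, w, p) ∈ F)
    (hxy : Adj F x y) (hxw : Adj F x w) (hxp : x ≠ p) (hxq : x ≠ q) (hpq : p ≠ q) :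
    ¬ Adj F p q := by
  intro hadj
  have yq : Adj F q y := T.rev hq
  obtain ⟨f, hf, f01, f12, f23, f34, hno⟩ := T.st5 (x0 := p) (x1 := q) (x2 := y) (x3 := x)
    (x4 := w) hadj yq (T.adj_symm hxy) hxw (T.ne3 hp) hxp.symm (T.ne2 hp).symm hxq.symm (T.ne2 hq)
    (T.ne hp)
  obtain ⟨x1, hx1⟩ := T.adj_symm hxy
  obtain ⟨n, n', hnn, hn, hn'⟩ := exists_exit T y {n | f y < f n ∧ n ≠ w} hx1 hq
    ⟨f23, T.adj_ne hxw⟩ (fun h => by have := h.1; linarith)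
  have hn'w : n' ≠ w := by
    rintro rfl
    have := T.prev_uniq hnn hq
    subst this
    have := hn.1; linarith
  have hlow : f n' < f y := by
    rcases lt_trichotomy (f n') (f y) with h | h | h
    · exact h
    · exact absurd (hf (T.mem (T.cyc2 hnn)) (T.mem hq) h) (T.ne3 hnn)
    · exact absurd ⟨h, hn'w⟩ hn'
  refine hno (n1 := q) (n2 := w) (n3 := n) ⟨hq, Or.inl ⟨f12, by linarith⟩⟩
    ⟨hp, Or.inr ⟨by linarith, by linarith⟩⟩ ⟨hnn, Or.inr ⟨hlow, hn.1⟩⟩ (T.ne2 hq) ?_ hn.2.symm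
  rintro rfl
  have := hn.1; linarith

lemma disc_ivt (p : ℕ → Prop) {a b : ℕ} (hab : a ≤ b) (ha : p a) (hb : ¬ p b) :
    ∃ t, a ≤ t ∧ t < b ∧ p t ∧ ¬ p (t + 1) := by
  by_contra hcon
  push Not at hcon
  have : ∀ t, a ≤ t → t ≤ b → p t := by
    intro t ht
    induction t, ht using Nat.le_induction with
    | base => intro _; exact ha
    | succ t ht ih => intro h; exact hcon t ht (by omega) (ih (by omega))
  exact hb (this b hab le_rfl)

/-- every vertex has a contractible edge -/
theorem Tri.contractible (T : Tri P F) {v : X} (hv : v ∈ P) :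
    ∃ u p q, (u, v, p) ∈ F ∧ (v, u, q) ∈ F ∧ ∀ z, Adj F u z → Adj F v z → z = p ∨ z = q := by
  classical
  obtain ⟨e0, he0⟩ := T.exists_adj hv
  have nxt : ∀ n : {n // Adj F v n}, ∃ n' : {n // Adj F v n}, (v, n.1, n'.1) ∈ F := by
    rintro ⟨n, n', h⟩
    exact ⟨⟨n', T.next_adj h⟩, h⟩
  choose nx hnx using nxt
  let e' : ℕ → {n // Adj F v n} := fun t => nx^[t] ⟨e0, he0⟩
  let e : ℕ → X := fun t => (e' t).1
  have he : ∀ t, (v, e t, e (t + 1)) ∈ F := by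
    intro t
    have := hnx (e' t)
    simp only [e, e', Function.iterate_succ_apply'] at this ⊢
    exact this
  have shift : ∀ {s t}, e s = e t → ∀ n, e (s + n) = e (t + n) := by
    intro s t h n
    induction n with
    | zero => exact h
    | succ n ih =>
      have h1 := he (s + n)
      rw [ih] at h1
      exact T.uniq h1 (he (t + n))
  have hall : ∀ i z, Adj F v z → ∃ j, i < j ∧ e j = z := by
    intro i z ⟨z1, hz⟩
    exact T.link v {z | ∃ j, i < j ∧ e j = z} (by
      rintro n n' h ⟨j, hj, rfl⟩
      exact ⟨j + 1, by omega, T.uniq (he j) h⟩) (e (i + 1)) (e (i + 2)) z z1 (he (i + 1)) hz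
      ⟨i + 1, by omega, rfl⟩
  by_contra hcon
  push Not at hcon
  have bad : ∀ i, ∃ d, Adj F (e i) (e (i + d)) ∧ e (i + d) ≠ e (i + 1) ∧
      e (i + d + 1) ≠ e i := by
    intro i
    obtain ⟨p, hp⟩ := T.rev (he i)
    obtain ⟨z, hz1, hz2, hz3, hz4⟩ := hcon (e i) p (e (i + 1)) hp (he i)
    obtain ⟨j, hj, rfl⟩ := hall i z hz2
    refine ⟨j - i, ?_⟩
    rw [show i + (j - i) = j by omega]
    refine ⟨hz1, hz4, ?_⟩
    intro h
    apply hz3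
    have h1 := he j
    rw [h] at h1
    exact T.prev_uniq h1 (T.cyc hp)
  let D : ℕ → ℕ → Prop := fun i d => Adj F (e i) (e (i + d)) ∧ e (i + d) ≠ e (i + 1) ∧
      e (i + d + 1) ≠ e i
  have hD : ∃ d, ∃ i, D i d := by
    obtain ⟨d, hd⟩ := bad 0
    exact ⟨d, 0, hd⟩
  obtain ⟨i, hi⟩ := Nat.find_spec hD
  set d := Nat.find hD with hd
  have dmin : ∀ d' i', D i' d' → d ≤ d' := fun d' i' h => Nat.find_min' hD ⟨i', h⟩
  have hB : ∃ d', D (i + 1) d' := bad (i + 1)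
  have hk := Nat.find_spec hB
  set d' := Nat.find hB with hd'
  have kmin : ∀ c, D (i + 1) c → d' ≤ c := fun c h => Nat.find_min' hB h
  have hdd : d ≤ d' := dmin _ _ hk
  have d0 : d ≠ 0 := by
    intro h; have := hi.1; rw [h] at this; exact T.adj_ne this rfl
  have d1 : d ≠ 1 := by
    intro h; exact hi.2.1 (by rw [h])
  have hgc : e (i + 1 + d') ≠ e (i + d) := by
    intro h
    have h1 : D (i + 1) (d - 1) := by
      have e1 : i + 1 + (d - 1) = i + d := by omega
      simp only [D]
      rw [e1, ← h, ← shift h 1]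
      exact hk
    have := dmin _ _ h1
    omega
  have hga : e (i + 1 + d') ≠ e i := by
    intro h
    exact hk.2.2 (shift h 1)
  have vadj : ∀ t, Adj F v (e t) := fun t => ⟨_, he t⟩
  have vne : ∀ t, v ≠ e t := fun t => T.ne (he t)
  obtain ⟨f, hf, f01, f12, f23, f34, hno⟩ := T.st5 (x0 := e (i + 1 + d')) (x1 := e (i + 1))
    (x2 := v) (x3 := e i) (x4 := e (i + d)) (T.adj_symm hk.1) (T.adj_symm (vadj _)) (vadj _) hi.1
    (vne _).symm hga hgc (T.ne2 (he i)).symm hi.2.1.symm (vne _)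
  have fne : ∀ t, f (e t) ≠ f v := fun t h =>
    vne t (hf (T.mem (he t)) (T.mem (T.cyc (he t))) h.symm)
  obtain ⟨t2, h21, h22, h23, h24⟩ := disc_ivt (fun t => f (e t) < f v) (a := i + 1) (b := i + d)
    (by omega) f12 (by simp only [not_lt]; linarith)
  obtain ⟨t3, h31, h32, h33, h34⟩ := disc_ivt (fun t => f v < f (e t)) (a := i + d)
    (b := i + 1 + d') (by omega) (by linarith) (by simp only [not_lt]; linarith)
  simp only [not_lt] at h24 h34
  refine hno (n1 := e i) (n2 := e t2) (n3 := e t3) ⟨he i, Or.inr ⟨f12, f23⟩⟩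
    ⟨he t2, Or.inl ⟨h23, lt_of_le_of_ne h24 (fne _).symm⟩⟩
    ⟨he t3, Or.inr ⟨lt_of_le_of_ne h34 (fne _), h33⟩⟩ ?_ ?_ ?_
  · intro h; rw [h] at f23; linarith
  · intro h
    have s1 := shift h
    have key : D (i + 1) (d' + i - t3) := by
      simp only [D]
      have := s1 (1 + (d' + i - t3))
      rw [show t3 + (1 + (d' + i - t3)) = i + 1 + d' by omega,
        show i + (1 + (d' + i - t3)) = i + 1 + (d' + i - t3) by omega] at this
      have h2 := shift this 1
      rw [this, h2]
      exact hk
    have := kmin _ key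
    omega
  · intro h; rw [h] at h23; linarith

end morse
end OPM


namespace OPM
section flip
variable {X : Type*} [DecidableEq X] {P : Finset X} {F : Finset (X × X × X)}

theorem Tri.flip [Infinite X] (T : Tri P F) {y w p q : X} (hp : (y, w, p) ∈ F)
    (hq : (w, y, q) ∈ F) (hpq : p ≠ q) (hno : ¬ Adj F p q) :
    ∃ F2, Tri P F2 ∧ (∀ a b, Adj F2 a b ↔ (Adj F a b ∧ NE y w a b) ∨ (a = p ∧ b = q) ∨
      (a = q ∧ b = p)) ∧ ∀ a b c, (a, b, c) ∈ F → NE y w a b → NE y w b c → NE y w c a →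
      (a, b, c) ∈ F2 := by
  obtain ⟨m, hm⟩ := Infinite.exists_notMem_finset P
  have yP := T.mem hp; have wP := T.mem hq; have pP := T.mem (T.cyc2 hp)
  have qP := T.mem (T.cyc2 hq)
  have d1 := T.ne hp; have d2 := T.ne2 hp; have d3 := T.ne3 hp
  have d4 := T.ne2 hq; have d5 := T.ne3 hq
  have hyw : Adj F y p := T.rev (T.cyc2 hp)
  have hwp : Adj F w p := ⟨_, T.cyc hp⟩
  have notm : ∀ {a b}, Adj F a b → a ≠ m ∧ b ≠ m := by
    intro a b h
    constructor
    · rintro rfl; exact hm (T.adj_mem h)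
    · rintro rfl; exact hm (T.adj_mem (T.adj_symm h))
  have hno' : ¬ Adj F q p := fun h => hno (T.adj_symm h)
  have ym : y ≠ m := by rintro rfl; exact hm yP
  have wm : w ≠ m := by rintro rfl; exact hm wP
  have pm : p ≠ m := by rintro rfl; exact hm pP
  have qm : q ≠ m := by rintro rfl; exact hm qP
  have T1 := T.split hp hq hpq hm
  have A1 := fun a b => adj_split (a := a) (b := b) T hp hq hpq hm
  set F1 := splitF F y w p q m with hF1
  have f1 : (p, m, w) ∈ F1 := by
    rw [hF1, mem_splitF]; right; right; right; exact ⟨rfl, Or.inr (Or.inl ⟨rfl, rfl⟩)⟩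
  have f2 : (m, p, y) ∈ F1 := by
    rw [hF1, mem_splitF]; right; left; exact ⟨rfl, (Or.inl ⟨rfl, rfl⟩)⟩
  have T2 := T1.contract f1 f2 d1.symm (by
    intro z hz1 hz2
    have hzm : z ≠ m := (T1.adj_ne hz2).symm
    have hzp : z ≠ p := (T1.adj_ne hz1).symm
    rw [A1] at hz1 hz2
    have hz1' : Adj F p z := by
      rcases hz1 with h | h | h
      · exact h.1
      · exact absurd h.1 pm
      · exact absurd h.1 hzm
    rcases hz2 with h | h | h
    · exact absurd rfl (notm h.1).1
    · rcases h.2 with h | h | h | h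
      · exact Or.inr h
      · exact Or.inl h
      · exact absurd h hzp
      · rw [h] at hz1'; exact absurd hz1' hno
    · exact absurd h.1 hzm)
  rw [Finset.erase_insert hm] at T2
  refine ⟨contractF F1 p m, T2, ?_, ?_⟩
  · intro a b
    rw [adj_contract T1 f1 f2 d1.symm]
    constructor
    · rintro ⟨hab, a0, b0, h, rfl, rfl⟩
      rw [A1] at h
      unfold phi at *
      rcases h with ⟨h, hN⟩ | ⟨rfl, h⟩ | ⟨rfl, h⟩
      · left
        have := notm h
        simp only [this, if_false]
        exact ⟨h, hN⟩
      · rw [if_pos rfl] at hab ⊢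
        have : b0 ≠ a0 := by grind
        rw [if_neg this] at hab ⊢
        rcases h with rfl | rfl | rfl | rfl
        · left; exact ⟨T.adj_symm hyw, by unfold NE; grind⟩
        · left; exact ⟨T.adj_symm hwp, by unfold NE; grind⟩
        · exact absurd rfl hab
        · right; left; exact ⟨rfl, rfl⟩
      · rw [if_pos rfl] at hab ⊢
        have : a0 ≠ b0 := by grind
        rw [if_neg this] at hab ⊢
        rcases h with rfl | rfl | rfl | rfl
        · left; exact ⟨hyw, by unfold NE; grind⟩
        · left; exact ⟨hwp, by unfold NE; grind⟩
        · exact absurd rfl hab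
        · right; right; exact ⟨rfl, rfl⟩
    · rintro (⟨h, hN⟩ | ⟨rfl, rfl⟩ | ⟨rfl, rfl⟩)
      · have := notm h
        exact ⟨T.adj_ne h, a, b, (A1 _ _).2 (Or.inl ⟨h, hN⟩), phi_ne this.1, phi_ne this.2⟩
      · exact ⟨hpq, m, b, (A1 _ _).2 (by simp), phi_y _ _, phi_ne qm⟩
      · exact ⟨hpq.symm, a, m, (A1 _ _).2 (by simp), phi_ne qm, phi_y _ _⟩
  · intro a b c h h1 h2 h3
    refine mem_contractF.2 ⟨⟨T.ne h, T.ne2 h, T.ne3 h⟩, a, b, c, ?_, ?_, ?_, ?_⟩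
    · rw [hF1, mem_splitF]; left; exact ⟨h, h1, h2, h3⟩
    · exact phi_ne (notm ⟨_, h⟩).1
    · exact phi_ne (notm ⟨_, h⟩).2
    · exact phi_ne (notm ⟨_, T.cyc h⟩).2

/-- labelled triangulation with connected fibres and three singleton outer labels -/
structure Lab {W : Type*} (f : X → W) (a b c : X) (P : Finset X) (F : Finset (X × X × X)) :
    Prop where
  tri : Tri P F
  fib : ∀ S : Set X, (∀ u v, Adj F u v → f u = f v → u ∈ S → v ∈ S) →
    ∀ u v, u ∈ P → v ∈ P → f u = f v → u ∈ S → v ∈ S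
  face : (a, b, c) ∈ F
  sa : ∀ z ∈ P, f z = f a → z = a
  sb : ∀ z ∈ P, f z = f b → z = b
  sc : ∀ z ∈ P, f z = f c → z = c

/-- the result of contracting all fibres -/
def Res {W : Type*} (f : X → W) (a b c : X) (P : Finset X) (F : Finset (X × X × X)) : Prop :=
  ∃ P' F', P' ⊆ P ∧ Lab f a b c P' F' ∧ Set.InjOn f P' ∧ (∀ v ∈ P, ∃ v' ∈ P', f v' = f v) ∧
    ∀ u v, Adj F u v → f u ≠ f v → ∃ u' v', Adj F' u' v' ∧ f u' = f u ∧ f v' = f v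

theorem Lab.step {W : Type*} [Infinite X] {f : X → W} {a b c : X} {k : ℕ}
    (ih : ∀ (P : Finset X) F, P.card = k → Lab f a b c P F → Res f a b c P F) :
    ∀ (n : ℕ) (P : Finset X) F, P.card = k + 1 → Lab f a b c P F → ∀ x y, Adj F x y → f x = f y →
    (open Classical in (P.filter (fun z => Adj F x z ∧ Adj F y z)).card = n) →
    Res f a b c P F := by
  classical
  intro n
  induction n using Nat.strong_induction_on with
  | _ n ihn =>
  intro P F hk hL x y hxy hf hn
  have T := hL.tri
  have hne := T.adj_ne hxy
  have xP := T.adj_mem hxy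
  have yP := T.adj_mem (T.adj_symm hxy)
  have hya : y ≠ a := by
    rintro rfl; exact hne (hL.sa x xP hf)
  have hyb : y ≠ b := by
    rintro rfl; exact hne (hL.sb x xP hf)
  have hyc : y ≠ c := by
    rintro rfl; exact hne (hL.sc x xP hf)
  have hface := hL.face
  have h4 : 4 ≤ P.card := by
    have hs : ({a, b, c, y} : Finset X) ⊆ P := by
      intro z hz
      simp only [Finset.mem_insert, Finset.mem_singleton] at hz
      rcases hz with rfl | rfl | rfl | rfl
      · exact T.mem hface
      · exact T.mem (T.cyc hface)
      · exact T.mem (T.cyc2 hface)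
      · exact yP
    have := Finset.card_le_card hs
    have e : ({a, b, c, y} : Finset X).card = 4 := by
      have := T.ne hface; have := T.ne2 hface; have := T.ne3 hface
      repeat rw [Finset.card_insert_of_notMem (by simp; grind)]
      simp
    omega
  obtain ⟨p0, hp0⟩ := hxy
  obtain ⟨q0, hq0⟩ := T.rev hp0
  have hpq0 := T.opp_ne h4 hp0 hq0
  by_cases hcom : ∀ z, Adj F x z → Adj F y z → z = p0 ∨ z = q0
  · -- contract
    have T' := T.contract hp0 hq0 hpq0 hcom
    have fphi : ∀ z, f (phi x y z) = f z := by
      intro z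
      rcases phi_cases x y z with ⟨h1, h2⟩ | ⟨h1, h2⟩ <;> rw [h2]
      rw [h1, hf]
    have aphi : ∀ z z', Adj F z z' → phi x y z ≠ phi x y z' →
        Adj (contractF F x y) (phi x y z) (phi x y z') := by
      intro z z' h hne
      exact (adj_contract T hp0 hq0 hpq0).2 ⟨hne, z, z', h, rfl, rfl⟩
    have hL' : Lab f a b c (P.erase y) (contractF F x y) := by
      refine ⟨T', ?_, ?_, ?_, ?_, ?_⟩
      · intro S hS u v hu hv huv huS
        rw [Finset.mem_erase] at hu hv
        have := hL.fib {z | phi x y z ∈ S} (by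
          intro z z' h hzz hz
          simp only [Set.mem_setOf_eq] at hz ⊢
          by_cases e : phi x y z = phi x y z'
          · rw [← e]; exact hz
          · exact hS _ _ (aphi z z' h e) (by rw [fphi, fphi, hzz]) hz) u v hu.2 hv.2 huv
          (by simpa [phi_ne hu.1] using huS)
        simpa [phi_ne hv.1] using this
      · exact mem_contractF.2 ⟨⟨T.ne hface, T.ne2 hface, T.ne3 hface⟩, a, b, c, hface,
          phi_ne hya.symm, phi_ne hyb.symm, phi_ne hyc.symm⟩
      · exact fun z hz => hL.sa z (Finset.mem_of_mem_erase hz)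
      · exact fun z hz => hL.sb z (Finset.mem_of_mem_erase hz)
      · exact fun z hz => hL.sc z (Finset.mem_of_mem_erase hz)
    obtain ⟨P', F', hsub, hLL, hinj, hcov, hadj⟩ := ih (P.erase y) (contractF F x y)
      (by rw [Finset.card_erase_of_mem yP]; omega) hL'
    refine ⟨P', F', hsub.trans (Finset.erase_subset _ _), hLL, hinj, ?_, ?_⟩
    · intro v hv
      obtain ⟨v', h1, h2⟩ := hcov (phi x y v) (by
        rw [Finset.mem_erase]
        rcases phi_cases x y v with ⟨h1, h2⟩ | ⟨h1, h2⟩ <;> rw [h2]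
        · exact ⟨hne, xP⟩
        · exact ⟨h1, hv⟩)
      exact ⟨v', h1, h2.trans (fphi v)⟩
    · intro u v huv hfuv
      obtain ⟨u', v', h1, h2, h3⟩ := hadj (phi x y u) (phi x y v) (aphi u v huv (by
        intro e; apply hfuv; rw [← fphi u, e, fphi])) (by rw [fphi, fphi]; exact hfuv)
      exact ⟨u', v', h1, h2.trans (fphi u), h3.trans (fphi v)⟩
  · push Not at hcom
    obtain ⟨w, hxw, hyw, hwp, hwq⟩ := hcom
    obtain ⟨p, hp⟩ := id hyw
    obtain ⟨q, hq⟩ := T.rev hp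
    have hpq := T.opp_ne h4 hp hq
    have hxp : x ≠ p := by
      rintro rfl
      exact hwp (T.uniq (T.cyc2 hp) hp0)
    have hxq : x ≠ q := by
      rintro rfl
      exact hwq (T.uniq (T.cyc hq) hq0)
    have hxw' := T.adj_ne hxw
    have hyw' := T.adj_ne hyw
    have hno := T.flip_ok (T.cyc hq) hp ⟨p0, hp0⟩ hxw hxp hxq hpq
    obtain ⟨F2, T2, A2, K2⟩ := T.flip hp hq hpq hno
    have hxy2 : Adj F2 x y := (A2 _ _).2 (Or.inl ⟨⟨p0, hp0⟩, by unfold NE; grind⟩)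
    have hxw2 : Adj F2 x w := (A2 _ _).2 (Or.inl ⟨hxw, by unfold NE; grind⟩)
    have hyx2 := T2.adj_symm hxy2
    have hwx2 := T2.adj_symm hxw2
    have hL2 : Lab f a b c P F2 := by
      refine ⟨T2, ?_, ?_, hL.sa, hL.sb, hL.sc⟩
      · intro S hS
        apply hL.fib S
        intro u v huv hfuv hu
        by_cases hN : NE y w u v
        · exact hS u v ((A2 _ _).2 (Or.inl ⟨huv, hN⟩)) hfuv hu
        · unfold NE at hN
          have hN' : (u = y ∧ v = w) ∨ (u = w ∧ v = y) := by tauto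
          rcases hN' with ⟨rfl, rfl⟩ | ⟨rfl, rfl⟩
          · exact hS _ _ hxw2 (hf.trans hfuv) (hS _ _ hyx2 hf.symm hu)
          · exact hS _ _ hxy2 hf (hS _ _ hwx2 (hfuv.trans hf.symm) hu)
      · apply K2 _ _ _ hface <;> unfold NE <;> grind
    have yp : y ≠ p := (T.ne3 hp).symm
    have yq : y ≠ q := T.ne2 hq
    have hlt : (P.filter (fun z => Adj F2 x z ∧ Adj F2 y z)).card < n := by
      rw [← hn]
      apply Finset.card_lt_card
      rw [Finset.ssubset_iff_of_subset]
      · refine ⟨w, ?_, ?_⟩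
        · rw [Finset.mem_filter]
          exact ⟨T.adj_mem (T.adj_symm hxw), hxw, hyw⟩
        · rw [Finset.mem_filter]
          rintro ⟨-, -, h⟩
          rw [A2] at h
          unfold NE at h
          grind
      · intro z hz
        rw [Finset.mem_filter] at hz ⊢
        obtain ⟨h1, h2, h3⟩ := hz
        rw [A2] at h2 h3
        refine ⟨h1, ?_, ?_⟩
        · rcases h2 with h2 | h2 | h2
          · exact h2.1
          · exact absurd h2.1 hxp
          · exact absurd h2.1 hxq
        · rcases h3 with h2 | h2 | h2
          · exact h2.1
          · exact absurd h2.1 yp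
          · exact absurd h2.1 yq
    obtain ⟨P', F', hsub, hLL, hinj, hcov, hadj⟩ := ihn _ hlt P F2 hk hL2 x y hxy2 hf rfl
    refine ⟨P', F', hsub, hLL, hinj, hcov, ?_⟩
    intro u v huv hfuv
    by_cases hN : NE y w u v
    · exact hadj u v ((A2 _ _).2 (Or.inl ⟨huv, hN⟩)) hfuv
    · unfold NE at hN
      have hN' : (u = y ∧ v = w) ∨ (u = w ∧ v = y) := by tauto
      rcases hN' with ⟨rfl, rfl⟩ | ⟨rfl, rfl⟩
      · rw [← hf] at hfuv ⊢
        exact hadj _ _ hxw2 hfuv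
      · rw [← hf] at hfuv ⊢
        exact hadj _ _ hwx2 hfuv

theorem Lab.reduce {W : Type*} [Infinite X] {f : X → W} {a b c : X} :
    ∀ (k : ℕ) (P : Finset X) F, P.card = k → Lab f a b c P F → Res f a b c P F := by
  intro k
  induction k with
  | zero =>
    intro P F hk hL
    have := hL.tri.euler
    omega
  | succ k ih =>
    intro P F hk hL
    by_cases hinj : Set.InjOn f P
    · exact ⟨P, F, subset_rfl, hL, hinj, fun v hv => ⟨v, hv, rfl⟩,
        fun u v h _ => ⟨u, v, h, rfl, rfl⟩⟩
    · simp only [Set.InjOn, not_forall] at hinj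
      obtain ⟨u, hu, v, hv, huv, hne⟩ := hinj
      obtain ⟨x, y, hxy, hf⟩ : ∃ x y, Adj F x y ∧ f x = f y := by
        by_contra hcon
        push Not at hcon
        have := hL.fib {u} (fun s t h1 h2 _ => absurd h2 (hcon s t h1)) u v hu hv huv rfl
        exact hne this.symm
      exact Lab.step ih _ P F hk hL x y hxy hf rfl

end flip
end OPM


namespace OPM
section wind

/-- twice the signed area -/
def det3 (A B C : ℝ × ℝ) : ℝ := (B.1 - A.1) * (C.2 - A.2) - (B.2 - A.2) * (C.1 - A.1)

lemma det3_rot (A B C : ℝ × ℝ) : det3 B C A = det3 A B C := by unfold det3; ring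
lemma det3_rot2 (A B C : ℝ × ℝ) : det3 C A B = det3 A B C := by unfold det3; ring
lemma det3_swap (A B C : ℝ × ℝ) : det3 B A C = - det3 A B C := by unfold det3; ring
lemma det3_self (A B : ℝ × ℝ) : det3 A B A = 0 := by unfold det3; ring
lemma det3_self' (A B : ℝ × ℝ) : det3 A B B = 0 := by unfold det3; ring
lemma det3_sum (A B C p : ℝ × ℝ) : det3 A B p + det3 B C p + det3 C A p = det3 A B C := by
  unfold det3; ring

/-- abstract crossing number -/
noncomputable def kap (a b g : ℝ) : ℤ :=
  (if a ≤ 0 ∧ 0 < b ∧ 0 < g then 1 else 0) - (if b ≤ 0 ∧ 0 < a ∧ g < 0 then 1 else 0)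

lemma kap_anti (a b g : ℝ) : kap b a (-g) = - kap a b g := by
  unfold kap
  simp only [Left.neg_pos_iff, Left.neg_neg_iff]
  ring

/-- possible values -/
def Good (I : ℤ) (α β γ : ℝ) : Prop :=
  (0 ≤ I ∧ I ≤ 1) ∧ (0 < α → 0 < β → 0 < γ → I = 1) ∧ ((α < 0 ∨ β < 0 ∨ γ < 0) → I = 0)

lemma Good.rot {I : ℤ} {α β γ : ℝ} (h : Good I α β γ) : Good I β γ α :=
  ⟨h.1, fun h1 h2 h3 => h.2.1 h3 h1 h2, fun h' => h.2.2 (by tauto)⟩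

lemma good1 {a b c α β γ : ℝ} (hs : 0 < α + β + γ) (hb : α * a + β * b + γ * c = 0)
    (h1 : a ≤ 0) (h2 : 0 < b) (h3 : 0 < c) :
    Good (kap a b γ + kap b c α + kap c a β) α β γ := by
  have k1 : kap a b γ = if 0 < γ then 1 else 0 := by
    unfold kap; simp [h1, h2, not_le.2 h2]
  have k2 : kap b c α = 0 := by
    unfold kap; simp [not_le.2 h2, not_le.2 h3]
  have k3 : kap c a β = - if β < 0 then 1 else 0 := by
    unfold kap; simp [h1, h3, not_le.2 h3]
  rw [k1, k2, k3]
  have hA : β < 0 → 0 < γ := by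
    intro h
    by_contra hg
    push Not at hg
    have : 0 < α := by linarith
    nlinarith
  have hB : α < 0 → 0 ≤ β → γ ≤ 0 := by
    intro h h'
    by_contra hg
    push Not at hg
    nlinarith [mul_pos hg h3, mul_nonneg h' h2.le]
  unfold Good
  by_cases g1 : 0 < γ <;> by_cases g2 : β < 0 <;> simp only [g1, g2, if_true, if_false]
  · refine ⟨by norm_num, ?_, by norm_num⟩
    intros; linarith
  · refine ⟨by norm_num, by norm_num, ?_⟩
    rintro (h | h | h)
    · linarith [hB h (not_lt.1 g2)]
    · exact h.elim
    · linarith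
  · exact absurd (hA g2) g1
  · refine ⟨by norm_num, ?_, by norm_num⟩
    intro _ _ h; exact h.elim

lemma good2 {a b c α β γ : ℝ} (hs : 0 < α + β + γ) (hb : α * a + β * b + γ * c = 0)
    (h1 : 0 < a) (h2 : b ≤ 0) (h3 : c ≤ 0) :
    Good (kap a b γ + kap b c α + kap c a β) α β γ := by
  have k1 : kap a b γ = - if γ < 0 then 1 else 0 := by
    unfold kap; simp [h1, h2, not_le.2 h1]
  have k2 : kap b c α = 0 := by
    unfold kap; simp [not_lt.2 h2, not_lt.2 h3]
  have k3 : kap c a β = if 0 < β then 1 else 0 := by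
    unfold kap; simp [h1, h3, not_le.2 h1]
  rw [k1, k2, k3]
  have hA : γ < 0 → 0 < β := by
    intro h
    by_contra hg
    push Not at hg
    have : 0 < α := by linarith
    nlinarith [mul_pos this h1, mul_nonneg_of_nonpos_of_nonpos hg h2,
      mul_nonneg_of_nonpos_of_nonpos h.le h3]
  have hB : α < 0 → 0 ≤ γ → β ≤ 0 := by
    intro h h'
    by_contra hg
    push Not at hg
    nlinarith [mul_neg_of_neg_of_pos h h1, mul_nonpos_of_nonneg_of_nonpos hg.le h2,
      mul_nonpos_of_nonneg_of_nonpos h' h3]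
  unfold Good
  by_cases g1 : 0 < β <;> by_cases g2 : γ < 0 <;> simp only [g1, g2, if_true, if_false]
  · refine ⟨by norm_num, ?_, by norm_num⟩
    intros; linarith
  · refine ⟨by norm_num, by norm_num, ?_⟩
    rintro (h | h | h)
    · linarith [hB h (not_lt.1 g2)]
    · linarith
    · exact h.elim
  · exact absurd (hA g2) g1
  · refine ⟨by norm_num, ?_, by norm_num⟩
    intro _ h; exact h.elim

lemma good {a b c α β γ : ℝ} (hs : 0 < α + β + γ) (hb : α * a + β * b + γ * c = 0)
    (h0 : ¬ (a = 0 ∧ b = 0 ∧ c = 0)) :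
    Good (kap a b γ + kap b c α + kap c a β) α β γ := by
  have r1 : kap a b γ + kap b c α + kap c a β = kap b c α + kap c a β + kap a b γ := by ring
  have r2 : kap a b γ + kap b c α + kap c a β = kap c a β + kap a b γ + kap b c α := by ring
  rcases le_or_gt a 0 with ha | ha <;> rcases le_or_gt b 0 with hb' | hb' <;>
    rcases le_or_gt c 0 with hc | hc
  · have e : kap a b γ + kap b c α + kap c a β = 0 := by
      unfold kap; simp [not_lt.2 ha, not_lt.2 hb', not_lt.2 hc]
    rw [e]
    refine ⟨by norm_num, ?_, fun _ => rfl⟩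
    intro p1 p2 p3
    exfalso
    apply h0
    have q1 := mul_nonpos_of_nonneg_of_nonpos p1.le ha
    have q2 := mul_nonpos_of_nonneg_of_nonpos p2.le hb'
    have q3 := mul_nonpos_of_nonneg_of_nonpos p3.le hc
    refine ⟨?_, ?_, ?_⟩
    · have : α * a = 0 := by linarith
      exact (mul_eq_zero.1 this).resolve_left p1.ne'
    · have : β * b = 0 := by linarith
      exact (mul_eq_zero.1 this).resolve_left p2.ne'
    · have : γ * c = 0 := by linarith
      exact (mul_eq_zero.1 this).resolve_left p3.ne'
  · rw [r2]; exact (good2 (by linarith) (by linarith) hc ha hb').rot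
  · rw [r1]; exact (good2 (by linarith) (by linarith) hb' hc ha).rot.rot
  · exact good1 hs hb ha hb' hc
  · exact good2 hs hb ha hb' hc
  · rw [r1]; exact (good1 (by linarith) (by linarith) hb' hc ha).rot.rot
  · rw [r2]; exact (good1 (by linarith) (by linarith) hc ha hb').rot
  · have e : kap a b γ + kap b c α + kap c a β = 0 := by
      unfold kap; simp [not_le.2 ha, not_le.2 hb', not_le.2 hc]
    rw [e]
    refine ⟨by norm_num, ?_, fun _ => rfl⟩
    intro p1 p2 p3
    nlinarith [mul_pos p1 ha, mul_pos p2 hb', mul_pos p3 hc]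

/-- crossing number of an edge -/
noncomputable def kp (p A B : ℝ × ℝ) : ℤ := kap (A.2 - p.2) (B.2 - p.2) (det3 A B p)

lemma kp_anti (p A B : ℝ × ℝ) : kp p B A = - kp p A B := by
  unfold kp; rw [det3_swap A B p, kap_anti]

/-- winding number of a triangle -/
noncomputable def wind (p A B C : ℝ × ℝ) : ℤ := kp p A B + kp p B C + kp p C A

lemma wind_good (p A B C : ℝ × ℝ) (h : 0 < det3 A B C) :
    Good (wind p A B C) (det3 B C p) (det3 C A p) (det3 A B p) := by
  unfold wind kp
  apply good
  · have := det3_sum A B C p; linarith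
  · unfold det3; ring
  · rintro ⟨h1, h2, h3⟩
    have e1 : A.2 = p.2 := by linarith
    have e2 : B.2 = p.2 := by linarith
    have e3 : C.2 = p.2 := by linarith
    unfold det3 at h
    rw [e1, e2, e3] at h
    simp at h

end wind

section draw
variable {X : Type*} [DecidableEq X]

/-- `(i,j,k)` is a rotation of `(a,b,c)` -/
def IsRot (a b c i j k : X) : Prop :=
  (i = a ∧ j = b ∧ k = c) ∨ (i = b ∧ j = c ∧ k = a) ∨ (i = c ∧ j = a ∧ k = b)

lemma IsRot.cyc {a b c i j k : X} (h : IsRot a b c i j k) : IsRot a b c j k i := by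
  unfold IsRot at *; tauto

/-- a drawing of a triangulation with all inner faces positively oriented -/
structure Draw (pos : X → ℝ × ℝ) (a b c : X) (P : Finset X) (F : Finset (X × X × X)) : Prop where
  tri : Tri P F
  face : (a, b, c) ∈ F
  neg : det3 (pos a) (pos b) (pos c) < 0
  posi : ∀ {i j k}, (i, j, k) ∈ F → ¬ IsRot a b c i j k → 0 < det3 (pos i) (pos j) (pos k)

/-- inner faces -/
def Inn (F : Finset (X × X × X)) (a b c i j k : X) : Prop := (i, j, k) ∈ F ∧ ¬ IsRot a b c i j k

variable {pos : X → ℝ × ℝ} {a b c : X} {P : Finset X} {F : Finset (X × X × X)}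

lemma Draw.inn_cyc (D : Draw pos a b c P F) {i j k : X} (h : Inn F a b c i j k) :
    Inn F a b c j k i := ⟨D.tri.cyc h.1, fun h' => h.2 h'.cyc.cyc⟩

lemma Draw.inn_pos (D : Draw pos a b c P F) {i j k : X} (h : Inn F a b c i j k) :
    0 < det3 (pos i) (pos j) (pos k) := D.posi h.1 h.2

lemma sum_kp (T : Tri P F) (pos : X → ℝ × ℝ) (p : ℝ × ℝ) :
    ∑ t ∈ F, kp p (pos t.1) (pos t.2.1) = 0 := by
  have hr : ∀ t ∈ F, ∃ w, (t.2.1, t.1, w) ∈ F := by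
    rintro ⟨i, j, k⟩ h
    exact T.rev h
  choose g hg using hr
  refine Finset.sum_involution (fun t ht => (t.2.1, t.1, g t ht)) ?_ ?_ ?_ ?_
  · intro t ht
    simp only
    rw [kp_anti]; ring
  · rintro ⟨i, j, k⟩ ht _ h
    simp only [Prod.mk.injEq] at h
    exact T.ne ht h.2.1
  · intro t ht; exact hg t ht
  · rintro ⟨i, j, k⟩ ht
    simp only [Prod.mk.injEq, true_and]
    exact T.uniq (hg _ (hg _ ht)) ht

lemma sum_wind (T : Tri P F) (pos : X → ℝ × ℝ) (p : ℝ × ℝ) :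
    ∑ t ∈ F, wind p (pos t.1) (pos t.2.1) (pos t.2.2) = 0 := by
  have rF : ∀ (h : X × X × X → ℤ), ∑ t ∈ F, h (t.2.1, t.2.2, t.1) = ∑ t ∈ F, h t := by
    intro h
    refine Finset.sum_nbij' (fun t => (t.2.1, t.2.2, t.1)) (fun t => (t.2.2, t.1, t.2.1)) ?_ ?_ ?_
      ?_ ?_
    · rintro ⟨i, j, k⟩ h; exact T.cyc h
    · rintro ⟨i, j, k⟩ h; exact T.cyc2 h
    · rintro ⟨i, j, k⟩ _; rfl
    · rintro ⟨i, j, k⟩ _; rfl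
    · rintro ⟨i, j, k⟩ _; rfl
  unfold wind
  rw [Finset.sum_add_distrib, Finset.sum_add_distrib, sum_kp T]
  have h1 := rF (fun t => kp p (pos t.1) (pos t.2.1))
  have h2 := rF (fun t => kp p (pos t.2.1) (pos t.2.2))
  simp only at h1 h2
  rw [sum_kp T] at h1
  rw [h1] at h2
  rw [h1, h2]; rfl

lemma Draw.sum_inner (D : Draw pos a b c P F) (p : ℝ × ℝ) :
    open Classical in
    ∑ t ∈ F.filter (fun t => ¬ IsRot a b c t.1 t.2.1 t.2.2),
      wind p (pos t.1) (pos t.2.1) (pos t.2.2) = 3 * wind p (pos a) (pos c) (pos b) := by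
  classical
  have h0 := sum_wind D.tri pos p
  rw [← Finset.sum_filter_add_sum_filter_not F (fun t => IsRot a b c t.1 t.2.1 t.2.2)] at h0
  have h1 : F.filter (fun t => IsRot a b c t.1 t.2.1 t.2.2) = {(a, b, c), (b, c, a), (c, a, b)} := by
    ext ⟨i, j, k⟩
    simp only [Finset.mem_filter, Finset.mem_insert, Finset.mem_singleton, Prod.mk.injEq]
    constructor
    · exact fun h => h.2
    · intro h
      refine ⟨?_, h⟩
      rcases h with ⟨rfl, rfl, rfl⟩ | ⟨rfl, rfl, rfl⟩ | ⟨rfl, rfl, rfl⟩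
      · exact D.face
      · exact D.tri.cyc D.face
      · exact D.tri.cyc2 D.face
  have n1 := D.tri.ne D.face
  have n2 := D.tri.ne2 D.face
  have n3 := D.tri.ne3 D.face
  rw [h1, Finset.sum_insert (by simp [n1]; try grind), Finset.sum_insert (by simp [n2]; try grind),
    Finset.sum_singleton] at h0
  have e : wind p (pos a) (pos c) (pos b) = - wind p (pos a) (pos b) (pos c) := by
    unfold wind
    rw [kp_anti p (pos a) (pos b), kp_anti p (pos b) (pos c), kp_anti p (pos c) (pos a)]
    ring
  have e1 : wind p (pos b) (pos c) (pos a) = wind p (pos a) (pos b) (pos c) := by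
    unfold wind; ring
  have e2 : wind p (pos c) (pos a) (pos b) = wind p (pos a) (pos b) (pos c) := by
    unfold wind; ring
  simp only at h0
  rw [e1, e2] at h0
  rw [e]
  linarith

/-- `p` is in the open triangle -/
def InO (A B C p : ℝ × ℝ) : Prop := 0 < det3 A B p ∧ 0 < det3 B C p ∧ 0 < det3 C A p
/-- `p` is in the closed triangle -/
def InC (A B C p : ℝ × ℝ) : Prop := 0 ≤ det3 A B p ∧ 0 ≤ det3 B C p ∧ 0 ≤ det3 C A p

lemma Draw.neg' (D : Draw pos a b c P F) : 0 < det3 (pos a) (pos c) (pos b) := by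
  have := D.neg
  have e : det3 (pos a) (pos c) (pos b) = - det3 (pos a) (pos b) (pos c) := by unfold det3; ring
  linarith

theorem Draw.disj (D : Draw pos a b c P F) {i j k i' j' k' : X} (h : Inn F a b c i j k)
    (h' : Inn F a b c i' j' k') {p : ℝ × ℝ} (hp : InO (pos i) (pos j) (pos k) p)
    (hp' : InO (pos i') (pos j') (pos k') p) : IsRot i j k i' j' k' := by
  classical
  by_contra hcon
  have hs := D.sum_inner p
  have T := D.tri
  have n1 := T.ne h.1
  have n2 := T.ne2 h.1
  have n3 := T.ne3 h.1
  have one : ∀ {i j k}, Inn F a b c i j k → InO (pos i) (pos j) (pos k) p →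
      wind p (pos i) (pos j) (pos k) = 1 := fun h hp =>
    (wind_good p _ _ _ (D.inn_pos h)).2.1 hp.2.1 hp.2.2 hp.1
  have mem : ∀ {i j k}, Inn F a b c i j k → (i, j, k) ∈
      F.filter (fun t => ¬ IsRot a b c t.1 t.2.1 t.2.2) := by
    intro i j k h
    rw [Finset.mem_filter]; exact h
  have hsub : ({(i, j, k), (j, k, i), (k, i, j), (i', j', k')} : Finset (X × X × X)) ⊆
      F.filter (fun t => ¬ IsRot a b c t.1 t.2.1 t.2.2) := by
    intro t ht
    simp only [Finset.mem_insert, Finset.mem_singleton] at ht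
    rcases ht with rfl | rfl | rfl | rfl
    · exact mem h
    · exact mem (D.inn_cyc h)
    · exact mem (D.inn_cyc (D.inn_cyc h))
    · exact mem h'
  have hle := Finset.sum_le_sum_of_subset_of_nonneg (f := fun t : X × X × X =>
    wind p (pos t.1) (pos t.2.1) (pos t.2.2)) hsub (by
      rintro ⟨x, y, z⟩ ht _
      rw [Finset.mem_filter] at ht
      exact (wind_good p _ _ _ (D.inn_pos ht)).1.1)
  rw [hs] at hle
  have e1 : wind p (pos j) (pos k) (pos i) = wind p (pos i) (pos j) (pos k) := by
    unfold wind; ring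
  have e2 : wind p (pos k) (pos i) (pos j) = wind p (pos i) (pos j) (pos k) := by
    unfold wind; ring
  rw [Finset.sum_insert (by unfold IsRot at hcon; simp; grind),
    Finset.sum_insert (by unfold IsRot at hcon; simp; grind),
    Finset.sum_insert (by unfold IsRot at hcon; simp; grind), Finset.sum_singleton] at hle
  simp only at hle
  rw [e1, e2, one h hp, one h' hp'] at hle
  have := (wind_good p _ _ _ D.neg').1.2
  omega

theorem Draw.in_outer (D : Draw pos a b c P F) {i j k : X} (h : Inn F a b c i j k)
    {p : ℝ × ℝ} (hp : InO (pos i) (pos j) (pos k) p) : InC (pos a) (pos c) (pos b) p := by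
  classical
  have hs := D.sum_inner p
  have hle := Finset.single_le_sum (f := fun t : X × X × X =>
    wind p (pos t.1) (pos t.2.1) (pos t.2.2))
    (s := F.filter (fun t => ¬ IsRot a b c t.1 t.2.1 t.2.2)) (by
      rintro ⟨x, y, z⟩ ht
      rw [Finset.mem_filter] at ht
      exact (wind_good p _ _ _ (D.inn_pos ht)).1.1) (a := (i, j, k)) (by
        rw [Finset.mem_filter]; exact h)
  rw [hs] at hle
  simp only at hle
  rw [(wind_good p _ _ _ (D.inn_pos h)).2.1 hp.2.1 hp.2.2 hp.1] at hle
  have g := wind_good p _ _ _ D.neg'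
  unfold InC
  by_contra hcon
  have := g.2.2 (by
    by_contra h'
    push Not at h'
    exact hcon ⟨h'.2.2, h'.1, h'.2.1⟩)
  omega

theorem Draw.cover (D : Draw pos a b c P F) {p : ℝ × ℝ} (hp : InO (pos a) (pos c) (pos b) p) :
    ∃ i j k, Inn F a b c i j k ∧ InC (pos i) (pos j) (pos k) p := by
  classical
  have hs := D.sum_inner p
  rw [(wind_good p _ _ _ D.neg').2.1 hp.2.1 hp.2.2 hp.1] at hs
  obtain ⟨⟨i, j, k⟩, ht, hne⟩ := Finset.exists_ne_zero_of_sum_ne_zero (by rw [hs]; norm_num)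
  rw [Finset.mem_filter] at ht
  refine ⟨i, j, k, ht, ?_⟩
  have g := wind_good p _ _ _ (D.inn_pos ht)
  unfold InC
  by_contra hcon
  exact hne (g.2.2 (by
    by_contra h'
    push Not at h'
    exact hcon ⟨h'.2.2, h'.1, h'.2.1⟩))

end draw
end OPM


namespace OPM
open Filter Topology
section geo

/-- affine interpolation -/
def lin (A B : ℝ × ℝ) (s : ℝ) : ℝ × ℝ := (A.1 + s * (B.1 - A.1), A.2 + s * (B.2 - A.2))

lemma lin_zero (A B : ℝ × ℝ) : lin A B 0 = A := by ext <;> simp [lin]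
lemma lin_one (A B : ℝ × ℝ) : lin A B 1 = B := by ext <;> simp [lin]
lemma lin_same (A : ℝ × ℝ) (s : ℝ) : lin A A s = A := by ext <;> simp [lin]
lemma lin_symm (A B : ℝ × ℝ) (s : ℝ) : lin B A (1 - s) = lin A B s := by
  ext <;> simp only [lin] <;> ring

lemma det3_lin (X Y A B : ℝ × ℝ) (s : ℝ) :
    det3 X Y (lin A B s) = (1 - s) * det3 X Y A + s * det3 X Y B := by
  simp only [det3, lin]; ring

lemma lin_cont (A B : ℝ × ℝ) : Continuous (lin A B) := by unfold lin; fun_prop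

lemma det3_cont {T : Type*} [TopologicalSpace T] {f g h : T → ℝ × ℝ} {t : T}
    (hf : ContinuousAt f t) (hg : ContinuousAt g t) (hh : ContinuousAt h t) :
    ContinuousAt (fun x => det3 (f x) (g x) (h x)) t := by
  unfold det3; fun_prop

lemma seg_iff {A B p : ℝ × ℝ} : p ∈ segment ℝ A B ↔ ∃ s, 0 ≤ s ∧ s ≤ 1 ∧ p = lin A B s := by
  rw [segment_eq_image']
  constructor
  · rintro ⟨s, hs, rfl⟩
    exact ⟨s, hs.1, hs.2, by ext <;> simp [lin]⟩
  · rintro ⟨s, h0, h1, rfl⟩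
    exact ⟨s, ⟨h0, h1⟩, by ext <;> simp [lin]⟩

lemma lin_inj {A B : ℝ × ℝ} (h : A ≠ B) {s t : ℝ} (e : lin A B s = lin A B t) : s = t := by
  by_contra hst
  apply h
  have e1 := congrArg Prod.fst e
  have e2 := congrArg Prod.snd e
  simp only [lin] at e1 e2
  have hst' : s - t ≠ 0 := sub_ne_zero.2 hst
  ext
  · have : (s - t) * (B.1 - A.1) = 0 := by linarith
    have := (mul_eq_zero.1 this).resolve_left hst'
    linarith
  · have : (s - t) * (B.2 - A.2) = 0 := by linarith
    have := (mul_eq_zero.1 this).resolve_left hst'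
    linarith

lemma seg_lin {A B : ℝ × ℝ} {s t r : ℝ} (h1 : s ≤ r) (h2 : r ≤ t) :
    lin A B r ∈ segment ℝ (lin A B s) (lin A B t) := by
  rcases eq_or_lt_of_le (h1.trans h2) with e | e
  · have : r = s := by linarith
    rw [this]; exact left_mem_segment _ _ _
  · have e' : 0 < t - s := by linarith
    refine seg_iff.2 ⟨(r - s) / (t - s), div_nonneg (by linarith) e'.le,
      (div_le_one e').2 (by linarith), ?_⟩
    ext <;> simp only [lin] <;> field_simp <;> ring

/-- collinear points are on the line -/
lemma line_of_det {A B p : ℝ × ℝ} (h : A ≠ B) (h0 : det3 A B p = 0) : ∃ s, p = lin A B s := by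
  have hd : 0 < (B.1 - A.1) ^ 2 + (B.2 - A.2) ^ 2 := by
    by_contra hc
    apply h
    have h1 : (B.1 - A.1) ^ 2 = 0 := by nlinarith [sq_nonneg (B.1 - A.1), sq_nonneg (B.2 - A.2)]
    have h2 : (B.2 - A.2) ^ 2 = 0 := by nlinarith [sq_nonneg (B.1 - A.1), sq_nonneg (B.2 - A.2)]
    have h1 := pow_eq_zero_iff (two_ne_zero) |>.1 h1
    have h2 := pow_eq_zero_iff (two_ne_zero) |>.1 h2
    ext <;> linarith
  unfold det3 at h0
  refine ⟨((p.1 - A.1) * (B.1 - A.1) + (p.2 - A.2) * (B.2 - A.2)) /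
    ((B.1 - A.1) ^ 2 + (B.2 - A.2) ^ 2), ?_⟩
  ext
  · simp only [lin]
    rw [div_mul_eq_mul_div, ← sub_eq_iff_eq_add', eq_div_iff hd.ne']
    linear_combination (-(B.2 - A.2)) * h0
  · simp only [lin]
    rw [div_mul_eq_mul_div, ← sub_eq_iff_eq_add', eq_div_iff hd.ne']
    linear_combination (B.1 - A.1) * h0

/-- centroid -/
noncomputable def cen (A B C : ℝ × ℝ) : ℝ × ℝ := ((A.1 + B.1 + C.1) / 3, (A.2 + B.2 + C.2) / 3)

lemma InO.inC {A B C p : ℝ × ℝ} (h : InO A B C p) : InC A B C p := ⟨h.1.le, h.2.1.le, h.2.2.le⟩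
lemma InO.rot {A B C p : ℝ × ℝ} (h : InO A B C p) : InO B C A p := ⟨h.2.1, h.2.2, h.1⟩
lemma InC.rot {A B C p : ℝ × ℝ} (h : InC A B C p) : InC B C A p := ⟨h.2.1, h.2.2, h.1⟩

lemma cen_det {A B C : ℝ × ℝ} : det3 A B (cen A B C) = det3 A B C / 3 ∧
    det3 B C (cen A B C) = det3 A B C / 3 ∧ det3 C A (cen A B C) = det3 A B C / 3 := by
  refine ⟨?_, ?_, ?_⟩ <;> simp only [det3, cen] <;> ring

lemma toward {A B C p : ℝ × ℝ} (hd : 0 < det3 A B C) (h : InC A B C p) {s : ℝ} (h0 : 0 < s)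
    (h1 : s ≤ 1) : InO A B C (lin p (cen A B C) s) := by
  obtain ⟨c1, c2, c3⟩ := cen_det (A := A) (B := B) (C := C)
  refine ⟨?_, ?_, ?_⟩ <;> rw [det3_lin]
  · rw [c1]; nlinarith [h.1, mul_pos h0 hd, mul_nonneg (sub_nonneg.2 h1) h.1]
  · rw [c2]; nlinarith [h.1, mul_pos h0 hd, mul_nonneg (sub_nonneg.2 h1) h.2.1]
  · rw [c3]; nlinarith [h.1, mul_pos h0 hd, mul_nonneg (sub_nonneg.2 h1) h.2.2]

lemma inC_left {A B C : ℝ × ℝ} (hd : 0 < det3 A B C) : InC A B C A := by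
  refine ⟨?_, ?_, ?_⟩
  · rw [det3_self]
  · rw [det3_rot]; exact hd.le
  · rw [det3_self']

lemma inC_seg {A B C p : ℝ × ℝ} (hd : 0 < det3 A B C) (h : p ∈ segment ℝ A B) :
    InC A B C p := by
  obtain ⟨s, h0, h1, rfl⟩ := seg_iff.1 h
  refine ⟨?_, ?_, ?_⟩ <;> rw [det3_lin]
  · rw [det3_self, det3_self']; simp
  · rw [det3_self, det3_rot]; nlinarith
  · rw [det3_self', det3_rot2]; nlinarith

lemma det_seg {A B p : ℝ × ℝ} (h : p ∈ segment ℝ A B) : det3 A B p = 0 := by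
  obtain ⟨s, h0, h1, rfl⟩ := seg_iff.1 h
  rw [det3_lin, det3_self, det3_self']; simp

lemma ev_inO {A B C p : ℝ × ℝ} (h : InO A B C p) {q : ℝ → ℝ × ℝ} (hq : ContinuousAt q 0)
    (h0 : q 0 = p) : ∀ᶠ s in 𝓝 (0:ℝ), InO A B C (q s) := by
  have ca : ∀ Z : ℝ × ℝ, ContinuousAt (fun _ : ℝ => Z) 0 := fun _ => continuousAt_const
  have e1 := (det3_cont (ca A) (ca B) hq).eventually_const_lt (u := 0) (by beta_reduce; rw [h0]; exact h.1)
  have e2 := (det3_cont (ca B) (ca C) hq).eventually_const_lt (u := 0) (by beta_reduce; rw [h0]; exact h.2.1)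
  have e3 := (det3_cont (ca C) (ca A) hq).eventually_const_lt (u := 0) (by beta_reduce; rw [h0]; exact h.2.2)
  filter_upwards [e1, e2, e3] with s a b c
  exact ⟨a, b, c⟩

lemma ev_not_inC {A B C p : ℝ × ℝ} (h : ¬ InC A B C p) {q : ℝ → ℝ × ℝ} (hq : ContinuousAt q 0)
    (h0 : q 0 = p) : ∀ᶠ s in 𝓝 (0:ℝ), ¬ InC A B C (q s) := by
  have ca : ∀ Z : ℝ × ℝ, ContinuousAt (fun _ : ℝ => Z) 0 := fun _ => continuousAt_const
  have : det3 A B p < 0 ∨ det3 B C p < 0 ∨ det3 C A p < 0 := by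
    by_contra hc
    push Not at hc
    exact h hc
  rcases this with h | h | h
  · filter_upwards [(det3_cont (ca A) (ca B) hq).eventually_lt_const (u := 0)
      (by beta_reduce; rw [h0]; exact h)] with s hs hc
    linarith [hc.1]
  · filter_upwards [(det3_cont (ca B) (ca C) hq).eventually_lt_const (u := 0)
      (by beta_reduce; rw [h0]; exact h)] with s hs hc
    linarith [hc.2.1]
  · filter_upwards [(det3_cont (ca C) (ca A) hq).eventually_lt_const (u := 0)
      (by beta_reduce; rw [h0]; exact h)] with s hs hc
    linarith [hc.2.2]

/-- pick a small positive parameter -/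
lemma pick {p : ℝ → Prop} (h : ∀ᶠ s in 𝓝 (0:ℝ), p s) : ∃ s, 0 < s ∧ s < 1 ∧ p s := by
  have h1 : ∀ᶠ s in 𝓝[>] (0:ℝ), p s := h.filter_mono nhdsWithin_le_nhds
  have h2 : ∀ᶠ s in 𝓝[>] (0:ℝ), s ∈ Set.Ioo (0:ℝ) 1 := Ioo_mem_nhdsGT one_pos
  obtain ⟨s, hs, hs'⟩ := (h1.and h2).exists
  exact ⟨s, hs'.1, hs'.2, hs⟩

end geo

section draw2
variable {X : Type*} [DecidableEq X]
variable {pos : X → ℝ × ℝ} {a b c : X} {P : Finset X} {F : Finset (X × X × X)}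

lemma Draw.exists_inn (D : Draw pos a b c P F) {v : X} (hv : v ∈ P) :
    ∃ n n', Inn F a b c v n n' := by
  have T := D.tri
  obtain ⟨n, n', h⟩ := T.exists_adj hv
  by_cases hr : IsRot a b c v n n'
  · obtain ⟨w, hw⟩ := T.rev h
    refine ⟨w, n, T.cyc hw, ?_⟩
    intro hr'
    have n1 := T.ne D.face
    have n2 := T.ne2 D.face
    have n3 := T.ne3 D.face
    unfold IsRot at hr hr'
    grind
  · exact ⟨n, n', h, hr⟩

lemma Draw.edge_inn (D : Draw pos a b c P F) {u v : X} (h : Adj F u v) :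
    (∃ w, Inn F a b c u v w) ∨ (∃ w, Inn F a b c v u w) := by
  have T := D.tri
  obtain ⟨w, h⟩ := h
  by_cases hr : IsRot a b c u v w
  · right
    obtain ⟨w, hw⟩ := T.rev h
    refine ⟨w, hw, ?_⟩
    intro hr'
    have n1 := T.ne D.face
    have n2 := T.ne2 D.face
    have n3 := T.ne3 D.face
    unfold IsRot at hr hr'
    grind
  · exact Or.inl ⟨w, h, hr⟩

lemma Draw.perturb (D : Draw pos a b c P F) {q : ℝ → X → ℝ × ℝ}
    (hq : ∀ x, ContinuousAt (fun s => q s x) 0) (h0 : q 0 = pos) :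
    ∀ᶠ s in 𝓝 (0:ℝ), Draw (q s) a b c P F := by
  have e1 : ∀ᶠ s in 𝓝 (0:ℝ), det3 (q s a) (q s b) (q s c) < 0 :=
    (det3_cont (hq a) (hq b) (hq c)).eventually_lt_const (by beta_reduce; rw [h0]; exact D.neg)
  have e2 : ∀ᶠ s in 𝓝 (0:ℝ), ∀ t ∈ F, ¬ IsRot a b c t.1 t.2.1 t.2.2 →
      0 < det3 (q s t.1) (q s t.2.1) (q s t.2.2) := by
    rw [Filter.eventually_all_finset]
    rintro ⟨i, j, k⟩ ht
    by_cases hr : IsRot a b c i j k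
    · exact Eventually.of_forall fun s h => absurd hr h
    · filter_upwards [(det3_cont (hq i) (hq j) (hq k)).eventually_const_lt (u := 0)
        (by beta_reduce; rw [h0]; exact D.posi ht hr)] with s hs _
      exact hs
  filter_upwards [e1, e2] with s h1 h2
  exact ⟨D.tri, D.face, h1, fun {i j k} h hr => h2 (i, j, k) h hr⟩

lemma Draw.perturb1 (D : Draw pos a b c P F) (w : X) (g : ℝ × ℝ) :
    ∀ᶠ s in 𝓝 (0:ℝ), Draw (Function.update pos w (lin (pos w) g s)) a b c P F := by
  apply D.perturb
  · intro x
    by_cases hx : x = w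
    · subst hx
      simp only [Function.update_self]
      exact (lin_cont _ _).continuousAt
    · simp only [Function.update_of_ne hx]
      exact continuousAt_const
  · rw [lin_zero, Function.update_eq_self]

lemma Draw.key (D : Draw pos a b c P F) {i j k i' j' k' : X} (h : Inn F a b c i j k)
    (h' : Inn F a b c i' j' k') {p : ℝ × ℝ} (hp : InO (pos i) (pos j) (pos k) p)
    (hp' : InC (pos i') (pos j') (pos k') p) : IsRot i j k i' j' k' := by
  obtain ⟨s, h0, h1, hs⟩ := pick (ev_inO hp (q := lin p (cen (pos i') (pos j') (pos k')))
    (lin_cont _ _).continuousAt (lin_zero _ _))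
  exact D.disj h h' hs (toward (D.inn_pos h') hp' h0 h1.le)

lemma Draw.inC_outer (D : Draw pos a b c P F) {v : X} (hv : v ∈ P) :
    InC (pos a) (pos c) (pos b) (pos v) := by
  obtain ⟨n, n', h⟩ := D.exists_inn hv
  by_contra hcon
  obtain ⟨s, h0, h1, hs⟩ := pick (ev_not_inC hcon
    (q := lin (pos v) (cen (pos v) (pos n) (pos n'))) (lin_cont _ _).continuousAt (lin_zero _ _))
  exact hs (D.in_outer h (toward (D.inn_pos h) (inC_left (D.inn_pos h)) h0 h1.le))

lemma push_out {A B p : ℝ × ℝ} (hAB : A ≠ B) :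
    ∃ g, det3 A B g < det3 A B p := by
  refine ⟨(p.1 + (B.2 - A.2), p.2 - (B.1 - A.1)), ?_⟩
  have : 0 < (B.1 - A.1) ^ 2 + (B.2 - A.2) ^ 2 := by
    by_contra hc
    apply hAB
    have h1 : (B.1 - A.1) ^ 2 = 0 := by nlinarith [sq_nonneg (B.1 - A.1), sq_nonneg (B.2 - A.2)]
    have h2 : (B.2 - A.2) ^ 2 = 0 := by nlinarith [sq_nonneg (B.1 - A.1), sq_nonneg (B.2 - A.2)]
    have h1 := pow_eq_zero_iff (two_ne_zero) |>.1 h1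
    have h2 := pow_eq_zero_iff (two_ne_zero) |>.1 h2
    ext <;> linarith
  unfold det3
  nlinarith

lemma det3_ne {A B C : ℝ × ℝ} (h : 0 < det3 A B C) : A ≠ B := by
  rintro rfl; unfold det3 at h; simp at h

lemma Draw.inO_outer (D : Draw pos a b c P F) {v : X} (hv : v ∈ P) (ha : v ≠ a) (hb : v ≠ b)
    (hc : v ≠ c) : InO (pos a) (pos c) (pos b) (pos v) := by
  have h := D.inC_outer hv
  have H : ∀ (A B : ℝ × ℝ), A ≠ B → det3 A B (pos v) ≤ 0 →
      ∃ g, ∀ s, 0 < s → det3 A B (lin (pos v) g s) < 0 := by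
    intro A B hAB hle
    obtain ⟨g, hg⟩ := push_out (p := pos v) hAB
    refine ⟨g, fun s hs => ?_⟩
    rw [det3_lin]
    nlinarith
  have e := D.neg'
  have e2 : 0 < det3 (pos c) (pos b) (pos a) := by rw [det3_rot]; exact e
  have e3 : 0 < det3 (pos b) (pos a) (pos c) := by rw [det3_rot2]; exact e
  refine ⟨?_, ?_, ?_⟩
  · by_contra hcon
    obtain ⟨g, hg⟩ := H _ _ (det3_ne e) (not_lt.1 hcon)
    obtain ⟨s, h0, h1, hs⟩ := pick (D.perturb1 v g)
    have := (hs.inC_outer hv).1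
    rw [Function.update_self, Function.update_of_ne ha.symm, Function.update_of_ne hc.symm] at this
    linarith [hg s h0]
  · by_contra hcon
    obtain ⟨g, hg⟩ := H _ _ (det3_ne e2) (not_lt.1 hcon)
    obtain ⟨s, h0, h1, hs⟩ := pick (D.perturb1 v g)
    have := (hs.inC_outer hv).2.1
    rw [Function.update_self, Function.update_of_ne hb.symm, Function.update_of_ne hc.symm] at this
    linarith [hg s h0]
  · by_contra hcon
    obtain ⟨g, hg⟩ := H _ _ (det3_ne e3) (not_lt.1 hcon)
    obtain ⟨s, h0, h1, hs⟩ := pick (D.perturb1 v g)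
    have := (hs.inC_outer hv).2.2
    rw [Function.update_self, Function.update_of_ne ha.symm, Function.update_of_ne hb.symm] at this
    linarith [hg s h0]

lemma Draw.W (D : Draw pos a b c P F) {i j k w : X} (h : Inn F a b c i j k) (hw : w ∈ P)
    (hc : InC (pos i) (pos j) (pos k) (pos w)) : w = i ∨ w = j ∨ w = k := by
  by_contra hcon
  push Not at hcon
  obtain ⟨h1, h2, h3⟩ := hcon
  obtain ⟨s, s0, s1, D'⟩ := pick (D.perturb1 w (cen (pos i) (pos j) (pos k)))
  have hO := toward (D.inn_pos h) hc s0 s1.le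
  obtain ⟨n, n', hn⟩ := D.exists_inn hw
  have := D'.key h hn (p := lin (pos w) (cen (pos i) (pos j) (pos k)) s) (by
    rw [Function.update_of_ne h1.symm, Function.update_of_ne h2.symm,
      Function.update_of_ne h3.symm]; exact hO) (by
    have := inC_left (D'.inn_pos hn)
    rw [Function.update_self] at this ⊢
    exact this)
  unfold IsRot at this
  rcases this with h | h | h
  · exact h1 h.1
  · exact h2 h.1
  · exact h3 h.1

lemma Draw.X0 (D : Draw pos a b c P F) {i j k u v : X} (h : Inn F a b c i j k) (he : Adj F u v)
    {p : ℝ × ℝ} (hp : p ∈ segment ℝ (pos u) (pos v)) (hO : InO (pos i) (pos j) (pos k) p) :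
    False := by
  have H : ∀ u v w, Inn F a b c u v w → p ∈ segment ℝ (pos u) (pos v) → False := by
    intro u v w h' hp
    have hr := D.key h h' hO (inC_seg (D.inn_pos h') hp)
    have hz := det_seg hp
    rcases hr with ⟨rfl, rfl, rfl⟩ | ⟨rfl, rfl, rfl⟩ | ⟨rfl, rfl, rfl⟩
    · linarith [hO.1]
    · linarith [hO.2.1]
    · linarith [hO.2.2]
  rcases D.edge_inn he with ⟨w, hw⟩ | ⟨w, hw⟩
  · exact H _ _ _ hw hp
  · exact H _ _ _ hw (by rw [segment_symm]; exact hp)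

lemma Draw.WE (D : Draw pos a b c P F) {u x y : X} (he : Adj F x y) (hu : u ∈ P)
    (hp : pos u ∈ segment ℝ (pos x) (pos y)) : u = x ∨ u = y := by
  have H : ∀ x y w, Inn F a b c x y w → pos u ∈ segment ℝ (pos x) (pos y) → u = x ∨ u = y := by
    intro x y w h' hp
    rcases D.W h' hu (inC_seg (D.inn_pos h') hp) with h | h | h
    · exact Or.inl h
    · exact Or.inr h
    · have := D.inn_pos h'
      rw [← h, det_seg hp] at this
      exact absurd this (lt_irrefl _)
  rcases D.edge_inn he with ⟨w, hw⟩ | ⟨w, hw⟩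
  · exact H _ _ _ hw hp
  · exact (H _ _ _ hw (by rw [segment_symm]; exact hp)).symm

lemma Draw.inj (D : Draw pos a b c P F) {u v : X} (hu : u ∈ P) (hv : v ∈ P)
    (h : pos u = pos v) : u = v := by
  obtain ⟨n, n', hn⟩ := D.exists_inn hv
  have hp := D.inn_pos hn
  rcases D.W hn hu (by rw [h]; exact inC_left hp) with e | e | e
  · exact e
  · rw [← e, h] at hp; exact absurd rfl (det3_ne hp)
  · rw [← e, h] at hp; rw [det3_self] at hp; exact absurd hp (lt_irrefl _)

lemma Draw.cone (D : Draw pos a b c P F) {q : X} (hq : q ∈ P) (ha : q ≠ a) (hb : q ≠ b)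
    (hc : q ≠ c) (z : ℝ × ℝ) : ∃ n n', Inn F a b c q n n' ∧ 0 ≤ det3 (pos q) (pos n) z ∧
      0 ≤ det3 (pos n') (pos q) z := by
  by_contra hcon
  push Not at hcon
  have hlin : ContinuousAt (lin (pos q) z) 0 := (lin_cont _ _).continuousAt
  have e1 := ev_inO (D.inO_outer hq ha hb hc) hlin (lin_zero _ _)
  have e2 : ∀ᶠ s in 𝓝 (0:ℝ), ∀ t ∈ F, Inn F a b c t.1 t.2.1 t.2.2 →
      t.1 ≠ q → t.2.1 ≠ q → t.2.2 ≠ q →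
      ¬ InC (pos t.1) (pos t.2.1) (pos t.2.2) (lin (pos q) z s) := by
    rw [Filter.eventually_all_finset]
    rintro ⟨i, j, k⟩ ht
    by_cases hr : Inn F a b c i j k ∧ i ≠ q ∧ j ≠ q ∧ k ≠ q
    · obtain ⟨hr, h1, h2, h3⟩ := hr
      have : ¬ InC (pos i) (pos j) (pos k) (pos q) := fun hC => by
        rcases D.W hr hq hC with h | h | h
        · exact h1 h.symm
        · exact h2 h.symm
        · exact h3 h.symm
      filter_upwards [ev_not_inC this hlin (lin_zero _ _)] with s hs _ _ _ _
      exact hs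
    · exact Eventually.of_forall fun s h h1 h2 h3 => absurd ⟨h, h1, h2, h3⟩ hr
  obtain ⟨s, s0, s1, h1, h2⟩ := pick (e1.and e2)
  have H : ∀ n n', Inn F a b c q n n' → ¬ InC (pos q) (pos n) (pos n') (lin (pos q) z s) := by
    intro n n' hn hC
    have g1 := hC.1
    have g2 := hC.2.2
    rw [det3_lin, det3_self] at g1
    rw [det3_lin, det3_self'] at g2
    have g1' : 0 ≤ det3 (pos q) (pos n) z := by
      by_contra hc; push Not at hc; nlinarith
    have := hcon n n' hn g1'
    nlinarith
  obtain ⟨i, j, k, hI, hC⟩ := D.cover h1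
  by_cases hi : i = q
  · subst hi; exact H _ _ hI hC
  by_cases hj : j = q
  · subst hj; exact H _ _ (D.inn_cyc hI) hC.rot
  by_cases hk : k = q
  · subst hk; exact H _ _ (D.inn_cyc (D.inn_cyc hI)) hC.rot.rot
  exact h2 (i, j, k) hI.1 hI hi hj hk hC

/-- collinear overlapping edges coincide -/
lemma Draw.overlap (D : Draw pos a b c P F) {u v x y : X} (h1 : Adj F u v) (h2 : Adj F x y)
    {tx ty r : ℝ} (hx : pos x = lin (pos u) (pos v) tx) (hy : pos y = lin (pos u) (pos v) ty)
    (r0 : 0 < r) (r1 : r < 1) (rx : tx < r) (ry : r < ty) : u = x ∧ v = y := by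
  have T := D.tri
  have huv : pos u ≠ pos v := fun h =>
    T.adj_ne h1 (D.inj (T.adj_mem h1) (T.adj_mem (T.adj_symm h1)) h)
  have c0 : pos u = lin (pos u) (pos v) 0 := (lin_zero _ _).symm
  have c1 : pos v = lin (pos u) (pos v) 1 := (lin_one _ _).symm
  have k1 : u = x := by
    rcases lt_or_ge tx 0 with h | h
    · have hm : pos u ∈ segment ℝ (pos x) (pos y) := by
        have := seg_lin (A := pos u) (B := pos v) h.le (show (0:ℝ) ≤ ty by linarith)
        rw [← hx, ← hy, lin_zero] at this
        exact this
      rcases D.WE h2 (T.adj_mem h1) hm with e | e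
      · exact e
      · rw [← e] at hy
        have := lin_inj huv (c0.symm.trans hy)
        linarith
    · have hm : pos x ∈ segment ℝ (pos u) (pos v) := by
        rw [hx]; exact seg_iff.2 ⟨tx, h, by linarith, rfl⟩
      rcases D.WE h1 (T.adj_mem h2) hm with e | e
      · exact e.symm
      · rw [e] at hx
        have := lin_inj huv (c1.symm.trans hx)
        linarith
  refine ⟨k1, ?_⟩
  rcases le_or_gt ty 1 with h | h
  · have hm : pos y ∈ segment ℝ (pos u) (pos v) := by
      rw [hy]; exact seg_iff.2 ⟨ty, by linarith, h, rfl⟩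
    rcases D.WE h1 (T.adj_mem (T.adj_symm h2)) hm with e | e
    · rw [e] at hy
      have := lin_inj huv (c0.symm.trans hy)
      linarith
    · exact e.symm
  · have hm : pos v ∈ segment ℝ (pos x) (pos y) := by
      have := seg_lin (A := pos u) (B := pos v) (show tx ≤ 1 by linarith) h.le
      rw [← hx, ← hy, lin_one] at this
      exact this
    rcases D.WE h2 (T.adj_mem (T.adj_symm h1)) hm with e | e
    · exact absurd (k1.trans e.symm) (T.adj_ne h1)
    · exact e

lemma Draw.cross (D : Draw pos a b c P F) {u v x y : X} (h1 : Adj F u v) (h2 : Adj F x y)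
    (hne : s(u, v) ≠ s(x, y)) {p : ℝ × ℝ} (hp : p ∈ segment ℝ (pos u) (pos v))
    (hp' : p ∈ segment ℝ (pos x) (pos y)) (pu : p ≠ pos u) (pv : p ≠ pos v) (px : p ≠ pos x)
    (py : p ≠ pos y) : False := by
  have T := D.tri
  have huv : pos u ≠ pos v := fun h =>
    T.adj_ne h1 (D.inj (T.adj_mem h1) (T.adj_mem (T.adj_symm h1)) h)
  -- the transversal case
  have H : ∀ u v w x y, Inn F a b c u v w → Adj F x y → p ∈ segment ℝ (pos u) (pos v) →
      p ∈ segment ℝ (pos x) (pos y) → p ≠ pos u → p ≠ pos v → 0 < det3 (pos u) (pos v) (pos x) →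
      False := by
    intro u v w x y hI hxy hp hp' pu pv hx
    have hd := D.inn_pos hI
    have hz := det_seg hp
    obtain ⟨s, s0, s1, rfl⟩ := seg_iff.1 hp
    have s0' : 0 < s := lt_of_le_of_ne s0 (by rintro rfl; exact pu (lin_zero _ _))
    have s1' : s < 1 := lt_of_le_of_ne s1 (by rintro rfl; exact pv (lin_one _ _))
    set p := lin (pos u) (pos v) s with hpdef
    have g2 : 0 < det3 (pos v) (pos w) p := by
      rw [hpdef, det3_lin, det3_self, det3_rot]; nlinarith
    have g3 : 0 < det3 (pos w) (pos u) p := by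
      rw [hpdef, det3_lin, det3_self', det3_rot2]; nlinarith
    have ca : ∀ Z : ℝ × ℝ, ContinuousAt (fun _ : ℝ => Z) 0 := fun _ => continuousAt_const
    have cl : ContinuousAt (lin p (pos x)) 0 := (lin_cont _ _).continuousAt
    have e2 := (det3_cont (ca (pos v)) (ca (pos w)) cl).eventually_const_lt (u := 0)
      (by beta_reduce; rw [lin_zero]; exact g2)
    have e3 := (det3_cont (ca (pos w)) (ca (pos u)) cl).eventually_const_lt (u := 0)
      (by beta_reduce; rw [lin_zero]; exact g3)
    obtain ⟨r, r0, r1, f2, f3⟩ := pick (e2.and e3)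
    refine D.X0 hI hxy (p := lin p (pos x) r) ?_ ⟨?_, f2, f3⟩
    · refine (convex_segment (𝕜 := ℝ) (pos x) (pos y)).segment_subset hp'
        (left_mem_segment _ _ _) (seg_iff.2 ⟨r, r0.le, r1.le, rfl⟩)
    · rw [det3_lin, hz]; nlinarith
  have H2 : ∀ u v, Adj F u v → p ∈ segment ℝ (pos u) (pos v) → p ≠ pos u → p ≠ pos v →
      0 < det3 (pos u) (pos v) (pos x) → False := by
    intro u v he hp pu pv hx
    have hz := det_seg hp
    obtain ⟨r, r0, r1, hr⟩ := seg_iff.1 hp'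
    have r0' : 0 < r := lt_of_le_of_ne r0 (by rintro rfl; exact px (hr.trans (lin_zero _ _)))
    have r1' : r < 1 := lt_of_le_of_ne r1 (by rintro rfl; exact py (hr.trans (lin_one _ _)))
    rw [hr, det3_lin] at hz
    have hy : det3 (pos u) (pos v) (pos y) < 0 := by
      by_contra hc; push Not at hc
      nlinarith [mul_pos (sub_pos.2 r1') hx, mul_nonneg r0 hc]
    rcases D.edge_inn he with ⟨w, hw⟩ | ⟨w, hw⟩
    · exact H _ _ _ _ _ hw h2 hp hp' pu pv hx
    · refine H _ _ _ _ _ hw (T.adj_symm h2) (by rw [segment_symm]; exact hp)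
        (by rw [segment_symm]; exact hp') pv pu ?_
      rw [det3_swap]; linarith
  by_cases hx : det3 (pos u) (pos v) (pos x) = 0
  · obtain ⟨s, s0, s1, hs⟩ := seg_iff.1 hp
    have s0' : 0 < s := lt_of_le_of_ne s0 (by rintro rfl; exact pu (hs.trans (lin_zero _ _)))
    have s1' : s < 1 := lt_of_le_of_ne s1 (by rintro rfl; exact pv (hs.trans (lin_one _ _)))
    obtain ⟨r, r0, r1, hr⟩ := seg_iff.1 hp'
    have r0' : 0 < r := lt_of_le_of_ne r0 (by rintro rfl; exact px (hr.trans (lin_zero _ _)))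
    have hy : det3 (pos u) (pos v) (pos y) = 0 := by
      have hz := det_seg hp
      rw [hr, det3_lin, hx] at hz
      simp only [mul_zero, zero_add] at hz
      exact (mul_eq_zero.1 hz).resolve_left r0'.ne'
    have r1' : r < 1 := lt_of_le_of_ne r1 (by rintro rfl; exact py (hr.trans (lin_one _ _)))
    obtain ⟨tx, hx⟩ := line_of_det huv hx
    obtain ⟨ty, hy⟩ := line_of_det huv hy
    have es : s = tx + r * (ty - tx) := by
      apply lin_inj huv
      rw [← hs, hr, hx, hy]
      ext <;> simp only [lin] <;> ring
    have hxy : tx ≠ ty := by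
      rintro rfl
      exact T.adj_ne h2 (D.inj (T.adj_mem h2) (T.adj_mem (T.adj_symm h2)) (hx.trans hy.symm))
    rcases lt_or_gt_of_ne hxy with h | h
    · obtain ⟨e1, e2⟩ := D.overlap h1 h2 hx hy s0' s1' (by nlinarith) (by nlinarith)
      exact hne (by rw [e1, e2])
    · obtain ⟨e1, e2⟩ := D.overlap h1 (T.adj_symm h2) hy hx s0' s1' (by nlinarith) (by nlinarith)
      exact hne (by rw [e1, e2, Sym2.eq_swap])
  · rcases lt_or_gt_of_ne hx with h | h
    · refine H2 v u (T.adj_symm h1) (by rw [segment_symm]; exact hp) pv pu ?_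
      rw [det3_swap]; linarith
    · exact H2 u v h1 hp pu pv h

theorem Draw.XX (D : Draw pos a b c P F) {u v x y : X} (h1 : Adj F u v) (h2 : Adj F x y)
    (hne : s(u, v) ≠ s(x, y)) {p : ℝ × ℝ} (hp : p ∈ segment ℝ (pos u) (pos v))
    (hp' : p ∈ segment ℝ (pos x) (pos y)) : (p = pos u ∨ p = pos v) ∧ (p = pos x ∨ p = pos y) := by
  have T := D.tri
  have A : ∀ u v x y, Adj F u v → Adj F x y → p ∈ segment ℝ (pos x) (pos y) →
      (p = pos u ∨ p = pos v) → (p = pos x ∨ p = pos y) := by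
    intro u v x y h1 h2 hp' h
    rcases h with rfl | rfl
    · rcases D.WE h2 (T.adj_mem h1) hp' with e | e
      · exact Or.inl (by rw [e])
      · exact Or.inr (by rw [e])
    · rcases D.WE h2 (T.adj_mem (T.adj_symm h1)) hp' with e | e
      · exact Or.inl (by rw [e])
      · exact Or.inr (by rw [e])
  by_cases q1 : p = pos u ∨ p = pos v
  · exact ⟨q1, A u v x y h1 h2 hp' q1⟩
  by_cases q2 : p = pos x ∨ p = pos y
  · exact ⟨A x y u v h2 h1 hp q2, q2⟩
  push Not at q1 q2
  exact (D.cross h1 h2 hne hp hp' q1.1 q1.2 q2.1 q2.2).elim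

end draw2
end OPM


namespace OPM
open Filter Topology
section drawthm
variable {X : Type*} [DecidableEq X]
variable {pos : X → ℝ × ℝ} {a b c : X} {P : Finset X} {F : Finset (X × X × X)}

lemma Draw.not_ray (D : Draw pos a b c P F) {q n n' : X} (h : Adj F q n) (h' : Adj F q n')
    (hne : n ≠ n') {t : ℝ} (ht : 0 < t) (e : pos n' = lin (pos q) (pos n) t) : False := by
  have T := D.tri
  rcases le_or_gt t 1 with h1 | h1
  · rcases D.WE h (T.adj_mem (T.adj_symm h')) (by rw [e]; exact seg_iff.2 ⟨t, ht.le, h1, rfl⟩)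
      with g | g
    · exact T.adj_ne h' g.symm
    · exact hne g.symm
  · have : pos n ∈ segment ℝ (pos q) (pos n') := by
      refine seg_iff.2 ⟨1 / t, by positivity, by rw [div_le_one ht]; exact h1.le, ?_⟩
      rw [e]
      ext <;> simp only [lin] <;> field_simp <;> ring
    rcases D.WE h' (T.adj_mem (T.adj_symm h)) this with g | g
    · exact T.adj_ne h g.symm
    · exact hne g

lemma exists_dir {U A B : ℝ × ℝ} (hA : A ≠ U) (hB : B ≠ U)
    (hn : ∀ t : ℝ, 0 < t → B ≠ lin U A t) : ∃ g, det3 U A g < 0 ∧ 0 < det3 U B g := by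
  by_cases hc : det3 U A B = 0
  · obtain ⟨t, ht⟩ := line_of_det hA.symm hc
    have t0 : t ≠ 0 := by rintro rfl; exact hB (ht.trans (lin_zero _ _))
    have t1 : t < 0 := by
      by_contra h
      push Not at h
      exact hn t (lt_of_le_of_ne h t0.symm) ht
    obtain ⟨g, hg⟩ := push_out (A := U) (B := A) (p := A) hA.symm
    rw [det3_self'] at hg
    refine ⟨g, hg, ?_⟩
    have : det3 U B g = t * det3 U A g := by rw [ht]; simp only [det3, lin]; ring
    rw [this]
    exact mul_pos_of_neg_of_neg t1 hg
  · have hc2 : 0 < det3 U A B ^ 2 := by positivity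
    refine ⟨(U.1 - det3 U A B * ((A.1 - U.1) + (B.1 - U.1)),
      U.2 - det3 U A B * ((A.2 - U.2) + (B.2 - U.2))), ?_, ?_⟩
    · have : det3 U A (U.1 - det3 U A B * ((A.1 - U.1) + (B.1 - U.1)),
        U.2 - det3 U A B * ((A.2 - U.2) + (B.2 - U.2))) = - det3 U A B ^ 2 := by
        simp only [det3]; ring
      rw [this]; linarith
    · have : det3 U B (U.1 - det3 U A B * ((A.1 - U.1) + (B.1 - U.1)),
        U.2 - det3 U A B * ((A.2 - U.2) + (B.2 - U.2))) = det3 U A B ^ 2 := by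
        simp only [det3]; ring
      rw [this]; exact hc2

lemma draw_base (T : Tri P F) (hf : (a, b, c) ∈ F) (h : ∀ v ∈ P, v = a ∨ v = b ∨ v = c) :
    ∃ pos : X → ℝ × ℝ, Draw pos a b c P F := by
  have n1 := T.ne hf
  have n2 := T.ne2 hf
  have n3 := T.ne3 hf
  refine ⟨fun x => if x = a then (0, 0) else if x = b then (0, 1) else (1, 0), T, hf, ?_, ?_⟩
  · simp [det3, n1.symm, n3, n2.symm]
  · intro i j k hi hr
    have m1 := h i (T.mem hi)
    have m2 := h j (T.mem (T.cyc hi))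
    have m3 := h k (T.mem (T.cyc2 hi))
    have k1 := T.ne hi
    have k2 := T.ne2 hi
    have k3 := T.ne3 hi
    unfold IsRot at hr
    rcases m1 with rfl | rfl | rfl <;> rcases m2 with rfl | rfl | rfl <;>
      rcases m3 with rfl | rfl | rfl <;>
      first
      | (exact absurd rfl k1)
      | (exact absurd rfl k2)
      | (exact absurd rfl k3)
      | (exfalso; apply hr; simp; done)
      | (simp [det3, n1.symm, n3, n2.symm])

lemma draw_step (T : Tri P F) {u v p q : X} (hp : (u, v, p) ∈ F) (hq : (v, u, q) ∈ F)
    (hpq : p ≠ q) (hc : ∀ z, Adj F u z → Adj F v z → z = p ∨ z = q)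
    (hf : (a, b, c) ∈ F) (va : v ≠ a) (vb : v ≠ b) (vc : v ≠ c)
    (D : Draw pos a b c (P.erase v) (contractF F u v)) :
    ∃ pos : X → ℝ × ℝ, Draw pos a b c P F := by
  have T' := D.tri
  have huv : u ≠ v := T.ne hp
  have pv : p ≠ v := (T.ne2 hp).symm
  have pu : p ≠ u := T.ne3 hp
  have qu : q ≠ u := (T.ne2 hq).symm
  have qv : q ≠ v := T.ne3 hq
  have fu : phi u v u = u := phi_ne huv
  have adj' : ∀ {x}, x ≠ u → x ≠ v → Adj F u x → Adj (contractF F u v) u x := by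
    intro x h1 h2 h3
    exact (adj_contract T hp hq hpq).2 ⟨h1.symm, u, x, h3, fu, phi_ne h2⟩
  have ap := adj' pu pv (T.next_adj hp)
  have aq := adj' qu qv ⟨_, T.cyc hq⟩
  have hm : ∀ {x}, Adj (contractF F u v) u x → pos x ≠ pos u := fun h e =>
    T'.adj_ne h (D.inj (T'.adj_mem h) (T'.adj_mem (T'.adj_symm h)) e.symm)
  obtain ⟨g, hg1, hg2⟩ := exists_dir (hm ap) (hm aq) (fun t ht e => D.not_ray ap aq hpq ht e)
  have e : ∀ᶠ s in 𝓝 (0:ℝ), ∀ t ∈ F, t.1 = v → t.2.1 ≠ u → t.2.2 ≠ u →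
      0 < det3 (lin (pos u) g s) (pos t.2.1) (pos t.2.2) := by
    rw [Filter.eventually_all_finset]
    rintro ⟨i, j, k⟩ ht
    by_cases hr : i = v ∧ j ≠ u ∧ k ≠ u
    · obtain ⟨rfl, hj, hk⟩ := hr
      have hjv := T.ne ht
      have hkv := T.ne3 ht
      have hjk := T.ne2 ht
      have hin : (u, j, k) ∈ contractF F u i :=
        mem_contractF.2 ⟨⟨hj.symm, hjk, hk⟩, i, j, k, ht, phi_y _ _, phi_ne hjv.symm, phi_ne hkv⟩
      have hrot : ¬ IsRot a b c u j k := by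
        rintro (⟨rfl, rfl, rfl⟩ | ⟨rfl, rfl, rfl⟩ | ⟨rfl, rfl, rfl⟩)
        · exact huv (T.uniq (T.cyc hf) (T.cyc ht))
        · exact huv (T.uniq (T.cyc2 hf) (T.cyc ht))
        · exact huv (T.uniq hf (T.cyc ht))
      have := D.posi hin hrot
      filter_upwards [(det3_cont (lin_cont (pos u) g).continuousAt (continuousAt_const (y := pos j))
        (continuousAt_const (y := pos k))).eventually_const_lt (u := 0)
          (by beta_reduce; rw [lin_zero]; exact this)] with s hs _ _ _
      exact hs
    · exact Eventually.of_forall fun s h1 h2 h3 => absurd ⟨h1, h2, h3⟩ hr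
  obtain ⟨s, s0, s1, hs⟩ := pick e
  have hv : ∀ j k, (v, j, k) ∈ F → 0 < det3 (lin (pos u) g s) (pos j) (pos k) := by
    intro j k hjk
    by_cases hj : j = u
    · subst hj
      have : k = q := T.uniq hjk hq
      subst this
      rw [← det3_rot, det3_lin, det3_self]
      nlinarith
    by_cases hk : k = u
    · subst hk
      have : j = p := T.uniq (T.cyc2 hjk) hp
      subst this
      rw [← det3_rot, det3_lin, det3_self', det3_swap]
      nlinarith
    exact hs (v, j, k) hjk rfl hj hk
  refine ⟨Function.update pos v (lin (pos u) g s), T, hf, ?_, ?_⟩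
  · rw [Function.update_of_ne va.symm, Function.update_of_ne vb.symm, Function.update_of_ne vc.symm]
    exact D.neg
  · intro i j k h hr
    have k1 := T.ne h
    have k2 := T.ne2 h
    have k3 := T.ne3 h
    by_cases hi : i = v
    · subst hi
      rw [Function.update_self, Function.update_of_ne k1.symm, Function.update_of_ne k3]
      exact hv _ _ h
    by_cases hj : j = v
    · subst hj
      rw [Function.update_self, Function.update_of_ne k1, Function.update_of_ne k2.symm,
        ← det3_rot]
      exact hv _ _ (T.cyc h)
    by_cases hk : k = v
    · subst hk
      rw [Function.update_self, Function.update_of_ne k2, Function.update_of_ne k3.symm,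
        ← det3_rot2]
      exact hv _ _ (T.cyc2 h)
    rw [Function.update_of_ne hi, Function.update_of_ne hj, Function.update_of_ne hk]
    exact D.posi (mem_contractF.2 ⟨⟨k1, k2, k3⟩, i, j, k, h, phi_ne hi, phi_ne hj, phi_ne hk⟩) hr

theorem draw_exists : ∀ (n : ℕ) (P : Finset X) (F : Finset (X × X × X)), P.card = n → Tri P F →
    (a, b, c) ∈ F → ∃ pos : X → ℝ × ℝ, Draw pos a b c P F := by
  intro n
  induction n with
  | zero =>
    intro P F hn T hf
    exact absurd (T.mem hf) (by rw [Finset.card_eq_zero.1 hn]; simp)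
  | succ n ih =>
    intro P F hn T hf
    by_cases h : ∀ v ∈ P, v = a ∨ v = b ∨ v = c
    · exact draw_base T hf h
    push Not at h
    obtain ⟨v, hv, va, vb, vc⟩ := h
    have h4 : 4 ≤ P.card := by
      have : ({v, a, b, c} : Finset X) ⊆ P := by
        intro x hx
        simp only [Finset.mem_insert, Finset.mem_singleton] at hx
        rcases hx with rfl | rfl | rfl | rfl
        · exact hv
        · exact T.mem hf
        · exact T.mem (T.cyc hf)
        · exact T.mem (T.cyc2 hf)
      refine le_trans ?_ (Finset.card_le_card this)
      rw [Finset.card_insert_of_notMem (by simp [va, vb, vc]),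
        Finset.card_insert_of_notMem (by simp [T.ne hf, (T.ne3 hf).symm]),
        Finset.card_insert_of_notMem (by simp [T.ne2 hf]), Finset.card_singleton]
    obtain ⟨u, p, q, hp, hq, hc⟩ := T.contractible hv
    have hpq := T.opp_ne h4 hp hq
    have T' := T.contract hp hq hpq hc
    obtain ⟨pos, D⟩ := ih (P.erase v) (contractF F u v)
      (by rw [Finset.card_erase_of_mem hv, hn]; rfl) T'
      (mem_contractF.2 ⟨⟨T.ne hf, T.ne2 hf, T.ne3 hf⟩, a, b, c, hf, phi_ne va.symm,
        phi_ne vb.symm, phi_ne vc.symm⟩)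
    exact draw_step T hp hq hpq hc hf va vb vc D

end drawthm
end OPM


namespace OPM
open Filter Topology Relation
section refine1

/-- the triangulation `K4` -/
lemma k4_tri {X : Type*} [DecidableEq X] {a b c o : X} (h1 : a ≠ b) (h2 : b ≠ c) (h3 : c ≠ a)
    (h4 : o ≠ a) (h5 : o ≠ b) (h6 : o ≠ c) :
    Tri ({a, b, c, o} : Finset X)
      {(a, b, c), (b, c, a), (c, a, b), (b, a, o), (a, o, b), (o, b, a), (c, b, o), (b, o, c),
        (o, c, b), (a, c, o), (c, o, a), (o, a, c)} where
  mem := by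
    intro u v w h
    simp only [Finset.mem_insert, Finset.mem_singleton, Prod.mk.injEq] at h ⊢
    grind
  ne := by
    intro u v w h
    simp only [Finset.mem_insert, Finset.mem_singleton, Prod.mk.injEq] at h
    rcases h with ⟨e1, e2, e3⟩ | ⟨e1, e2, e3⟩ | ⟨e1, e2, e3⟩ | ⟨e1, e2, e3⟩ |
      ⟨e1, e2, e3⟩ | ⟨e1, e2, e3⟩ | ⟨e1, e2, e3⟩ | ⟨e1, e2, e3⟩ | ⟨e1, e2, e3⟩ |
      ⟨e1, e2, e3⟩ | ⟨e1, e2, e3⟩ | ⟨e1, e2, e3⟩ <;> grind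
  cyc := by
    intro u v w h
    simp only [Finset.mem_insert, Finset.mem_singleton, Prod.mk.injEq] at h ⊢
    grind
  uniq := by
    intro u v w w' h h'
    simp only [Finset.mem_insert, Finset.mem_singleton, Prod.mk.injEq] at h h'
    rcases h with ⟨rfl, rfl, rfl⟩ | ⟨rfl, rfl, rfl⟩ | ⟨rfl, rfl, rfl⟩ | ⟨rfl, rfl, rfl⟩ |
      ⟨rfl, rfl, rfl⟩ | ⟨rfl, rfl, rfl⟩ | ⟨rfl, rfl, rfl⟩ | ⟨rfl, rfl, rfl⟩ | ⟨rfl, rfl, rfl⟩ |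
      ⟨rfl, rfl, rfl⟩ | ⟨rfl, rfl, rfl⟩ | ⟨rfl, rfl, rfl⟩ <;> grind
  rev := by
    intro u v w h
    simp only [Finset.mem_insert, Finset.mem_singleton, Prod.mk.injEq] at h ⊢
    rcases h with ⟨e1, e2, e3⟩ | ⟨e1, e2, e3⟩ | ⟨e1, e2, e3⟩ | ⟨e1, e2, e3⟩ |
      ⟨e1, e2, e3⟩ | ⟨e1, e2, e3⟩ | ⟨e1, e2, e3⟩ | ⟨e1, e2, e3⟩ | ⟨e1, e2, e3⟩ |
      ⟨e1, e2, e3⟩ | ⟨e1, e2, e3⟩ | ⟨e1, e2, e3⟩ <;> 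
      first
      | (refine ⟨o, ?_⟩; simp [e1, e2]; done)
      | (refine ⟨a, ?_⟩; simp [e1, e2]; done)
      | (refine ⟨b, ?_⟩; simp [e1, e2]; done)
      | (refine ⟨c, ?_⟩; simp [e1, e2]; done)
  link := by
    intro v S hS n n1 m m1 hn hm hnS
    have hn1 := hS _ _ hn hnS
    have hS' := fun n2 h => hS n1 n2 h hn1
    simp only [Finset.mem_insert, Finset.mem_singleton, Prod.mk.injEq] at hn hm hS'
    rcases hn with ⟨rfl, rfl, rfl⟩ | ⟨rfl, rfl, rfl⟩ | ⟨rfl, rfl, rfl⟩ | ⟨rfl, rfl, rfl⟩ |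
      ⟨rfl, rfl, rfl⟩ | ⟨rfl, rfl, rfl⟩ | ⟨rfl, rfl, rfl⟩ | ⟨rfl, rfl, rfl⟩ | ⟨rfl, rfl, rfl⟩ |
      ⟨rfl, rfl, rfl⟩ | ⟨rfl, rfl, rfl⟩ | ⟨rfl, rfl, rfl⟩ <;> simp at hS' <;> grind
  conn := by
    intro S hS u v hu hv huS
    simp only [Finset.mem_insert, Finset.mem_singleton, Prod.mk.injEq] at hS hu hv
    by_cases huv : u = v
    · rw [← huv]; exact huS
    have : ∃ w, (u = a ∧ v = b ∧ w = c ∨ u = b ∧ v = c ∧ w = a ∨ u = c ∧ v = a ∧ w = b ∨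
      u = b ∧ v = a ∧ w = o ∨ u = a ∧ v = o ∧ w = b ∨ u = o ∧ v = b ∧ w = a ∨
      u = c ∧ v = b ∧ w = o ∨ u = b ∧ v = o ∧ w = c ∨ u = o ∧ v = c ∧ w = b ∨
      u = a ∧ v = c ∧ w = o ∨ u = c ∧ v = o ∧ w = a ∨ u = o ∧ v = a ∧ w = c) := by
      rcases hu with e1 | e1 | e1 | e1 <;> rcases hv with e2 | e2 | e2 | e2 <;>
        first
        | (exact absurd (e1.trans e2.symm) huv)
        | (refine ⟨o, ?_⟩; simp [e1, e2]; done)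
        | (refine ⟨a, ?_⟩; simp [e1, e2]; done)
        | (refine ⟨b, ?_⟩; simp [e1, e2]; done)
        | (refine ⟨c, ?_⟩; simp [e1, e2]; done)
    obtain ⟨w, hw⟩ := this
    exact hS u v w hw huS
  euler := by
    have e1 : ({a, b, c, o} : Finset X).card = 4 := by
      rw [Finset.card_insert_of_notMem (by simp [h1, h3.symm, h4.symm]),
        Finset.card_insert_of_notMem (by simp [h2, h5.symm]),
        Finset.card_insert_of_notMem (by simp [h6.symm]), Finset.card_singleton]
    rw [e1]
    have : ∀ x1 x2 x3 x4 x5 x6 x7 x8 x9 x10 x11 x12 : X × X × X,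
      ({x1, x2, x3, x4, x5, x6, x7, x8, x9, x10, x11, x12} : Finset (X × X × X)).card ≤ 12 := by
      intro x1 x2 x3 x4 x5 x6 x7 x8 x9 x10 x11 x12
      have := List.toFinset_card_le [x1, x2, x3, x4, x5, x6, x7, x8, x9, x10, x11, x12]
      simpa using this
    have := this (a, b, c) (b, c, a) (c, a, b) (b, a, o) (a, o, b) (o, b, a) (c, b, o) (b, o, c)
        (o, c, b) (a, c, o) (c, o, a) (o, a, c)
    omega

end refine1
end OPM


namespace OPM
open Filter Topology Relation
section refine2

/-- a corner -/
def Cor {X : Type*} (a b c x : X) : Prop := x = a ∨ x = b ∨ x = c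

/-- `z1` and `z2` are joined by a chain of edges inside their segment -/
def Joined (F : Finset ((ℝ × ℝ) × (ℝ × ℝ) × (ℝ × ℝ))) (z1 z2 : ℝ × ℝ) : Prop :=
  ReflTransGen (fun p q => Adj F p q ∧ p ∈ segment ℝ z1 z2 ∧ q ∈ segment ℝ z1 z2) z1 z2

/-- refinement -/
def Ref (P : Finset (ℝ × ℝ)) (F : Finset ((ℝ × ℝ) × (ℝ × ℝ) × (ℝ × ℝ)))
    (P' : Finset (ℝ × ℝ)) (F' : Finset ((ℝ × ℝ) × (ℝ × ℝ) × (ℝ × ℝ))) : Prop :=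
  P ⊆ P' ∧ ∀ p q, Adj F p q → Joined F' p q

variable {P P' P'' : Finset (ℝ × ℝ)} {F F' F'' : Finset ((ℝ × ℝ) × (ℝ × ℝ) × (ℝ × ℝ))}
variable {a b c : ℝ × ℝ}

lemma Joined.mono (h : Ref P F P' F') {z1 z2 : ℝ × ℝ} (hj : Joined F z1 z2) :
    Joined F' z1 z2 := by
  have H : ∀ z, ReflTransGen (fun p q => Adj F p q ∧ p ∈ segment ℝ z1 z2 ∧ q ∈ segment ℝ z1 z2)
      z1 z → ReflTransGen (fun p q => Adj F' p q ∧ p ∈ segment ℝ z1 z2 ∧ q ∈ segment ℝ z1 z2)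
      z1 z := by
    intro z hz
    induction hz with
    | refl => exact ReflTransGen.refl
    | tail _ h1 ih =>
      refine ih.trans (ReflTransGen.mono ?_ _ _ (h.2 _ _ h1.1))
      intro p q hpq
      have hs := (convex_segment (𝕜 := ℝ) z1 z2).segment_subset h1.2.1 h1.2.2
      exact ⟨hpq.1, hs hpq.2.1, hs hpq.2.2⟩
  exact H _ hj

lemma Ref.refl : Ref P F P F := ⟨fun _ h => h, fun p q h =>
  ReflTransGen.single ⟨h, left_mem_segment _ _ _, right_mem_segment _ _ _⟩⟩

lemma Ref.trans (h : Ref P F P' F') (h' : Ref P' F' P'' F'') : Ref P F P'' F'' :=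
  ⟨h.1.trans h'.1, fun p q hpq => (h.2 p q hpq).mono h'⟩

lemma inn_of {u v w : ℝ × ℝ} (h : (u, v, w) ∈ F) (hc : ¬ (Cor a b c u ∧ Cor a b c v)) :
    Inn F a b c u v w := by
  refine ⟨h, ?_⟩
  rintro (⟨rfl, rfl, rfl⟩ | ⟨rfl, rfl, rfl⟩ | ⟨rfl, rfl, rfl⟩)
  · exact hc ⟨Or.inl rfl, Or.inr (Or.inl rfl)⟩
  · exact hc ⟨Or.inr (Or.inl rfl), Or.inr (Or.inr rfl)⟩
  · exact hc ⟨Or.inr (Or.inr rfl), Or.inl rfl⟩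

lemma Draw.cor_edge (D : Draw id a b c P F) {i j k : ℝ × ℝ} (h : Inn F a b c i j k)
    (hi : Cor a b c i) (hj : Cor a b c j) : (i = a ∧ j = c) ∨ (i = c ∧ j = b) ∨ (i = b ∧ j = a) := by
  have T := D.tri
  have hf := D.face
  have hij := T.ne h.1
  rcases hi with rfl | rfl | rfl <;> rcases hj with rfl | rfl | rfl
  · exact absurd rfl hij
  · exact absurd (Or.inl ⟨rfl, rfl, T.uniq h.1 hf⟩) h.2
  · exact Or.inl ⟨rfl, rfl⟩
  · exact Or.inr (Or.inr ⟨rfl, rfl⟩)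
  · exact absurd rfl hij
  · exact absurd (Or.inr (Or.inl ⟨rfl, rfl, T.uniq h.1 (T.cyc hf)⟩)) h.2
  · exact absurd (Or.inr (Or.inr ⟨rfl, rfl, T.uniq h.1 (T.cyc2 hf)⟩)) h.2
  · exact Or.inr (Or.inl ⟨rfl, rfl⟩)
  · exact absurd rfl hij

lemma Draw.splitD (D : Draw id a b c P F) {u v w w' : ℝ × ℝ} (h : (u, v, w) ∈ F)
    (h' : (v, u, w') ∈ F) (hc : ¬ (Cor a b c u ∧ Cor a b c v)) {s : ℝ} (s0 : 0 < s) (s1 : s < 1) :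
    lin u v s ∉ P ∧ w ≠ w' ∧ Draw id a b c (insert (lin u v s) P) (splitF F u v w w' (lin u v s)) ∧
      Ref P F (insert (lin u v s) P) (splitF F u v w w' (lin u v s)) := by
  have T := D.tri
  have hI := inn_of h hc
  have hI' := inn_of h' (fun h => hc ⟨h.2, h.1⟩)
  have d1 : 0 < det3 u v w := D.inn_pos hI
  have d2 : 0 < det3 v u w' := D.inn_pos hI'
  have hww : w ≠ w' := by
    rintro rfl
    rw [det3_swap] at d2
    linarith
  have huv : u ≠ v := T.ne h
  have hm : lin u v s ∉ P := by
    intro hm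
    rcases D.WE ⟨w, h⟩ hm (seg_iff.2 ⟨s, s0.le, s1.le, rfl⟩) with e | e
    · have := lin_inj huv (e.trans (lin_zero u v).symm)
      linarith
    · have := lin_inj huv (e.trans (lin_one u v).symm)
      linarith
  have k1 : 0 < det3 w u (lin u v s) := by rw [det3_lin, det3_self', det3_rot2]; nlinarith
  have k2 : 0 < det3 v w (lin u v s) := by rw [det3_lin, det3_self, det3_rot]; nlinarith
  have k3 : 0 < det3 w' v (lin u v s) := by rw [det3_lin, det3_self', det3_rot2]; nlinarith
  have k4 : 0 < det3 u w' (lin u v s) := by rw [det3_lin, det3_self, det3_rot]; nlinarith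
  have Q : ∀ x y, Q4 u v w w' x y → 0 < det3 x y (lin u v s) := by
    rintro x y (⟨rfl, rfl⟩ | ⟨rfl, rfl⟩ | ⟨rfl, rfl⟩ | ⟨rfl, rfl⟩)
    · exact k1
    · exact k2
    · exact k3
    · exact k4
  have NEc : ∀ x y, Cor a b c x → Cor a b c y → NE u v x y := by
    intro x y hx hy
    refine ⟨?_, ?_⟩
    · rintro ⟨rfl, rfl⟩; exact hc ⟨hx, hy⟩
    · rintro ⟨rfl, rfl⟩; exact hc ⟨hy, hx⟩
  have ca : Cor a b c a := Or.inl rfl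
  have cb : Cor a b c b := Or.inr (Or.inl rfl)
  have cc : Cor a b c c := Or.inr (Or.inr rfl)
  refine ⟨hm, hww, ⟨T.split h h' hww hm, ?_, D.neg, ?_⟩, Finset.subset_insert _ _, ?_⟩
  · exact mem_splitF.2 (Or.inl ⟨D.face, NEc _ _ ca cb, NEc _ _ cb cc, NEc _ _ cc ca⟩)
  · intro i j k hf hr
    rcases mem_splitF.1 hf with g | ⟨rfl, g⟩ | ⟨rfl, g⟩ | ⟨rfl, g⟩
    · exact D.posi g.1 hr
    · have := Q _ _ g
      rw [det3_rot] at this; exact this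
    · exact Q _ _ g
    · have := Q _ _ g
      rw [det3_rot2] at this; exact this
  · intro p q hpq
    have A := fun {x y} => adj_split (a := x) (b := y) T h h' hww hm
    have hms : lin u v s ∈ segment ℝ u v := seg_iff.2 ⟨s, s0.le, s1.le, rfl⟩
    by_cases e1 : p = u ∧ q = v
    · obtain ⟨rfl, rfl⟩ := e1
      exact (ReflTransGen.single ⟨A.2 (Or.inr (Or.inr ⟨rfl, Or.inl rfl⟩)),
        left_mem_segment _ _ _, hms⟩).tail ⟨A.2 (Or.inr (Or.inl ⟨rfl, Or.inr (Or.inl rfl)⟩)),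
        hms, right_mem_segment _ _ _⟩
    by_cases e2 : p = v ∧ q = u
    · obtain ⟨rfl, rfl⟩ := e2
      rw [segment_symm] at hms
      exact (ReflTransGen.single ⟨A.2 (Or.inr (Or.inr ⟨rfl, Or.inr (Or.inl rfl)⟩)),
        left_mem_segment _ _ _, hms⟩).tail ⟨A.2 (Or.inr (Or.inl ⟨rfl, (Or.inl rfl)⟩)),
        hms, right_mem_segment _ _ _⟩
    exact ReflTransGen.single ⟨A.2 (Or.inl ⟨hpq, e1, e2⟩), left_mem_segment _ _ _,
      right_mem_segment _ _ _⟩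

lemma bary {A B C z : ℝ × ℝ} (h : InO A B C z) :
    z = lin (lin A B (det3 C A z / (det3 B C z + det3 C A z))) C
      (det3 A B z / (det3 A B z + det3 B C z + det3 C A z)) := by
  obtain ⟨h1, h2, h3⟩ := h
  have hx : (det3 A B z + det3 B C z + det3 C A z) * z.1 =
      det3 B C z * A.1 + det3 C A z * B.1 + det3 A B z * C.1 := by unfold det3; ring
  have hy : (det3 A B z + det3 B C z + det3 C A z) * z.2 =
      det3 B C z * A.2 + det3 C A z * B.2 + det3 A B z * C.2 := by unfold det3; ring
  generalize det3 A B z = γ at *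
  generalize det3 B C z = α at *
  generalize det3 C A z = β at *
  have p1 : 0 < α + β := by linarith
  have p2 : 0 < γ + α + β := by linarith
  ext
  · simp only [lin]
    field_simp
    linear_combination (α + β) * hx
  · simp only [lin]
    field_simp
    linear_combination (α + β) * hy

/-- insert a point on an edge -/
lemma Draw.insert_edge (D : Draw id a b c P F) {z i j k : ℝ × ℝ} (hz : InO a c b z) (hzP : z ∉ P)
    (hI : Inn F a b c i j k) (hC : InC i j k z) (h0 : det3 i j z = 0) :
    ∃ P' F', Draw id a b c P' F' ∧ Ref P F P' F' ∧ z ∈ P' := by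
  have T := D.tri
  have hd : 0 < det3 i j k := D.inn_pos hI
  obtain ⟨s, rfl⟩ := line_of_det (det3_ne hd) h0
  have g2 := hC.2.1
  have g3 := hC.2.2
  rw [det3_lin, det3_self, det3_rot] at g2
  rw [det3_lin, det3_self', det3_rot2] at g3
  have s0 : 0 < s := by
    refine lt_of_le_of_ne (by by_contra hc; push Not at hc; nlinarith) ?_
    rintro rfl
    rw [lin_zero] at hzP
    exact hzP (T.mem hI.1)
  have s1 : s < 1 := by
    refine lt_of_le_of_ne (by by_contra hc; push Not at hc; nlinarith) ?_
    rintro rfl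
    rw [lin_one] at hzP
    exact hzP (T.mem (T.cyc hI.1))
  have hc : ¬ (Cor a b c i ∧ Cor a b c j) := by
    rintro ⟨hi, hj⟩
    rcases D.cor_edge hI hi hj with ⟨rfl, rfl⟩ | ⟨rfl, rfl⟩ | ⟨rfl, rfl⟩
    · linarith [hz.1]
    · linarith [hz.2.1]
    · linarith [hz.2.2]
  obtain ⟨w', hw'⟩ := T.rev hI.1
  obtain ⟨_, _, D', R⟩ := D.splitD hI.1 hw' hc s0 s1
  exact ⟨_, _, D', R, Finset.mem_insert_self _ _⟩

/-- insert a point inside a face with first vertex inner -/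
lemma Draw.insert_face (D : Draw id a b c P F) {z i j k : ℝ × ℝ}
    (hI : Inn F a b c i j k) (hC : InO i j k z) (hi : ¬ Cor a b c i) :
    ∃ P' F', Draw id a b c P' F' ∧ Ref P F P' F' ∧ z ∈ P' := by
  have T := D.tri
  obtain ⟨w', hw'⟩ := T.rev hI.1
  have hb := bary hC
  obtain ⟨h1, h2, h3⟩ := hC
  set s := det3 k i z / (det3 j k z + det3 k i z)
  set t := det3 i j z / (det3 i j z + det3 j k z + det3 k i z)
  have s0 : 0 < s := by positivity
  have s1 : s < 1 := by rw [div_lt_one (by positivity)]; linarith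
  have t0 : 0 < t := by positivity
  have t1 : t < 1 := by rw [div_lt_one (by positivity)]; linarith
  obtain ⟨hm, hww, D', R⟩ := D.splitD hI.1 hw' (fun h => hi h.1) s0 s1
  have f1 : (lin i j s, k, i) ∈ splitF F i j k w' (lin i j s) :=
    mem_splitF.2 (Or.inr (Or.inl ⟨rfl, Or.inl ⟨rfl, rfl⟩⟩))
  have f2 : (k, lin i j s, j) ∈ splitF F i j k w' (lin i j s) :=
    mem_splitF.2 (Or.inr (Or.inr (Or.inr ⟨rfl, Or.inr (Or.inl ⟨rfl, rfl⟩)⟩)))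
  have hcm : ¬ Cor a b c (lin i j s) := by
    rintro (h | h | h)
    · exact hm (by rw [h]; exact T.mem D.face)
    · exact hm (by rw [h]; exact T.mem (T.cyc D.face))
    · exact hm (by rw [h]; exact T.mem (T.cyc2 D.face))
  obtain ⟨_, _, D'', R'⟩ := D'.splitD f1 f2 (fun h => hcm h.1) t0 t1
  exact ⟨_, _, D'', R.trans R', by rw [← hb]; exact Finset.mem_insert_self _ _⟩

lemma Draw.insert_pt (D : Draw id a b c P F) {z o : ℝ × ℝ} (ho : o ∈ P) (hco : ¬ Cor a b c o)
    (hz : InO a c b z) : ∃ P' F', Draw id a b c P' F' ∧ Ref P F P' F' ∧ z ∈ P' := by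
  have T := D.tri
  by_cases hzP : z ∈ P
  · exact ⟨P, F, D, Ref.refl, hzP⟩
  obtain ⟨i, j, k, hI, hC⟩ := D.cover hz
  simp only [id] at hC
  by_cases e1 : det3 i j z = 0
  · exact D.insert_edge hz hzP hI hC e1
  by_cases e2 : det3 j k z = 0
  · exact D.insert_edge hz hzP (D.inn_cyc hI) hC.rot e2
  by_cases e3 : det3 k i z = 0
  · exact D.insert_edge hz hzP (D.inn_cyc (D.inn_cyc hI)) hC.rot.rot e3
  have hO : InO i j k z := ⟨lt_of_le_of_ne hC.1 (Ne.symm e1), lt_of_le_of_ne hC.2.1 (Ne.symm e2),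
    lt_of_le_of_ne hC.2.2 (Ne.symm e3)⟩
  by_cases c1 : Cor a b c i
  swap
  · exact D.insert_face hI hO c1
  by_cases c2 : Cor a b c j
  swap
  · exact D.insert_face (D.inn_cyc hI) hO.rot c2
  by_cases c3 : Cor a b c k
  swap
  · exact D.insert_face (D.inn_cyc (D.inn_cyc hI)) hO.rot.rot c3
  exfalso
  have hoO : InC a c b o := D.inC_outer ho
  have n1 := T.ne D.face
  have n2 := T.ne2 D.face
  have n3 := T.ne3 D.face
  have hoC : InC i j k o := by
    rcases D.cor_edge hI c1 c2 with ⟨rfl, rfl⟩ | ⟨rfl, rfl⟩ | ⟨rfl, rfl⟩ <;>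
    rcases D.cor_edge (D.inn_cyc hI) c2 c3 with ⟨g1, g2⟩ | ⟨g1, g2⟩ | ⟨g1, g2⟩
    · exact absurd g1 n3
    · rw [g2]; exact hoO
    · exact absurd g1 n2.symm
    · exact absurd g1 n1.symm
    · exact absurd g1 n2
    · rw [g2]; exact hoO.rot
    · rw [g2]; exact hoO.rot.rot
    · exact absurd g1 n3.symm
    · exact absurd g1 n1
  rcases D.W hI ho hoC with rfl | rfl | rfl
  · exact hco c1
  · exact hco c2
  · exact hco c3

end refine2
end OPM


namespace OPM
open Filter Topology Relation
section refine3

variable {P P' P'' : Finset (ℝ × ℝ)} {F F' F'' : Finset ((ℝ × ℝ) × (ℝ × ℝ) × (ℝ × ℝ))}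
variable {a b c : ℝ × ℝ}

/-- an inner edge strictly crossing the line through `z1` and `z2` -/
def Crs (F : Finset ((ℝ × ℝ) × (ℝ × ℝ) × (ℝ × ℝ))) (a b c z1 z2 : ℝ × ℝ)
    (e : (ℝ × ℝ) × (ℝ × ℝ)) : Prop :=
  Adj F e.1 e.2 ∧ ¬ (Cor a b c e.1 ∧ Cor a b c e.2) ∧ 0 < det3 z1 z2 e.1 ∧ det3 z1 z2 e.2 < 0

lemma Draw.clear_line (z1 z2 : ℝ × ℝ) : ∀ (n : ℕ) (P : Finset (ℝ × ℝ))
    (F : Finset ((ℝ × ℝ) × (ℝ × ℝ) × (ℝ × ℝ))), Draw id a b c P F →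
    (∃ S : Finset ((ℝ × ℝ) × (ℝ × ℝ)), S.card = n ∧ ∀ e, Crs F a b c z1 z2 e → e ∈ S) →
    ∃ P' F', Draw id a b c P' F' ∧ Ref P F P' F' ∧ ∀ e, ¬ Crs F' a b c z1 z2 e := by
  intro n
  induction n with
  | zero =>
    rintro P F D ⟨S, hS, h⟩
    refine ⟨P, F, D, Ref.refl, fun e he => ?_⟩
    have := h e he
    rw [Finset.card_eq_zero.1 hS] at this
    simp at this
  | succ n ih =>
    rintro P F D ⟨S, hS, h⟩
    by_cases hno : ∀ e, ¬ Crs F a b c z1 z2 e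
    · exact ⟨P, F, D, Ref.refl, hno⟩
    push Not at hno
    obtain ⟨⟨x, y⟩, hxy⟩ := hno
    have hmem := h _ hxy
    obtain ⟨⟨w, hw⟩, hc, hx, hy⟩ := hxy
    simp only at hw hc hx hy
    obtain ⟨w', hw'⟩ := D.tri.rev hw
    set s := det3 z1 z2 x / (det3 z1 z2 x - det3 z1 z2 y) with hs
    have hpos : 0 < det3 z1 z2 x - det3 z1 z2 y := by linarith
    have s0 : 0 < s := by positivity
    have s1 : s < 1 := by rw [hs, div_lt_one hpos]; linarith
    have hz : det3 z1 z2 (lin x y s) = 0 := by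
      rw [det3_lin, hs]; field_simp; ring
    obtain ⟨hm, hww, D', R⟩ := D.splitD hw hw' hc s0 s1
    obtain ⟨P', F', D'', R', hcl⟩ := ih _ _ D' ⟨S.erase (x, y), by
      rw [Finset.card_erase_of_mem hmem, hS]; rfl, by
      rintro ⟨p, q⟩ ⟨h1, h2, h3, h4⟩
      simp only at h1 h2 h3 h4
      rcases (adj_split D.tri hw hw' hww hm).1 h1 with g | g | g
      · rw [Finset.mem_erase]
        refine ⟨?_, h _ ⟨g.1, h2, h3, h4⟩⟩
        intro e
        rw [Prod.mk.injEq] at e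
        exact g.2.1 e
      · rw [g.1, hz] at h3; exact absurd h3 (lt_irrefl _)
      · rw [g.1, hz] at h4; exact absurd h4 (lt_irrefl _)⟩
    exact ⟨P', F', D'', R.trans R', hcl⟩

lemma Draw.step (D : Draw id a b c P F) {z1 z2 n : ℝ × ℝ} {s t : ℝ} (hz : z1 ≠ z2) (h2 : z2 ∈ P)
    (h : Adj F (lin z1 z2 s) n) (hn : n = lin z1 z2 t) (hst : s < t) (s1 : s < 1) : t ≤ 1 := by
  by_contra hc
  push Not at hc
  have : z2 ∈ segment ℝ (lin z1 z2 s) n := by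
    have := seg_lin (A := z1) (B := z2) s1.le hc.le
    rw [lin_one, ← hn] at this
    exact this
  rcases D.WE h h2 this with e | e
  · have := lin_inj hz ((lin_one z1 z2).trans e)
    linarith
  · have := lin_inj hz ((lin_one z1 z2).trans (e.trans hn))
    linarith

lemma Draw.progress (D : Draw id a b c P F) {z1 z2 : ℝ × ℝ} (hz : z1 ≠ z2) (h1 : z1 ∈ P)
    (h2 : z2 ∈ P) (hc1 : ¬ Cor a b c z1) (hcl : ∀ e, ¬ Crs F a b c z1 z2 e) {s : ℝ}
    (s0 : 0 ≤ s) (s1 : s < 1) (hq : lin z1 z2 s ∈ P) :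
    ∃ t, s < t ∧ t ≤ 1 ∧ Adj F (lin z1 z2 s) (lin z1 z2 t) := by
  have T := D.tri
  have o1 : InO a c b z1 := D.inO_outer h1 (fun h => hc1 (Or.inl h))
    (fun h => hc1 (Or.inr (Or.inl h))) (fun h => hc1 (Or.inr (Or.inr h)))
  have o2 : InC a c b z2 := D.inC_outer h2
  have oq : InO a c b (lin z1 z2 s) := by
    refine ⟨?_, ?_, ?_⟩ <;> rw [det3_lin]
    · nlinarith [mul_pos (sub_pos.2 s1) o1.1, mul_nonneg s0 o2.1]
    · nlinarith [mul_pos (sub_pos.2 s1) o1.2.1, mul_nonneg s0 o2.2.1]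
    · nlinarith [mul_pos (sub_pos.2 s1) o1.2.2, mul_nonneg s0 o2.2.2]
  have qa : lin z1 z2 s ≠ a := by
    intro e; have := oq.1; rw [e, det3_self] at this; exact lt_irrefl _ this
  have qb : lin z1 z2 s ≠ b := by
    intro e; have := oq.2.2; rw [e, det3_self] at this; exact lt_irrefl _ this
  have qc : lin z1 z2 s ≠ c := by
    intro e; have := oq.2.1; rw [e, det3_self] at this; exact lt_irrefl _ this
  obtain ⟨n, n', hI, g1, g2⟩ := D.cone hq qa qb qc z2
  simp only [id] at g1 g2
  have hp : 0 < det3 (lin z1 z2 s) n n' := D.inn_pos hI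
  have e1 : det3 (lin z1 z2 s) n z2 = - ((1 - s) * det3 z1 z2 n) := by
    simp only [det3, lin]; ring
  have e2 : det3 n' (lin z1 z2 s) z2 = (1 - s) * det3 z1 z2 n' := by
    simp only [det3, lin]; ring
  have hs : 0 < 1 - s := by linarith
  have f1 : det3 z1 z2 n ≤ 0 := by
    by_contra hc; push Not at hc; nlinarith
  have f2 : 0 ≤ det3 z1 z2 n' := by
    by_contra hc; push Not at hc; nlinarith
  have an : Adj F (lin z1 z2 s) n := ⟨n', hI.1⟩
  have an' : Adj F (lin z1 z2 s) n' := T.next_adj hI.1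
  by_cases z0 : det3 z1 z2 n = 0
  · obtain ⟨t, ht⟩ := line_of_det hz z0
    have : det3 (lin z1 z2 s) n n' = (t - s) * det3 z1 z2 n' := by
      rw [ht]; simp only [det3, lin]; ring
    rw [this] at hp
    have hst : s < t := by
      by_contra hc; push Not at hc; nlinarith
    exact ⟨t, hst, D.step hz h2 an ht hst s1, ht ▸ an⟩
  by_cases z0' : det3 z1 z2 n' = 0
  · obtain ⟨t, ht⟩ := line_of_det hz z0'
    have : det3 (lin z1 z2 s) n n' = - ((t - s) * det3 z1 z2 n) := by
      rw [ht]; simp only [det3, lin]; ring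
    rw [this] at hp
    have hst : s < t := by
      by_contra hc; push Not at hc; nlinarith
    exact ⟨t, hst, D.step hz h2 an' ht hst s1, ht ▸ an'⟩
  exfalso
  have k1 : det3 z1 z2 n < 0 := lt_of_le_of_ne f1 z0
  have k2 : 0 < det3 z1 z2 n' := lt_of_le_of_ne f2 (Ne.symm z0')
  by_cases hcc : Cor a b c n' ∧ Cor a b c n
  · have k3 : 0 ≤ det3 n n' z2 := by
      rcases D.cor_edge (D.inn_cyc hI) hcc.2 hcc.1 with ⟨rfl, rfl⟩ | ⟨rfl, rfl⟩ | ⟨rfl, rfl⟩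
      · exact o2.1
      · exact o2.2.1
      · exact o2.2.2
    rcases D.W hI h2 ⟨g1, k3, g2⟩ with e | e | e
    · have := lin_inj hz ((lin_one z1 z2).trans e)
      linarith
    · rw [← e, det3_self'] at k1; exact lt_irrefl _ k1
    · rw [← e, det3_self'] at k2; exact lt_irrefl _ k2
  · exact hcl (n', n) ⟨T.adj_symm ⟨_, T.cyc hI.1⟩, hcc, k2, k1⟩

lemma Draw.join (D : Draw id a b c P F) {z1 z2 : ℝ × ℝ} (hz : z1 ≠ z2) (h1 : z1 ∈ P)
    (h2 : z2 ∈ P) (hc1 : ¬ Cor a b c z1) (hcl : ∀ e, ¬ Crs F a b c z1 z2 e) : Joined F z1 z2 := by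
  classical
  have H : ∀ (n : ℕ) (s : ℝ), 0 ≤ s → s ≤ 1 → lin z1 z2 s ∈ P →
      (P.filter (fun p => ∃ t, s ≤ t ∧ p = lin z1 z2 t)).card ≤ n →
      ReflTransGen (fun p q => Adj F p q ∧ p ∈ segment ℝ z1 z2 ∧ q ∈ segment ℝ z1 z2)
        (lin z1 z2 s) z2 := by
    intro n
    induction n with
    | zero =>
      intro s s0 s1 hq hn
      exfalso
      have : lin z1 z2 s ∈ P.filter (fun p => ∃ t, s ≤ t ∧ p = lin z1 z2 t) :=
        Finset.mem_filter.2 ⟨hq, s, le_refl _, rfl⟩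
      rw [Finset.card_eq_zero.1 (Nat.le_zero.1 hn)] at this
      simp at this
    | succ n ih =>
      intro s s0 s1 hq hn
      rcases eq_or_lt_of_le s1 with e | s1'
      · rw [e, lin_one]
      obtain ⟨t, hst, t1, hA⟩ := D.progress hz h1 h2 hc1 hcl s0 s1' hq
      refine ReflTransGen.head ⟨hA, seg_iff.2 ⟨s, s0, s1, rfl⟩,
        seg_iff.2 ⟨t, by linarith, t1, rfl⟩⟩ ?_
      refine ih t (by linarith) t1 (D.tri.adj_mem (D.tri.adj_symm hA)) ?_
      have : (P.filter (fun p => ∃ r, t ≤ r ∧ p = lin z1 z2 r)) ⊂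
          (P.filter (fun p => ∃ r, s ≤ r ∧ p = lin z1 z2 r)) := by
        rw [Finset.ssubset_iff_of_subset]
        · refine ⟨lin z1 z2 s, Finset.mem_filter.2 ⟨hq, s, le_refl _, rfl⟩, ?_⟩
          intro hh
          obtain ⟨_, r, hr, e⟩ := Finset.mem_filter.1 hh
          have := lin_inj hz e
          linarith
        · intro p hp
          obtain ⟨hp1, r, hr, e⟩ := Finset.mem_filter.1 hp
          exact Finset.mem_filter.2 ⟨hp1, r, by linarith, e⟩
      have := Finset.card_lt_card this
      omega
  have := H _ 0 le_rfl zero_le_one (by rw [lin_zero]; exact h1) le_rfl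
  rw [lin_zero] at this
  exact this

lemma Draw.join_pair (D : Draw id a b c P F) {z1 z2 : ℝ × ℝ} (h1 : z1 ∈ P)
    (h2 : z2 ∈ P) (hc1 : ¬ Cor a b c z1) :
    ∃ P' F', Draw id a b c P' F' ∧ Ref P F P' F' ∧ Joined F' z1 z2 := by
  by_cases hz : z1 = z2
  · subst hz
    exact ⟨P, F, D, Ref.refl, ReflTransGen.refl⟩
  obtain ⟨P', F', D', R, hcl⟩ := Draw.clear_line z1 z2 _ P F D ⟨P ×ˢ P, rfl, by
    rintro ⟨x, y⟩ ⟨h, _⟩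
    exact Finset.mem_product.2 ⟨D.tri.adj_mem h, D.tri.adj_mem (D.tri.adj_symm h)⟩⟩
  exact ⟨P', F', D', R, D'.join hz (R.1 h1) (R.1 h2) hc1 hcl⟩

theorem Draw.refine_all {o : ℝ × ℝ} (hco : ¬ Cor a b c o) (D0 : Draw id a b c P F) (ho : o ∈ P) :
    ∀ L : List ((ℝ × ℝ) × (ℝ × ℝ)),
    (∀ e ∈ L, InO a c b e.1 ∧ (InO a c b e.2 ∨ e.2 = a)) →
    ∃ P' F', Draw id a b c P' F' ∧ o ∈ P' ∧ ∀ e ∈ L, e.1 ∈ P' ∧ Joined F' e.1 e.2 := by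
  intro L
  induction L with
  | nil => intro _; exact ⟨P, F, D0, ho, by simp⟩
  | cons e L ih =>
    intro hL
    obtain ⟨P1, F1, D1, o1, h1⟩ := ih (fun e he => hL e (List.mem_cons_of_mem _ he))
    obtain ⟨k1, k2⟩ := hL e List.mem_cons_self
    obtain ⟨P2, F2, D2, R2, h2⟩ := D1.insert_pt o1 hco k1
    obtain ⟨P3, F3, D3, R3, h3⟩ : ∃ P' F', Draw id a b c P' F' ∧ Ref P2 F2 P' F' ∧ e.2 ∈ P' := by
      rcases k2 with k2 | k2
      · exact D2.insert_pt (R2.1 o1) hco k2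
      · exact ⟨P2, F2, D2, Ref.refl, by rw [k2]; exact D2.tri.mem D2.face⟩
    have hc1 : ¬ Cor a b c e.1 := by
      rintro (h | h | h)
      · have := k1.1; rw [h, det3_self] at this; exact lt_irrefl _ this
      · have := k1.2.2; rw [h, det3_self] at this; exact lt_irrefl _ this
      · have := k1.2.1; rw [h, det3_self] at this; exact lt_irrefl _ this
    obtain ⟨P4, F4, D4, R4, h4⟩ := D3.join_pair (R3.1 h2) h3 hc1
    have R := (R2.trans R3).trans R4
    refine ⟨P4, F4, D4, R.1 o1, ?_⟩
    intro e' he'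
    rcases List.mem_cons.1 he' with rfl | he'
    · exact ⟨R4.1 (R3.1 h2), h4⟩
    · exact ⟨R.1 (h1 e' he').1, (h1 e' he').2.mono R⟩

/-- starting drawing -/
lemma k4_draw {N : ℝ} (hN : 0 < N) : ∃ P F, Draw id ((0, 4 * N) : ℝ × ℝ) (4 * N, - (2 * N))
    (- (4 * N), - (2 * N)) P F ∧ ((0, 0) : ℝ × ℝ) ∈ P := by
  refine ⟨_, _, ⟨k4_tri (a := ((0, 4 * N) : ℝ × ℝ)) (b := (4 * N, - (2 * N)))
    (c := (- (4 * N), - (2 * N))) (o := (0, 0)) ?_ ?_ ?_ ?_ ?_ ?_, ?_, ?_, ?_⟩, ?_⟩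
  · intro h; rw [Prod.mk.injEq] at h; linarith [h.1]
  · intro h; rw [Prod.mk.injEq] at h; linarith [h.1]
  · intro h; rw [Prod.mk.injEq] at h; linarith [h.1]
  · intro h; rw [Prod.mk.injEq] at h; linarith [h.2]
  · intro h; rw [Prod.mk.injEq] at h; linarith [h.2]
  · intro h; rw [Prod.mk.injEq] at h; linarith [h.2]
  · simp
  · simp only [id, det3]; nlinarith
  · intro i j k h hr
    simp only [Finset.mem_insert, Finset.mem_singleton] at h
    rcases h with h | h | h | h | h | h | h | h | h | h | h | h <;>
      (have hi := congrArg Prod.fst h; have hj := congrArg (fun t => t.2.1) h; have hk := congrArg (fun t => t.2.2) h; simp only at hi hj hk; subst hi; subst hj; subst hk) <;>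
      first
      | (exact absurd (Or.inl ⟨rfl, rfl, rfl⟩) hr)
      | (exact absurd (Or.inr (Or.inl ⟨rfl, rfl, rfl⟩)) hr)
      | (exact absurd (Or.inr (Or.inr ⟨rfl, rfl, rfl⟩)) hr)
      | (simp only [id, det3]; nlinarith)
  · simp

end refine3
end OPM


namespace OPM
open Filter Topology Relation
section topo

lemma uf_seg {X : Set (ℝ × ℝ)} {p q : ℝ × ℝ} (h : segment ℝ p q ⊆ Xᶜ) (hq : q ∈ unboundedFace X) :
    p ∈ unboundedFace X := by
  refine ⟨h (left_mem_segment ℝ p q), ?_⟩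
  have h1 : q ∈ connectedComponentIn Xᶜ p :=
    (convex_segment p q).isPreconnected.subset_connectedComponentIn (left_mem_segment ℝ p q) h
      (right_mem_segment ℝ p q)
  rw [connectedComponentIn_eq h1]
  exact hq.2

lemma uf_ray {X : Set (ℝ × ℝ)} {p d : ℝ × ℝ} (hd : d ≠ 0) (h : ∀ t : ℝ, 0 ≤ t → p + t • d ∉ X) :
    p ∈ unboundedFace X := by
  refine ⟨by simpa using h 0 le_rfl, ?_⟩
  intro hb
  have hc : IsPreconnected ((fun t : ℝ => p + t • d) '' Set.Ici 0) :=
    isPreconnected_Ici.image _ (by fun_prop)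
  have hs := hc.subset_connectedComponentIn (x := p) ⟨0, Set.self_mem_Ici, by simp⟩
    (F := Xᶜ) (by rintro _ ⟨t, ht, rfl⟩; exact h t ht)
  obtain ⟨C, hC⟩ := (hb.subset hs).exists_norm_le
  have hd' : 0 < ‖d‖ := norm_pos_iff.2 hd
  have hC0 : 0 ≤ C := (norm_nonneg _).trans (hC p ⟨0, Set.self_mem_Ici, by simp⟩)
  have ht0 : 0 ≤ (C + ‖p‖ + 1) / ‖d‖ := by positivity
  have h1 := hC _ ⟨(C + ‖p‖ + 1) / ‖d‖, ht0, rfl⟩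
  have h2 : ‖((C + ‖p‖ + 1) / ‖d‖) • d‖ = C + ‖p‖ + 1 := by
    rw [norm_smul, Real.norm_of_nonneg ht0]; field_simp
  have h3 : ‖((C + ‖p‖ + 1) / ‖d‖) • d‖ ≤ ‖p + ((C + ‖p‖ + 1) / ‖d‖) • d‖ + ‖p‖ := by
    have := norm_sub_le (p + ((C + ‖p‖ + 1) / ‖d‖) • d) p
    simpa using this
  beta_reduce at h1
  linarith

lemma closure_lin {U : Set (ℝ × ℝ)} {p q : ℝ × ℝ} (h : ∀ s : ℝ, 0 < s → s ≤ 1 → lin p q s ∈ U) :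
    p ∈ closure U := by
  have ht : Tendsto (lin p q) (𝓝[>] 0) (𝓝 p) := by
    have := (lin_cont p q).tendsto 0
    rw [lin_zero] at this
    exact this.mono_left nhdsWithin_le_nhds
  refine mem_closure_of_tendsto ht ?_
  filter_upwards [Ioo_mem_nhdsGT (zero_lt_one (α := ℝ))] with s hs
  exact h s hs.1 hs.2.le

lemma closure_uf {X : Set (ℝ × ℝ)} {p q : ℝ × ℝ} (h : ∀ s : ℝ, 0 < s → s ≤ 1 → lin p q s ∉ X)
    (hq : q ∈ unboundedFace X) : p ∈ closure (unboundedFace X) := by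
  refine closure_lin (q := q) fun s h0 h1 => uf_seg ?_ hq
  intro z hz
  obtain ⟨t, t0, t1, rfl⟩ := seg_iff.1 hz
  have e : lin (lin p q s) q t = lin p q (s + t * (1 - s)) := by
    ext <;> simp only [lin] <;> ring
  rw [e]
  apply h
  · nlinarith
  · nlinarith

/-- local cone structure of a segment -/
lemma cone_seg (o u v : ℝ × ℝ) : ∀ᶠ q in 𝓝 o, q ∉ segment ℝ u v →
    ∀ s : ℝ, 0 < s → s ≤ 1 → lin o q s ∉ segment ℝ u v := by
  by_cases ho : o ∈ segment ℝ u v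
  · obtain ⟨t, t0, t1, rfl⟩ := seg_iff.1 ho
    have e1 : ∀ᶠ q in 𝓝 (lin u v t), t < 1 → Dist.dist q (lin u v t) < (1 - t) * Dist.dist u v ∨ u = v := by
      by_cases huv : u = v
      · filter_upwards with q _; exact Or.inr huv
      by_cases h : t < 1
      · filter_upwards [Metric.ball_mem_nhds _ (mul_pos (sub_pos.2 h) (dist_pos.2 huv))] with q hq _
        exact Or.inl hq
      · filter_upwards with q h'; exact absurd h' h
    have e2 : ∀ᶠ q in 𝓝 (lin u v t), 0 < t → Dist.dist q (lin u v t) < t * Dist.dist u v ∨ u = v := by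
      by_cases huv : u = v
      · filter_upwards with q _; exact Or.inr huv
      by_cases h : 0 < t
      · filter_upwards [Metric.ball_mem_nhds _ (mul_pos h (dist_pos.2 huv))] with q hq _
        exact Or.inl hq
      · filter_upwards with q h'; exact absurd h' h
    filter_upwards [e1, e2] with q k1 k2 hq s s0 s1 hmem
    apply hq
    obtain ⟨t', t0', t1', he⟩ := seg_iff.1 hmem
    have hqe : q = lin u v (t + (t' - t) / s) := by
      have a1 := congrArg Prod.fst he
      have a2 := congrArg Prod.snd he
      simp only [lin] at a1 a2
      ext
      · simp only [lin]; field_simp; linarith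
      · simp only [lin]; field_simp; linarith
    have hd : ∀ τ, Dist.dist (lin u v τ) (lin u v t) = |τ - t| * Dist.dist u v := by
      intro τ
      rw [dist_eq_norm, dist_eq_norm, ← norm_neg (u - v), neg_sub,
        show lin u v τ - lin u v t = (τ - t) • (v - u) by
          ext <;> simp only [lin, Prod.fst_sub, Prod.snd_sub, Prod.smul_fst, Prod.smul_snd, smul_eq_mul] <;> ring,
        norm_smul, Real.norm_eq_abs]
    rw [hqe, hd] at k1 k2
    by_cases huv : u = v
    · rw [hqe, huv, lin_same]; exact left_mem_segment ℝ v v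
    have hp := dist_pos.2 huv
    rw [hqe]
    refine seg_iff.2 ⟨_, ?_, ?_, rfl⟩
    · rcases lt_or_ge t' t with hlt | hge
      · rcases k2 (by linarith) with k | k
        · have := (mul_lt_mul_iff_left₀ hp).1 k
          have := neg_abs_le (t + (t' - t) / s - t)
          linarith
        · exact absurd k huv
      · have : 0 ≤ (t' - t) / s := div_nonneg (by linarith) s0.le
        linarith
    · rcases lt_or_ge t t' with hlt | hge
      · rcases k1 (by linarith) with k | k
        · have := (mul_lt_mul_iff_left₀ hp).1 k
          have := le_abs_self (t + (t' - t) / s - t)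
          linarith
        · exact absurd k huv
      · have : (t' - t) / s ≤ 0 := div_nonpos_of_nonpos_of_nonneg (by linarith) s0.le
        linarith
  · have hcl : IsClosed (segment ℝ u v) := by
      rw [segment_eq_image_lineMap]
      exact (isCompact_Icc.image (by fun_prop)).isClosed
    obtain ⟨ε, ε0, hε⟩ := Metric.isOpen_iff.1 hcl.isOpen_compl o ho
    filter_upwards [Metric.ball_mem_nhds o ε0] with q hq _ s s0 s1
    apply hε
    exact (convex_ball o ε).segment_subset (Metric.mem_ball_self ε0) hq
      (seg_iff.2 ⟨s, s0.le, s1, rfl⟩)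

lemma rtg_list {Y : Type*} {r : Y → Y → Prop} {x y : Y} (h : ReflTransGen r x y) :
    ∃ L : List (Y × Y), (∀ e ∈ L, r e.1 e.2) ∧ ReflTransGen (fun p q => (p, q) ∈ L) x y := by
  induction h with
  | refl => exact ⟨[], by simp, .refl⟩
  | @tail b c _ hbc ih =>
    obtain ⟨L, h1, h2⟩ := ih
    refine ⟨(b, c) :: L, ?_, ?_⟩
    · intro e he
      rcases List.mem_cons.1 he with rfl | he
      · exact hbc
      · exact h1 e he
    · refine ReflTransGen.tail (ReflTransGen.mono (fun p q hpq => List.mem_cons_of_mem _ hpq) _ _ h2) ?_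
      exact List.mem_cons_self

lemma seg_half {X : Set (ℝ × ℝ)} (φ : (ℝ × ℝ) →ₗ[ℝ] ℝ) {R : ℝ} (hX : ∀ p ∈ X, φ p ≤ R)
    {p q : ℝ × ℝ} (hp : R < φ p) (hq : R < φ q) : segment ℝ p q ⊆ Xᶜ := by
  intro z hz hzX
  have hc : Convex ℝ {w | R < φ w} := convex_halfSpace_gt φ.isLinear R
  have := hc.segment_subset hp hq hz
  exact absurd (hX z hzX) (not_le.2 this)

lemma far_path {X : Set (ℝ × ℝ)} {R : ℝ} (hR : 0 ≤ R) (hX : ∀ p ∈ X, ‖p‖ ≤ R) {z : ℝ × ℝ} (hz : R < ‖z‖) :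
    ReflTransGen (fun p p' => segment ℝ p p' ⊆ Xᶜ) z (0, R + 1) := by
  have X1 : ∀ p ∈ X, |p.1| ≤ R := fun p hp => (norm_fst_le p).trans (hX p hp)
  have X2 : ∀ p ∈ X, |p.2| ≤ R := fun p hp => (norm_snd_le p).trans (hX p hp)
  have up : ∀ {p q : ℝ × ℝ}, R < p.2 → R < q.2 → segment ℝ p q ⊆ Xᶜ := fun hp hq =>
    seg_half (LinearMap.snd ℝ ℝ ℝ) (fun p hp => (le_abs_self _).trans (X2 p hp)) hp hq
  have rt : ∀ {p q : ℝ × ℝ}, R < p.1 → R < q.1 → segment ℝ p q ⊆ Xᶜ := fun hp hq =>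
    seg_half (LinearMap.fst ℝ ℝ ℝ) (fun p hp => (le_abs_self _).trans (X1 p hp)) hp hq
  have lf : ∀ {p q : ℝ × ℝ}, R < -p.1 → R < -q.1 → segment ℝ p q ⊆ Xᶜ := fun hp hq =>
    seg_half (-LinearMap.fst ℝ ℝ ℝ) (fun p hp => (neg_le_abs _).trans (X1 p hp)) hp hq
  have dn : ∀ {p q : ℝ × ℝ}, R < -p.2 → R < -q.2 → segment ℝ p q ⊆ Xᶜ := fun hp hq =>
    seg_half (-LinearMap.snd ℝ ℝ ℝ) (fun p hp => (neg_le_abs _).trans (X2 p hp)) hp hq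
  have top : ∀ {z : ℝ × ℝ}, R < z.2 → 
      ReflTransGen (fun p p' => segment ℝ p p' ⊆ Xᶜ) z (0, R + 1) := fun hz =>
    ReflTransGen.single (up hz (by simp))
  have right : ∀ {z : ℝ × ℝ}, R < z.1 → 
      ReflTransGen (fun p p' => segment ℝ p p' ⊆ Xᶜ) z (0, R + 1) := fun {z} hz =>
    ReflTransGen.head (b := (z.1, R + 1)) (rt hz hz) (top (by simp))
  rw [Prod.norm_def, lt_max_iff, Real.norm_eq_abs, Real.norm_eq_abs, lt_abs, lt_abs] at hz
  rcases hz with (hz | hz) | (hz | hz)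
  · exact right hz
  · exact ReflTransGen.head (b := (z.1, R + 1)) (lf hz hz) (top (by simp))
  · exact top hz
  · exact ReflTransGen.head (b := (R + 1, z.2)) (dn hz hz) (right (by simp))

lemma seg_compact (u v : ℝ × ℝ) : IsCompact (segment ℝ u v) := by
  rw [segment_eq_image_lineMap]
  exact isCompact_Icc.image (by fun_prop)

theorem escape {E : Set ((ℝ × ℝ) × (ℝ × ℝ))} (hE : E.Finite) {X : Set (ℝ × ℝ)}
    (hX : X = ⋃ e ∈ E, segment ℝ e.1 e.2) {o : ℝ × ℝ} (ho : o ∈ closure (unboundedFace X)) :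
    ∃ (L : List ((ℝ × ℝ) × (ℝ × ℝ))) (R : ℝ),
      (∀ e ∈ L, ∀ z ∈ segment ℝ e.1 e.2, z = o ∨ z ∉ X) ∧
      ReflTransGen (fun p p' => (p, p') ∈ L) o (0, R) ∧
      ∀ Y, R ≤ Y → ∀ z ∈ segment ℝ ((0, R) : ℝ × ℝ) (0, Y), z ∉ X := by
  have hcomp : IsCompact X := by
    rw [hX]; exact hE.isCompact_biUnion fun e _ => seg_compact _ _
  obtain ⟨R0, hR0⟩ := hcomp.isBounded.exists_norm_le
  set R := max R0 0 with hRdef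
  have hR : 0 ≤ R := le_max_right _ _
  have hXR : ∀ p ∈ X, ‖p‖ ≤ R := fun p hp => (hR0 p hp).trans (le_max_left _ _)
  have hcone : ∀ᶠ q in 𝓝 o, ∀ e ∈ E, q ∉ segment ℝ e.1 e.2 →
      ∀ s : ℝ, 0 < s → s ≤ 1 → lin o q s ∉ segment ℝ e.1 e.2 :=
    (eventually_all_finite hE).2 fun e _ => cone_seg o e.1 e.2
  obtain ⟨q, hq, hqc⟩ := ((mem_closure_iff_frequently.1 ho).and_eventually hcone).exists
  have hlin : ∀ s : ℝ, 0 < s → s ≤ 1 → lin o q s ∉ X := by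
    intro s s0 s1 hm
    rw [hX] at hm
    simp only [Set.mem_iUnion] at hm
    obtain ⟨e, he, hm⟩ := hm
    refine hqc e he ?_ s s0 s1 hm
    intro h
    apply hq.1
    rw [hX]
    simp only [Set.mem_iUnion]
    exact ⟨e, he, h⟩
  have hopen : IsOpen (connectedComponentIn Xᶜ q) := hcomp.isClosed.isOpen_compl.connectedComponentIn
  obtain ⟨z, hz, hzR⟩ : ∃ z ∈ connectedComponentIn Xᶜ q, R < ‖z‖ := by
    by_contra hcon
    push Not at hcon
    exact hq.2 (isBounded_iff_forall_norm_le.2 ⟨R, hcon⟩)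
  have hpoly : ReflTransGen (fun p p' => segment ℝ p p' ⊆ Xᶜ) q z := by
    refine (isPreconnected_connectedComponentIn (x := q) (F := Xᶜ)).induction₂'
      (fun p p' => ReflTransGen (fun p p' => segment ℝ p p' ⊆ Xᶜ) p p') ?_ ?_
      (mem_connectedComponentIn hq.1) hz
    · intro x hx
      obtain ⟨ε, ε0, hε⟩ := Metric.isOpen_iff.1 hopen x hx
      have hb := Metric.ball_mem_nhds x ε0
      filter_upwards [mem_nhdsWithin_of_mem_nhds hb] with y hy
      have hs : segment ℝ x y ⊆ Xᶜ := ((convex_ball x ε).segment_subset (Metric.mem_ball_self ε0) hy).trans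
        (hε.trans (connectedComponentIn_subset _ _))
      refine ⟨ReflTransGen.single hs, ReflTransGen.single ?_⟩
      rw [segment_symm]; exact hs
    · intro x y z _ _ _ h1 h2; exact h1.trans h2
  obtain ⟨L, h1, h2⟩ := rtg_list (hpoly.trans (far_path hR hXR hzR))
  refine ⟨(o, q) :: L, R + 1, ?_, ?_, ?_⟩
  · intro e he w hw
    rcases List.mem_cons.1 he with rfl | he
    · obtain ⟨s, s0, s1, rfl⟩ := seg_iff.1 hw
      rcases s0.lt_or_eq with h | h
      · exact Or.inr (hlin s h s1)
      · left; rw [← h, lin_zero]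
    · exact Or.inr (h1 e he hw)
  · refine ReflTransGen.head (b := q) List.mem_cons_self
      (ReflTransGen.mono (fun p q hpq => List.mem_cons_of_mem _ hpq) _ _ h2)
  · intro Y hY w hw hwX
    have := seg_half (X := X) (R := R) (LinearMap.snd ℝ ℝ ℝ)
      (fun p hp => (le_abs_self _).trans ((norm_snd_le p).trans (hXR p hp)))
      (p := (0, R + 1)) (q := (0, Y)) (by simp) (by simp; linarith) hw
    exact this hwX

end topo
end OPM


namespace OPM
open Filter Topology Relation
section peel

variable {V : Type*} {G : SimpleGraph V} {pos : V → ℝ × ℝ}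

lemma mem_drawn {S : Set V} {p : ℝ × ℝ} : p ∈ drawnSet G pos S ↔
    (∃ v ∈ S, p = pos v) ∨ ∃ u v, u ∈ S ∧ v ∈ S ∧ G.Adj u v ∧ p ∈ segment ℝ (pos u) (pos v) := by
  unfold drawnSet
  simp only [Set.mem_union, Set.mem_image, Set.mem_iUnion, exists_prop]
  constructor
  · rintro (⟨v, hv, rfl⟩ | ⟨u, v, ⟨h1, h2, h3⟩, h4⟩)
    · exact Or.inl ⟨v, hv, rfl⟩
    · exact Or.inr ⟨u, v, h1, h2, h3, h4⟩
  · rintro (⟨v, hv, rfl⟩ | ⟨u, v, h1, h2, h3, h4⟩)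
    · exact Or.inl ⟨v, hv, rfl⟩
    · exact Or.inr ⟨u, v, ⟨h1, h2, h3⟩, h4⟩

lemma drawn_fin [Fintype V] (S : Set V) : ∃ E : Set ((ℝ × ℝ) × (ℝ × ℝ)), E.Finite ∧
    drawnSet G pos S = ⋃ e ∈ E, segment ℝ e.1 e.2 := by
  refine ⟨(fun t : V × V => (pos t.1, pos t.2)) '' {t | t.1 ∈ S ∧ t.2 ∈ S ∧ (t.1 = t.2 ∨ G.Adj t.1 t.2)},
    (Set.toFinite _).image _, ?_⟩
  ext p
  rw [mem_drawn]
  simp only [Set.mem_iUnion, exists_prop]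
  constructor
  · rintro (⟨v, hv, rfl⟩ | ⟨u, v, h1, h2, h3, h4⟩)
    · exact ⟨_, ⟨(v, v), ⟨hv, hv, Or.inl rfl⟩, rfl⟩, left_mem_segment ℝ _ _⟩
    · exact ⟨_, ⟨(u, v), ⟨h1, h2, Or.inr h3⟩, rfl⟩, h4⟩
  · rintro ⟨_, ⟨⟨u, v⟩, ⟨h1, h2, h3⟩, rfl⟩, h4⟩
    rcases h3 with h3 | h3
    · left
      refine ⟨u, h1, ?_⟩
      simp only at h3
      subst h3
      simpa [segment_same] using h4
    · exact Or.inr ⟨u, v, h1, h2, h3, h4⟩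

lemma exists_outer [Fintype V] {S : Set V} (hS : S.Nonempty) : (outerVertices G pos S).Nonempty := by
  obtain ⟨v, hv, hmax⟩ := (Set.toFinite S).exists_maximalFor (fun v => (pos v).2) S hS
  have hle : ∀ w ∈ S, (pos w).2 ≤ (pos v).2 := by
    intro w hw
    rcases le_total (pos w).2 (pos v).2 with h | h
    · exact h
    · exact hmax hw h
  have hX : ∀ p ∈ drawnSet G pos S, p.2 ≤ (pos v).2 := by
    intro p hp
    rcases mem_drawn.1 hp with ⟨w, hw, rfl⟩ | ⟨u, w, h1, h2, _, h4⟩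
    · exact hle w hw
    · exact (convex_halfSpace_le (LinearMap.snd ℝ ℝ ℝ).isLinear (pos v).2).segment_subset
        (hle u h1) (hle w h2) h4
  refine ⟨v, hv, ?_⟩
  refine closure_uf (q := pos v + (0, 1)) ?_ (uf_ray (d := (0, 1)) ?_ ?_)
  · intro s s0 s1 hm
    have := hX _ hm
    simp [lin] at this
    linarith
  · simp
  · intro t ht hm
    have := hX _ hm
    simp at this
    linarith

lemma peel_anti (i : ℕ) : drawingPeel G pos (i + 1) ⊆ drawingPeel G pos i := fun _ h => h.1

lemma peel_empty [Fintype V] : ∃ k, drawingPeel G pos k = ∅ := by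
  by_contra hcon
  push Not at hcon
  have h : ∀ k, (drawingPeel G pos k).ncard + k ≤ Fintype.card V := by
    intro k
    induction k with
    | zero => simp [drawingPeel, Set.ncard_univ]
    | succ k ih =>
      have : (drawingPeel G pos (k + 1)).ncard < (drawingPeel G pos k).ncard := by
        apply Set.ncard_lt_ncard _ (Set.toFinite _)
        refine ⟨peel_anti k, fun hsub => ?_⟩
        obtain ⟨v, hv⟩ := exists_outer (G := G) (pos := pos) (hcon k)
        exact (hsub hv.1).2 hv
      omega
  have := h (Fintype.card V + 1)
  omega

lemma key_exists [Fintype V] (S : ℕ → Set V) (hS : ∀ i, S (i + 1) ⊆ S i) {k : ℕ} (hk : S k = ∅) :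
    ∃ key : V → ℕ, Function.Injective key ∧ ∀ h h' i, key h < key h' → h ∈ S i → h' ∈ S i := by
  classical
  have hanti : Antitone S := antitone_nat_of_succ_le hS
  have hex : ∀ v, ∃ i, v ∉ S i := fun v => ⟨k, by rw [hk]; simp⟩
  let lay : V → ℕ := fun v => Nat.find (hex v)
  have hlay : ∀ v i, v ∈ S i ↔ i < lay v := by
    intro v i
    constructor
    · intro hv
      by_contra hcon
      exact Nat.find_spec (hex v) (hanti (not_lt.1 hcon) hv)
    · intro h
      exact not_not.1 (Nat.find_min (hex v) h)
  let e := Fintype.equivFin V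
  have key_eq : ∀ u v, lay u < lay v → lay u * Fintype.card V + (e u : ℕ) <
      lay v * Fintype.card V + (e v : ℕ) := by
    intro u v h
    have h1 := (e u).2
    have h2 : (lay u + 1) * Fintype.card V ≤ lay v * Fintype.card V := Nat.mul_le_mul_right _ h
    rw [add_mul, one_mul] at h2
    omega
  refine ⟨fun v => lay v * Fintype.card V + (e v : ℕ), ?_, ?_⟩
  · intro u v h
    simp only at h
    rcases lt_trichotomy (lay u) (lay v) with h1 | h1 | h1
    · have := key_eq u v h1; omega
    · rw [h1] at h
      exact e.injective (Fin.ext (by omega))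
    · have := key_eq v u h1; omega
  · intro h h' i hlt hi
    rw [hlay] at hi ⊢
    by_contra hcon
    have := key_eq h' h (by omega)
    simp only at hlt
    omega

end peel
end OPM


namespace OPM
open Filter Topology Relation
section label

lemma rtg_last {Y : Type*} {r : Y → Y → Prop} {x y : Y} (h : ReflTransGen r x y) (hne : x ≠ y) :
    ∃ p, ReflTransGen (fun u v => r u v ∧ v ≠ y) x p ∧ r p y := by
  induction h using ReflTransGen.head_induction_on with
  | refl => exact absurd rfl hne
  | @head a c hac _ ih =>
    by_cases hc : c = y
    · subst hc; exact ⟨a, .refl, hac⟩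
    · obtain ⟨p, h1, h2⟩ := ih hc
      exact ⟨p, ReflTransGen.head ⟨hac, hc⟩ h1, h2⟩

lemma rtg_first {Y : Type*} {r : Y → Y → Prop} {x y : Y} (h : ReflTransGen r x y) (hne : x ≠ y) :
    ∃ p, r x p ∧ p ≠ x ∧ ReflTransGen (fun u v => r u v ∧ v ≠ x) p y := by
  induction h with
  | refl => exact absurd rfl hne
  | @tail b c _ hbc ih =>
    by_cases hb : x = b
    · subst hb; exact ⟨c, hbc, hne.symm, .refl⟩
    · obtain ⟨p, h1, h2, h3⟩ := ih hb
      exact ⟨p, h1, h2, h3.tail ⟨hbc, hne.symm⟩⟩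

variable {α β : Type*} {G : SimpleGraph β} {pos : β → ℝ × ℝ}
variable {P : Finset (ℝ × ℝ)} {F : Finset ((ℝ × ℝ) × (ℝ × ℝ) × (ℝ × ℝ))}

/-- half edge of `g` towards `g'` -/
def Half (F : Finset ((ℝ × ℝ) × (ℝ × ℝ) × (ℝ × ℝ))) (pos : β → ℝ × ℝ) (g g' : β) (x : ℝ × ℝ) : Prop :=
  ReflTransGen (fun p q => (Adj F p q ∧ p ∈ segment ℝ (pos g) (pos g') ∧
    q ∈ segment ℝ (pos g) (pos g')) ∧ q ≠ pos g') (pos g) x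

/-- the point `x` belongs to the vertex `g` -/
def Own (G : SimpleGraph β) (key : β → ℕ) (F : Finset ((ℝ × ℝ) × (ℝ × ℝ) × (ℝ × ℝ)))
    (pos : β → ℝ × ℝ) (x : ℝ × ℝ) (g : β) : Prop :=
  x = pos g ∨ ∃ g', G.Adj g g' ∧ key g < key g' ∧ Half F pos g g' x

variable {key : β → ℕ}

lemma Half.seg {g g' : β} {x : ℝ × ℝ} (h : Half F pos g g' x) : x ∈ segment ℝ (pos g) (pos g') := by
  rcases ReflTransGen.cases_tail h with h | ⟨_, _, h⟩
  · rw [h]; exact left_mem_segment ℝ _ _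
  · exact h.1.2.2

lemma Half.ne {g g' : β} {x : ℝ × ℝ} (hp : IsPlanarDrawing G pos) (ha : G.Adj g g')
    (h : Half F pos g g' x) : x ≠ pos g' := by
  rcases ReflTransGen.cases_tail h with h | ⟨_, _, h⟩
  · rw [h]; exact fun e => ha.ne (hp.1 e)
  · exact h.2

lemma Own.seg {g : β} {x : ℝ × ℝ} (h : Own G key F pos x g) :
    x = pos g ∨ ∃ g', G.Adj g g' ∧ key g < key g' ∧ x ∈ segment ℝ (pos g) (pos g') := by
  rcases h with h | ⟨g', h1, h2, h3⟩
  · exact Or.inl h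
  · exact Or.inr ⟨g', h1, h2, h3.seg⟩

lemma Own.uniq (hp : IsPlanarDrawing G pos) {x : ℝ × ℝ} {g1 g2 : β}
    (h1 : Own G key F pos x g1) (h2 : Own G key F pos x g2) : g1 = g2 := by
  have aux : ∀ {g1 g2 : β}, x = pos g1 → (∃ g', G.Adj g2 g' ∧ key g2 < key g' ∧ Half F pos g2 g' x) →
      g1 = g2 := by
    rintro g1 g2 e ⟨g', ha, _, hh⟩
    by_contra hne
    have h3 : g1 ≠ g' := by
      rintro rfl; exact hh.ne hp ha e
    exact hp.2.1 g2 g' g1 ha hne h3 (e ▸ hh.seg)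
  rcases h1 with h1 | h1
  · rcases h2 with h2 | h2
    · exact hp.1 (h1.symm.trans h2)
    · exact aux h1 h2
  · rcases h2 with h2 | h2
    · exact (aux h2 h1).symm
    · obtain ⟨g1', a1, k1, c1⟩ := h1
      obtain ⟨g2', a2, k2, c2⟩ := h2
      by_cases hs : s(g1, g1') = s(g2, g2')
      · rcases Sym2.eq_iff.1 hs with ⟨e, _⟩ | ⟨e, e'⟩
        · exact e
        · subst e; subst e'; omega
      · obtain ⟨e1, e2⟩ := hp.2.2 _ _ _ _ a1 a2 hs x c1.seg c2.seg
        have e1 := e1.resolve_right (c1.ne hp a1)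
        have e2 := e2.resolve_right (c2.ne hp a2)
        exact hp.1 (e1.symm.trans e2)

open Classical in
/-- the label of a point -/
noncomputable def lab (G : SimpleGraph β) (key : β → ℕ) (F : Finset ((ℝ × ℝ) × (ℝ × ℝ) × (ℝ × ℝ)))
    (pos : β → ℝ × ℝ) (B : α → Set β) (x : ℝ × ℝ) : (ℝ × ℝ) ⊕ α :=
  if h : ∃ a, ∃ g ∈ B a, Own G key F pos x g then Sum.inr h.choose else Sum.inl x

variable {B : α → Set β}

lemma lab_inl {x y : ℝ × ℝ} (h : lab G key F pos B x = Sum.inl y) : y = x := by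
  unfold lab at h
  split_ifs at h
  exact (Sum.inl.inj h).symm

lemma lab_own {x : ℝ × ℝ} {a : α} (h : lab G key F pos B x = Sum.inr a) :
    ∃ g ∈ B a, Own G key F pos x g := by
  unfold lab at h
  split_ifs at h with h'
  rw [← Sum.inr.inj h]
  exact h'.choose_spec

lemma lab_of (hp : IsPlanarDrawing G pos) (hB : Pairwise fun a b => Disjoint (B a) (B b))
    {x : ℝ × ℝ} {a : α} {g : β} (hg : g ∈ B a) (h : Own G key F pos x g) :
    lab G key F pos B x = Sum.inr a := by
  have h' : ∃ a, ∃ g ∈ B a, Own G key F pos x g := ⟨a, g, hg, h⟩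
  unfold lab
  rw [dif_pos h']
  obtain ⟨g2, hg2, ho⟩ := h'.choose_spec
  have := Own.uniq hp ho h
  subst this
  congr 1
  by_contra hne
  exact (Set.disjoint_left.1 (hB hne)) hg2 hg

lemma lab_free {x : ℝ × ℝ} (h : ∀ g, ¬ Own G key F pos x g) : lab G key F pos B x = Sum.inl x := by
  unfold lab
  rw [dif_neg]
  rintro ⟨a, g, _, ho⟩
  exact h g ho

/-- the fibre relation -/
def FR {W : Type*} (f : ℝ × ℝ → W) (F : Finset ((ℝ × ℝ) × (ℝ × ℝ) × (ℝ × ℝ))) (u v : ℝ × ℝ) : Prop :=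
  Adj F u v ∧ f u = f v

lemma half_conn (hp : IsPlanarDrawing G pos) (hB : Pairwise fun a b => Disjoint (B a) (B b))
    {a : α} {g g' : β} (hg : g ∈ B a) (ha : G.Adj g g') (hk : key g < key g') {x : ℝ × ℝ}
    (h : Half F pos g g' x) : ReflTransGen (FR (lab G key F pos B) F) (pos g) x := by
  unfold Half at h
  induction h with
  | refl => exact .refl
  | @tail y z hy hyz ih =>
    refine ih.tail ⟨hyz.1.1, ?_⟩
    rw [lab_of hp hB hg (Or.inr ⟨g', ha, hk, hy⟩), lab_of hp hB hg (Or.inr ⟨g', ha, hk, hy.tail hyz⟩)]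

lemma own_conn (hp : IsPlanarDrawing G pos) (hB : Pairwise fun a b => Disjoint (B a) (B b))
    {a : α} {g : β} (hg : g ∈ B a) {x : ℝ × ℝ} (h : Own G key F pos x g) :
    ReflTransGen (FR (lab G key F pos B) F) (pos g) x := by
  rcases h with rfl | ⟨g', h1, h2, h3⟩
  · exact .refl
  · exact half_conn hp hB hg h1 h2 h3

lemma half_end (hp : IsPlanarDrawing G pos) {g g' : β} (ha : G.Adj g g')
    (hJ : Joined F (pos g) (pos g')) : ∃ x, Half F pos g g' x ∧ Adj F x (pos g') := by
  obtain ⟨x, h1, h2⟩ := rtg_last hJ (fun e => ha.ne (hp.1 e))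
  exact ⟨x, h1, h2.1⟩

theorem lab_lab {A1 A2 A3 : ℝ × ℝ} (D : Draw id A1 A2 A3 P F) (hp : IsPlanarDrawing G pos)
    (hB : Pairwise fun a b => Disjoint (B a) (B b))
    (hBc : ∀ a, (G.induce (B a)).Connected) (hkey : Function.Injective key)
    (hJ : ∀ g g', G.Adj g g' → Joined F (pos g) (pos g'))
    (hfree : ∀ x, Cor A1 A2 A3 x → ∀ g, ¬ Own G key F pos x g) :
    Lab (lab G key F pos B) A1 A2 A3 P F := by
  have T := D.tri
  have hsym : ∀ {u v}, ReflTransGen (FR (lab G key F pos B) F) u v →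
      ReflTransGen (FR (lab G key F pos B) F) v u := by
    intro u v h
    induction h with
    | refl => exact .refl
    | tail _ h ih => exact ReflTransGen.head ⟨T.adj_symm h.1, h.2.symm⟩ ih
  have hedge1 : ∀ {a : α} {g g' : β}, g ∈ B a → g' ∈ B a → G.Adj g g' → key g < key g' →
      ReflTransGen (FR (lab G key F pos B) F) (pos g) (pos g') := by
    intro a g g' hg hg' ha hk
    obtain ⟨x, h1, h2⟩ := half_end hp ha (hJ g g' ha)
    refine (half_conn hp hB hg ha hk h1).tail ⟨h2, ?_⟩
    rw [lab_of hp hB hg (Or.inr ⟨g', ha, hk, h1⟩), lab_of hp hB hg' (Or.inl rfl)]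
  have hedge : ∀ {a : α} {g g' : β}, g ∈ B a → g' ∈ B a → G.Adj g g' →
      ReflTransGen (FR (lab G key F pos B) F) (pos g) (pos g') := by
    intro a g g' hg hg' ha
    rcases lt_trichotomy (key g) (key g') with h | h | h
    · exact hedge1 hg hg' ha h
    · exact absurd (hkey h) ha.ne
    · exact hsym (hedge1 hg' hg ha.symm h)
  have hbr : ∀ {a : α} {g g' : β}, g ∈ B a → g' ∈ B a →
      ReflTransGen (FR (lab G key F pos B) F) (pos g) (pos g') := by
    intro a g g' hg hg'
    obtain ⟨w⟩ := (hBc a).preconnected ⟨g, hg⟩ ⟨g', hg'⟩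
    have key2 : ∀ (u v : B a) (w : (G.induce (B a)).Walk u v),
        ReflTransGen (FR (lab G key F pos B) F) (pos u) (pos v) := by
      intro u v w
      induction w with
      | nil => exact .refl
      | @cons u v w h _ ih => exact (hedge u.2 v.2 h).trans ih
    exact key2 _ _ w
  have hcor : ∀ x, Cor A1 A2 A3 x → ∀ z ∈ P, lab G key F pos B z = lab G key F pos B x → z = x := by
    intro x hx z _ h
    rw [lab_free (hfree x hx)] at h
    exact (lab_inl h).symm
  refine ⟨T, ?_, D.face, hcor _ (Or.inl rfl), hcor _ (Or.inr (Or.inl rfl)), hcor _ (Or.inr (Or.inr rfl))⟩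
  intro S hS u v hu' hv' huv hu
  have hrt : ReflTransGen (FR (lab G key F pos B) F) u v := by
    cases h : lab G key F pos B u with
    | inl y =>
      have h' := h
      rw [huv] at h'
      rw [← lab_inl h, ← lab_inl h']
    | inr a =>
      have h' := h
      rw [huv] at h'
      obtain ⟨g, hg, ho⟩ := lab_own h
      obtain ⟨g', hg', ho'⟩ := lab_own h'
      exact ((hsym (own_conn hp hB hg ho)).trans (hbr hg hg')).trans (own_conn hp hB hg' ho')
  clear huv hu' hv'
  induction hrt with
  | refl => exact hu
  | @tail x y hx hxy ih =>
    exact hS x y hxy.1 hxy.2 ih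

end label
end OPM


namespace OPM
open Filter Topology Relation
section final

variable {α β : Type*} {H : SimpleGraph α} {G : SimpleGraph β} {pos : β → ℝ × ℝ}
variable {P : Finset (ℝ × ℝ)} {F : Finset ((ℝ × ℝ) × (ℝ × ℝ) × (ℝ × ℝ))}
variable {key : β → ℕ} {B : α → Set β}

/-- the outer corner lies in the unbounded face of every subdrawing missing the corners -/
lemma corner_uf {X : Type*} [DecidableEq X] {pos' : X → ℝ × ℝ} {A1 A2 A3 : X} {P' : Finset X}
    {F' : Finset (X × X × X)} (D : Draw pos' A1 A2 A3 P' F') {rep : α → X} (hrep : ∀ a, rep a ∈ P')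
    (h1 : ∀ a, rep a ≠ A1) (h2 : ∀ a, rep a ≠ A2) (h3 : ∀ a, rep a ≠ A3) (S : Set α) :
    pos' A1 ∈ unboundedFace (drawnSet H (fun a => pos' (rep a)) S) := by
  have hpos := D.neg'
  have hlt : ∀ a, det3 (pos' A3) (pos' A2) (pos' (rep a)) < det3 (pos' A1) (pos' A3) (pos' A2) := by
    intro a
    have h := D.inO_outer (hrep a) (h1 a) (h2 a) (h3 a)
    have e : det3 (pos' A1) (pos' A3) (pos' (rep a)) + det3 (pos' A3) (pos' A2) (pos' (rep a)) +
        det3 (pos' A2) (pos' A1) (pos' (rep a)) = det3 (pos' A1) (pos' A3) (pos' A2) := by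
      unfold det3; ring
    linarith [h.1, h.2.2]
  have hX : ∀ p ∈ drawnSet H (fun a => pos' (rep a)) S,
      det3 (pos' A3) (pos' A2) p < det3 (pos' A1) (pos' A3) (pos' A2) := by
    intro p hp
    rcases mem_drawn.1 hp with ⟨w, _, rfl⟩ | ⟨u, w, _, _, _, h4⟩
    · exact hlt w
    · obtain ⟨s, s0, s1, rfl⟩ := seg_iff.1 h4
      rw [det3_lin]
      have k1 := hlt u
      have k2 := hlt w
      rcases s0.lt_or_eq with h | h
      · nlinarith
      · rw [← h]; linarith
  refine uf_ray (d := pos' A1 - pos' A2) ?_ ?_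
  · intro h
    rw [sub_eq_zero.1 h] at hpos
    simp [det3] at hpos
  · intro t ht hm
    have := hX _ hm
    have e : det3 (pos' A3) (pos' A2) (pos' A1 + t • (pos' A1 - pos' A2)) =
        (1 + t) * det3 (pos' A1) (pos' A3) (pos' A2) := by
      simp [det3]; ring
    rw [e] at this
    nlinarith

theorem final_draw {A1 A2 A3 : ℝ × ℝ} (D : Draw id A1 A2 A3 P F) (hp : IsPlanarDrawing G pos)
    (hBn : ∀ a, (B a).Nonempty)
    (hB : Pairwise fun a b => Disjoint (B a) (B b))
    (hBc : ∀ a, (G.induce (B a)).Connected)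
    (hBa : ∀ a b, H.Adj a b → ∃ x ∈ B a, ∃ y ∈ B b, G.Adj x y)
    (hkey : Function.Injective key)
    (hkeyS : ∀ h h' i, key h < key h' → h ∈ drawingPeel G pos i → h' ∈ drawingPeel G pos i)
    (hP : ∀ g, pos g ∈ P)
    (hJ : ∀ g g', G.Adj g g' → Joined F (pos g) (pos g'))
    (hfree : ∀ x, Cor A1 A2 A3 x → ∀ g, ¬ Own G key F pos x g)
    (hchain : ∀ i g, g ∈ outerVertices G pos (drawingPeel G pos i) →
      ReflTransGen (fun p q => Adj F p q ∧ (q = pos g ∨ q ∉ drawnSet G pos (drawingPeel G pos i)))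
        (pos g) A1) :
    ∃ posH : α → ℝ × ℝ, IsPlanarDrawing H posH ∧
      ∀ i a, a ∈ drawingPeel H posH i → B a ⊆ drawingPeel G pos i := by
  have hL : Lab (lab G key F pos B) A1 A2 A3 P F := lab_lab D hp hB hBc hkey hJ hfree
  have hinr : ∀ {x a}, lab G key F pos B x = Sum.inr a → ¬ Cor A1 A2 A3 x := by
    intro x a hx hc
    rw [lab_free (hfree x hc)] at hx
    cases hx
  obtain ⟨P', F', hsub, hL', hinj, hsurj, hadj⟩ := Lab.reduce _ P F rfl hL
  obtain ⟨pos', D'⟩ := draw_exists _ P' F' rfl hL'.tri hL'.face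
  have T' := hL'.tri
  have hlabpos : ∀ {g a}, g ∈ B a → lab G key F pos B (pos g) = Sum.inr a :=
    fun hg => lab_of hp hB hg (Or.inl rfl)
  have hrep : ∀ a, ∃ v ∈ P', lab G key F pos B v = Sum.inr a := by
    intro a
    obtain ⟨g, hg⟩ := hBn a
    obtain ⟨v, hv, he⟩ := hsurj _ (hP g)
    exact ⟨v, hv, he.trans (hlabpos hg)⟩
  choose rep repP repL using hrep
  have rep_eq : ∀ {v a}, v ∈ P' → lab G key F pos B v = Sum.inr a → v = rep a := fun hv h =>
    hinj hv (repP _) (h.trans (repL _).symm)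
  have rep_inj : Function.Injective rep := by
    intro a b h
    have := repL a
    rw [h, repL b] at this
    exact (Sum.inr.inj this).symm
  have radj1 : ∀ {a b x y}, a ≠ b → x ∈ B a → y ∈ B b → G.Adj x y → key x < key y →
      Adj F' (rep a) (rep b) := by
    intro a b x y hab hx hy hxy hk
    obtain ⟨p, h1, h2⟩ := half_end hp hxy (hJ x y hxy)
    have e1 := lab_of hp hB hx (Or.inr ⟨y, hxy, hk, h1⟩ : Own G key F pos p x)
    have e2 := hlabpos hy
    obtain ⟨u', v', h3, h4, h5⟩ := hadj _ _ h2 (by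
      rw [e1, e2]; exact fun h => hab (Sum.inr.inj h))
    rw [← rep_eq (T'.adj_mem h3) (h4.trans e1), ← rep_eq (T'.adj_mem (T'.adj_symm h3)) (h5.trans e2)]
    exact h3
  have radj : ∀ {a b}, H.Adj a b → Adj F' (rep a) (rep b) := by
    intro a b hab
    obtain ⟨x, hx, y, hy, hxy⟩ := hBa a b hab
    rcases lt_trichotomy (key x) (key y) with h | h | h
    · exact radj1 hab.ne hx hy hxy h
    · exact absurd (hkey h) hxy.ne
    · exact T'.adj_symm (radj1 hab.ne.symm hy hx hxy.symm h)
  have symne : ∀ {x y a b}, y ≠ rep a → y ≠ rep b → s(x, y) ≠ s(rep a, rep b) := by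
    intro x y a b h1 h2 he
    rcases Sym2.eq_iff.1 he with ⟨_, e⟩ | ⟨_, e⟩
    · exact h2 e
    · exact h1 e
  refine ⟨fun a => pos' (rep a), ⟨?_, ?_, ?_⟩, ?_⟩
  · intro a b h
    exact rep_inj (D'.inj (repP a) (repP b) h)
  · intro u v w huv hwu hwv hm
    rcases D'.WE (radj huv) (repP w) hm with e | e
    · exact hwu (rep_inj e)
    · exact hwv (rep_inj e)
  · intro u v x y huv hxy hne p h1 h2
    refine D'.XX (radj huv) (radj hxy) ?_ h1 h2
    intro he
    apply hne
    rcases Sym2.eq_iff.1 he with ⟨e1, e2⟩ | ⟨e1, e2⟩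
    · rw [rep_inj e1, rep_inj e2]
    · rw [rep_inj e1, rep_inj e2, Sym2.eq_swap]
  intro i
  induction i with
  | zero => intro a _; exact Set.subset_univ _
  | succ i ih =>
    intro a ha g hg
    refine ⟨ih a ha.1 hg, fun hout => ha.2 ⟨ha.1, ?_⟩⟩
    set S := drawingPeel H (fun a => pos' (rep a)) i with hS
    -- labels of points outside the drawing
    have hgood : ∀ q, q ∉ drawnSet G pos (drawingPeel G pos i) → ∀ b ∈ S,
        lab G key F pos B q ≠ Sum.inr b := by
      intro q hq b hb he
      apply hq
      obtain ⟨h, hh, ho⟩ := lab_own he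
      rcases ho.seg with e | ⟨h', a1, k1, s1⟩
      · exact mem_drawn.2 (Or.inl ⟨h, ih b hb hh, e⟩)
      · exact mem_drawn.2 (Or.inr ⟨h, h', ih b hb hh, hkeyS h h' i k1 (ih b hb hh), a1, s1⟩)
    -- chain in the contracted triangulation
    have hc : ∀ q, ReflTransGen (fun p q => Adj F p q ∧
        (q = pos g ∨ q ∉ drawnSet G pos (drawingPeel G pos i))) (pos g) q →
        ∃ q' ∈ P', lab G key F pos B q' = lab G key F pos B q ∧
          ReflTransGen (fun x y => Adj F' x y ∧ (y = rep a ∨ ∀ b ∈ S, y ≠ rep b)) (rep a) q' := by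
      intro q hq
      induction hq with
      | refl => exact ⟨rep a, repP a, (repL a).trans (hlabpos hg).symm, .refl⟩
      | @tail q1 q2 _ hstep ihc =>
        obtain ⟨q', hq', e', hch⟩ := ihc
        by_cases hsame : lab G key F pos B q1 = lab G key F pos B q2
        · exact ⟨q', hq', e'.trans hsame, hch⟩
        · obtain ⟨u', v', h3, h4, h5⟩ := hadj _ _ hstep.1 hsame
          have hu : u' = q' := hinj (T'.adj_mem h3) hq' (h4.trans e'.symm)
          subst hu
          have hv' := T'.adj_mem (T'.adj_symm h3)
          refine ⟨v', hv', h5, hch.tail ⟨h3, ?_⟩⟩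
          rcases hstep.2 with e | e
          · left
            apply rep_eq hv'
            rw [h5, e]
            exact hlabpos hg
          · right
            intro b hb hvb
            apply hgood q2 e b hb
            rw [← h5, hvb]
            exact repL b
    have hrA1 : ∀ b, rep b ≠ A1 := fun b h => hinr (repL b) (Or.inl h)
    have hrA2 : ∀ b, rep b ≠ A2 := fun b h => hinr (repL b) (Or.inr (Or.inl h))
    have hrA3 : ∀ b, rep b ≠ A3 := fun b h => hinr (repL b) (Or.inr (Or.inr h))
    obtain ⟨q', hq', e', hch⟩ := hc _ (hchain i g hout)
    have hqA : q' = A1 := hL'.sa q' hq' e'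
    rw [hqA] at hch
    obtain ⟨p, hp1, hp2, hp3⟩ := rtg_first hch (hrA1 a)
    have hpn : ∀ b ∈ S, p ≠ rep b := hp1.2.resolve_left hp2
    have hpP : p ∈ P' := T'.adj_mem (T'.adj_symm hp1.1)
    have huf : p ∈ P' → (∀ b ∈ S, p ≠ rep b) →
        pos' p ∈ unboundedFace (drawnSet H (fun a => pos' (rep a)) S) := by
      clear hp1 hp2 hpn hpP
      induction hp3 using ReflTransGen.head_induction_on with
      | refl => intro _ _; exact corner_uf D' repP hrA1 hrA2 hrA3 S
      | @head x y hxy _ ihx =>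
        intro hxP hxn
        have hyn : ∀ b ∈ S, y ≠ rep b := hxy.1.2.resolve_left hxy.2
        have hyP := T'.adj_mem (T'.adj_symm hxy.1.1)
        refine uf_seg ?_ (ihx hyP hyn)
        intro z hz hzX
        rcases mem_drawn.1 hzX with ⟨b, hb, rfl⟩ | ⟨b, b', hb, hb', hbb, hzs⟩
        · rcases D'.WE hxy.1.1 (repP b) hz with e | e
          · exact hxn b hb e.symm
          · exact hyn b hb e.symm
        · obtain ⟨e1, e2⟩ := D'.XX hxy.1.1 (radj hbb) (symne (hyn b hb) (hyn b' hb')) hz hzs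
          rcases e1 with e1 | e1 <;> rcases e2 with e2 | e2
          · exact hxn b hb (D'.inj hxP (repP b) (e1.symm.trans e2))
          · exact hxn b' hb' (D'.inj hxP (repP b') (e1.symm.trans e2))
          · exact hyn b hb (D'.inj hyP (repP b) (e1.symm.trans e2))
          · exact hyn b' hb' (D'.inj hyP (repP b') (e1.symm.trans e2))
    refine closure_uf (q := pos' p) ?_ (huf hpP hpn)
    intro s s0 s1 hzX
    have hz : lin (pos' (rep a)) (pos' p) s ∈ segment ℝ (pos' (rep a)) (pos' p) :=
      seg_iff.2 ⟨s, s0.le, s1, rfl⟩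
    have hne : pos' (rep a) ≠ pos' p := fun e => hp2 (D'.inj hpP (repP a) e.symm)
    have hn0 : lin (pos' (rep a)) (pos' p) s ≠ pos' (rep a) := by
      intro e
      exact s0.ne' (lin_inj hne (e.trans (lin_zero (pos' (rep a)) (pos' p)).symm))
    rcases mem_drawn.1 hzX with ⟨b, hb, hb2⟩ | ⟨b, b', hb, hb', hbb, hzs⟩
    · rw [hb2] at hz hn0
      rcases D'.WE hp1.1 (repP b) hz with e | e
      · rw [e] at hn0; exact hn0 rfl
      · exact hpn b hb e.symm
    · obtain ⟨e1, e2⟩ := D'.XX hp1.1 (radj hbb) (symne (hpn b hb) (hpn b' hb')) hz hzs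
      have e1 := e1.resolve_left hn0
      rcases e2 with e2 | e2
      · exact hpn b hb (D'.inj hpP (repP b) (e1.symm.trans e2))
      · exact hpn b' hb' (D'.inj hpP (repP b') (e1.symm.trans e2))

end final
end OPM


namespace OPM
open Filter Topology Relation
section main

variable {α β : Type*} {H : SimpleGraph α} {G : SimpleGraph β} {pos : β → ℝ × ℝ}

lemma inO_box {N : ℝ} (hN : 0 < N) {p : ℝ × ℝ} (hp : ‖p‖ ≤ N) :
    InO ((0, 4 * N) : ℝ × ℝ) (- (4 * N), - (2 * N)) (4 * N, - (2 * N)) p := by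
  have h1 := abs_le.1 ((norm_fst_le p).trans hp)
  have h2 := abs_le.1 ((norm_snd_le p).trans hp)
  refine ⟨?_, ?_, ?_⟩
  · have e : det3 ((0, 4 * N) : ℝ × ℝ) (- (4 * N), - (2 * N)) p = N * (16 * N - 4 * p.2 + 6 * p.1) := by
      simp only [det3]; ring
    rw [e]; apply mul_pos hN; linarith
  · have e : det3 ((- (4 * N), - (2 * N)) : ℝ × ℝ) (4 * N, - (2 * N)) p = N * (16 * N + 8 * p.2) := by
      simp only [det3]; ring
    rw [e]; apply mul_pos hN; linarith
  · have e : det3 ((4 * N, - (2 * N)) : ℝ × ℝ) (0, 4 * N) p = N * (16 * N - 4 * p.2 - 6 * p.1) := by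
      simp only [det3]; ring
    rw [e]; apply mul_pos hN; linarith

theorem minor_draw [Fintype β] (hp : IsPlanarDrawing G pos) (hm : IsMinor H G) {k : ℕ}
    (hk : drawingPeel G pos k = ∅) :
    ∃ posH : α → ℝ × ℝ, IsPlanarDrawing H posH ∧ drawingPeel H posH k = ∅ := by
  obtain ⟨B, hBn, hBc, hB, hBa⟩ := hm
  have hanti : Antitone (drawingPeel G pos) := antitone_nat_of_succ_le peel_anti
  obtain ⟨key, hkey, hkeyS⟩ := key_exists (drawingPeel G pos) peel_anti hk
  have hesc : ∀ t : β × Fin k, ∃ (L : List ((ℝ × ℝ) × (ℝ × ℝ))) (R : ℝ),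
      t.1 ∈ outerVertices G pos (drawingPeel G pos t.2) →
      (∀ e ∈ L, ∀ z ∈ segment ℝ e.1 e.2, z = pos t.1 ∨ z ∉ drawnSet G pos (drawingPeel G pos t.2)) ∧
      ReflTransGen (fun p p' => (p, p') ∈ L) (pos t.1) (0, R) ∧
      ∀ Y, R ≤ Y → ∀ z ∈ segment ℝ ((0, R) : ℝ × ℝ) (0, Y),
        z ∉ drawnSet G pos (drawingPeel G pos t.2) := by
    intro t
    by_cases h : t.1 ∈ outerVertices G pos (drawingPeel G pos t.2)
    · obtain ⟨E, hE, hX⟩ := drawn_fin (G := G) (pos := pos) (drawingPeel G pos t.2)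
      obtain ⟨L, R, h1⟩ := escape hE hX h.2
      exact ⟨L, R, fun _ => h1⟩
    · exact ⟨[], 0, fun h' => absurd h' h⟩
  choose L R hLR using hesc
  have hZ : (Set.range pos ∪ ⋃ t, (Prod.fst '' {e | e ∈ L t} ∪ Prod.snd '' {e | e ∈ L t} ∪
      {((0, R t) : ℝ × ℝ)})).Finite := by
    refine (Set.finite_range _).union (Set.finite_iUnion fun t => ?_)
    refine Set.Finite.union (Set.Finite.union ?_ ?_) (Set.finite_singleton _)
    · exact (List.finite_toSet (L t)).image _
    · exact (List.finite_toSet (L t)).image _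
  obtain ⟨N0, hN0⟩ := hZ.isBounded.exists_norm_le
  set N := max N0 1 with hNdef
  have hN : 0 < N := lt_of_lt_of_le one_pos (le_max_right _ _)
  have hNle : N0 ≤ N := le_max_left _ _
  have npos : ∀ g, ‖pos g‖ ≤ N := fun g => (hN0 _ (Or.inl ⟨g, rfl⟩)).trans hNle
  have nL1 : ∀ t, ∀ e ∈ L t, ‖e.1‖ ≤ N := fun t e he =>
    (hN0 _ (Or.inr (Set.mem_iUnion.2 ⟨t, Or.inl (Or.inl ⟨e, he, rfl⟩)⟩))).trans hNle
  have nL2 : ∀ t, ∀ e ∈ L t, ‖e.2‖ ≤ N := fun t e he =>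
    (hN0 _ (Or.inr (Set.mem_iUnion.2 ⟨t, Or.inl (Or.inr ⟨e, he, rfl⟩)⟩))).trans hNle
  have nR : ∀ t, ‖((0, R t) : ℝ × ℝ)‖ ≤ N := fun t =>
    (hN0 _ (Or.inr (Set.mem_iUnion.2 ⟨t, Or.inr rfl⟩))).trans hNle
  have hEs : (Set.range (fun t : β × β => (pos t.1, pos t.2)) ∪ (⋃ t, {e | e ∈ L t}) ∪
      Set.range (fun t => (((0, R t) : ℝ × ℝ), ((0, 4 * N) : ℝ × ℝ)))).Finite :=
    ((Set.finite_range _).union (Set.finite_iUnion fun t => List.finite_toSet (L t))).union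
      (Set.finite_range _)
  obtain ⟨P0, F0, D0, hO⟩ := k4_draw hN
  have hfar : ∀ x, Cor ((0, 4 * N) : ℝ × ℝ) (4 * N, - (2 * N)) (- (4 * N), - (2 * N)) x → N < ‖x‖ := by
    rintro x (rfl | rfl | rfl)
    · refine lt_of_lt_of_le ?_ (norm_snd_le _)
      rw [Real.norm_eq_abs]
      exact lt_of_lt_of_le (by linarith) (le_abs_self _)
    · refine lt_of_lt_of_le ?_ (norm_snd_le _)
      rw [Real.norm_eq_abs]
      exact lt_of_lt_of_le (by simp; linarith) (neg_le_abs _)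
    · refine lt_of_lt_of_le ?_ (norm_snd_le _)
      rw [Real.norm_eq_abs]
      exact lt_of_lt_of_le (by simp; linarith) (neg_le_abs _)
  have hco : ¬ Cor ((0, 4 * N) : ℝ × ℝ) (4 * N, - (2 * N)) (- (4 * N), - (2 * N)) (0, 0) := by
    intro h
    have := hfar _ h
    simp at this
    linarith
  obtain ⟨P, F, D, _, hjoin⟩ := D0.refine_all hco hO hEs.toFinset.toList (by
    intro e he
    rw [Finset.mem_toList, Set.Finite.mem_toFinset] at he
    rcases he with (⟨t, rfl⟩ | he) | ⟨t, rfl⟩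
    · exact ⟨inO_box hN (npos _), Or.inl (inO_box hN (npos _))⟩
    · obtain ⟨t, ht⟩ := Set.mem_iUnion.1 he
      exact ⟨inO_box hN (nL1 t e ht), Or.inl (inO_box hN (nL2 t e ht))⟩
    · exact ⟨inO_box hN (nR t), Or.inr rfl⟩)
  have hjoin : ∀ e, e ∈ (Set.range (fun t : β × β => (pos t.1, pos t.2)) ∪ (⋃ t, {e | e ∈ L t}) ∪
      Set.range (fun t => (((0, R t) : ℝ × ℝ), ((0, 4 * N) : ℝ × ℝ)))) →
      e.1 ∈ P ∧ Joined F e.1 e.2 := fun e he => hjoin e (by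
    rw [Finset.mem_toList, Set.Finite.mem_toFinset]; exact he)
  have hchain : ∀ i g, g ∈ outerVertices G pos (drawingPeel G pos i) →
      ReflTransGen (fun p q => Adj F p q ∧ (q = pos g ∨ q ∉ drawnSet G pos (drawingPeel G pos i)))
        (pos g) (0, 4 * N) := by
    intro i g hg
    have hik : i < k := by
      by_contra hcon
      have := hanti (not_lt.1 hcon) hg.1
      rw [hk] at this
      exact this
    obtain ⟨h1, h2, h3⟩ := hLR (g, ⟨i, hik⟩) hg
    have hstep : ∀ {z1 z2 : ℝ × ℝ}, (∀ z ∈ segment ℝ z1 z2, z = pos g ∨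
        z ∉ drawnSet G pos (drawingPeel G pos i)) → Joined F z1 z2 →
        ReflTransGen (fun p q => Adj F p q ∧ (q = pos g ∨ q ∉ drawnSet G pos (drawingPeel G pos i)))
        z1 z2 := by
      intro z1 z2 hz hj
      exact ReflTransGen.mono (fun p q hpq => ⟨hpq.1, hz q hpq.2.2⟩) _ _ hj
    have hall : ∀ z, ReflTransGen (fun p p' => (p, p') ∈ L (g, ⟨i, hik⟩)) (pos g) z →
        ReflTransGen (fun p q => Adj F p q ∧ (q = pos g ∨ q ∉ drawnSet G pos (drawingPeel G pos i)))
        (pos g) z := by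
      intro z hz
      induction hz with
      | refl => exact .refl
      | @tail y z _ hyz ih =>
        refine ih.trans (hstep (h1 (y, z) hyz) ?_)
        exact (hjoin (y, z) (Or.inl (Or.inr (Set.mem_iUnion.2 ⟨_, hyz⟩)))).2
    refine (hall _ h2).trans (hstep ?_ (hjoin _ (Or.inr ⟨(g, ⟨i, hik⟩), rfl⟩)).2)
    intro z hz
    refine Or.inr (h3 (4 * N) ?_ z hz)
    have := (le_abs_self _).trans ((norm_snd_le _).trans (nR (g, ⟨i, hik⟩)))
    simp only at this
    linarith
  have hfree : ∀ x, Cor ((0, 4 * N) : ℝ × ℝ) (4 * N, - (2 * N)) (- (4 * N), - (2 * N)) x →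
      ∀ g, ¬ Own G key F pos x g := by
    intro x hx g ho
    have h := hfar x hx
    rcases ho.seg with e | ⟨g', _, _, hs⟩
    · rw [e] at h; exact absurd (npos g) (not_le.2 h)
    · have := (convex_closedBall (0 : ℝ × ℝ) N).segment_subset
        (mem_closedBall_zero_iff.2 (npos g)) (mem_closedBall_zero_iff.2 (npos g')) hs
      exact absurd (mem_closedBall_zero_iff.1 this) (not_le.2 h)
  obtain ⟨posH, hH, hcl⟩ := final_draw (H := H) D hp hBn hB hBc hBa hkey hkeyS
    (fun g => (hjoin (pos g, pos g) (Or.inl (Or.inl ⟨(g, g), rfl⟩))).1)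
    (fun g g' _ => (hjoin (pos g, pos g') (Or.inl (Or.inl ⟨(g, g'), rfl⟩))).2)
    hfree hchain
  refine ⟨posH, hH, Set.eq_empty_iff_forall_notMem.2 fun a ha => ?_⟩
  obtain ⟨g, hg⟩ := hBn a
  have := hcl k a ha hg
  rw [hk] at this
  exact this

theorem main_thm [Fintype β] (hG : ∃ pos : β → ℝ × ℝ, IsPlanarDrawing G pos) (hm : IsMinor H G) :
    outerplanarity H ≤ outerplanarity G := by
  have hne : {k | ∃ pos : β → ℝ × ℝ, IsPlanarDrawing G pos ∧ drawingPeel G pos k = ∅}.Nonempty := by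
    obtain ⟨pos, hp⟩ := hG
    obtain ⟨k, hk⟩ := peel_empty (G := G) (pos := pos)
    exact ⟨k, pos, hp, hk⟩
  obtain ⟨pos, hp, hk⟩ := Nat.sInf_mem hne
  obtain ⟨posH, h1, h2⟩ := minor_draw hp hm hk
  exact Nat.sInf_le ⟨posH, h1, h2⟩

end main
end OPM

/-- Outer-planarity is minor-monotone among planar graphs: if a
planar graph `H` is a minor of a planar graph `G`, then `op(H) ≤ op(G)`. -/
theorem outerplanarity_minor_monotone {α β : Type*} [Fintype α] [Fintype β]
    (H : SimpleGraph α) (G : SimpleGraph β)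
    (hHpl : ∃ pos : α → ℝ × ℝ, IsPlanarDrawing H pos)
    (hGpl : ∃ pos : β → ℝ × ℝ, IsPlanarDrawing G pos)
    (hminor : IsMinor H G) :
    outerplanarity H ≤ outerplanarity G := by
  exact OPM.main_thm hGpl hminor
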